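/- Let p be a semihyperbolic polynomial of degree d ≥ 2 without attracting periodic points, and let f be a Poincaré function of p at a repelling fixed point. Then logarea(Δ \ (A(f) ∩ J(f))) < ∞. In particular, area(A(f) ∩ J(f)) > 0. -/

import Mathlib

open MeasureTheory Filter Metric Set Topology ENNReal

/-- Logarithmic area of a subset of the plane. -/
noncomputable def logArea (A : Set ℂ) : ℝ≥0∞ :=
  ∫⁻ z in A, ENNReal.ofReal ((‖z‖ ^ 2)⁻¹)

/-- The set Δ = {z : |z| ≥ 1}. -/
def Delta : Set ℂ := {z : ℂ | 1 ≤ ‖z‖}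

/-- Chordal (spherical) distance on the Riemann sphere ℂ ∪ {∞}, with ∞ encoded as `none`. -/
noncomputable def chordalDist : Option ℂ → Option ℂ → ℝ
  | none, none => 0
  | none, some w => 2 / Real.sqrt (1 + ‖w‖ ^ 2)
  | some z, none => 2 / Real.sqrt (1 + ‖z‖ ^ 2)
  | some z, some w =>
      2 * ‖z - w‖ / (Real.sqrt (1 + ‖z‖ ^ 2) * Real.sqrt (1 + ‖w‖ ^ 2))

/-- Locally uniform convergence on `U` of a sequence of ℂ-valued functions towards a
function with values in the Riemann sphere, with respect to the spherical metric. -/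
def SphLocUnifConvOn (F : ℕ → ℂ → ℂ) (g : ℂ → Option ℂ) (U : Set ℂ) : Prop :=
  ∀ K : Set ℂ, K ⊆ U → IsCompact K → ∀ ε : ℝ, 0 < ε →
    ∀ᶠ n in atTop, ∀ z ∈ K, chordalDist (some (F n z)) (g z) < ε

/-- The Fatou set: points having a neighborhood on which every sequence of iterates has a
subsequence converging locally uniformly with respect to the spherical metric. -/
def fatouSet (f : ℂ → ℂ) : Set ℂ :=
  {z | ∃ U ∈ 𝓝 z, ∀ φ : ℕ → ℕ, StrictMono φ →
    ∃ ψ : ℕ → ℕ, StrictMono ψ ∧ ∃ g : ℂ → Option ℂ,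
      SphLocUnifConvOn (fun n => f^[φ (ψ n)]) g U}

/-- The Julia set. -/
def juliaSet (f : ℂ → ℂ) : Set ℂ := (fatouSet f)ᶜ

/-- The escaping set. -/
def escapingSet (f : ℂ → ℂ) : Set ℂ :=
  {z | Tendsto (fun n => ‖f^[n] z‖) atTop atTop}

/-- The Fatou set has no multiply connected component. -/
def NoMultiplyConnectedFatouComponent (f : ℂ → ℂ) : Prop :=
  ∀ z ∈ fatouSet f, SimplyConnectedSpace (connectedComponentIn (fatouSet f) z)

/-- Maximum modulus M(r,f). -/
noncomputable def maxMod (f : ℂ → ℂ) (r : ℝ) : ℝ :=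
  sSup ((fun z => ‖f z‖) '' {z : ℂ | ‖z‖ = r})

/-- The order ρ(f) of an entire function, as an extended real number. -/
noncomputable def entireOrder (f : ℂ → ℂ) : EReal :=
  limsup (fun r : ℝ => ((Real.log (Real.log (maxMod f r)) / Real.log r : ℝ) : EReal)) atTop

/-- The fast escaping set A(f). -/
def fastEscapingSet (f : ℂ → ℂ) : Set ℂ :=
  {z | ∃ R : ℝ, 0 < R ∧ (∀ r : ℝ, R ≤ r → r < maxMod f r) ∧
    ∃ L : ℕ, ∀ n : ℕ, L < n → (maxMod f)^[n - L] R ≤ ‖f^[n] z‖}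

/-- `f` is a transcendental entire function. -/
def TranscendentalEntire (f : ℂ → ℂ) : Prop :=
  Differentiable ℂ f ∧ ¬ ∃ p : Polynomial ℂ, ∀ z, f z = p.eval z

/-- Order of vanishing of `g` at `z` (the least `k` with nonzero `k`-th derivative). -/
noncomputable def vanishingOrder (g : ℂ → ℂ) (z : ℂ) : ℕ :=
  sInf {k : ℕ | iteratedDeriv k g z ≠ 0}

/-- n(r,a): the number of solutions of f(z) = a with |z| ≤ r, counted with multiplicity. -/
noncomputable def nCount (f : ℂ → ℂ) (a : ℂ) (r : ℝ) : ℕ :=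
  ∑ᶠ z ∈ {z : ℂ | ‖z‖ ≤ r ∧ f z = a}, vanishingOrder (fun w => f w - a) z

/-- n(r) = max over a of n(r,a). -/
noncomputable def nMax (f : ℂ → ℂ) (r : ℝ) : ℕ := ⨆ a : ℂ, nCount f a r

/-- Critical values of `f`. -/
def criticalValues (f : ℂ → ℂ) : Set ℂ := {w | ∃ z, deriv f z = 0 ∧ f z = w}

/-- Finite asymptotic values of `f`. -/
def asymptoticValues (f : ℂ → ℂ) : Set ℂ :=
  {w | ∃ γ : ℝ → ℂ, Continuous γ ∧ Tendsto (fun t => ‖γ t‖) atTop atTop ∧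
    Tendsto (fun t => f (γ t)) atTop (𝓝 w)}

/-- The Eremenko–Lyubich class B. -/
def ELClass (f : ℂ → ℂ) : Prop :=
  TranscendentalEntire f ∧ Bornology.IsBounded (criticalValues f ∪ asymptoticValues f)

/-- Semihyperbolic polynomial. -/
def SemiHyperbolic (p : Polynomial ℂ) : Prop :=
  ∃ ε : ℝ, 0 < ε ∧ ∃ N : ℕ, ∀ z ∈ juliaSet (fun w => p.eval w), ∀ n : ℕ, 1 ≤ n →
    ∀ V : Set ℂ, (∃ u ∈ (fun w => p.eval w)^[n] ⁻¹' ball z ε,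
        V = connectedComponentIn ((fun w => p.eval w)^[n] ⁻¹' ball z ε) u) →
      ∀ w ∈ ball z ε,
        (∑ᶠ u ∈ {u : ℂ | u ∈ V ∧ (fun v => p.eval v)^[n] u = w},
          vanishingOrder (fun ζ => (fun v => p.eval v)^[n] ζ - w) u) ≤ N

/-- The connected component containing `x` of the preimage of a disc under a polynomial. -/
def pcomp (q : Polynomial ℂ) (z : ℂ) (r : ℝ) (x : ℂ) : Set ℂ :=
  connectedComponentIn ((fun w => q.eval w) ⁻¹' ball z r) x

lemma isOpen_preimage_ball (q : Polynomial ℂ) (z : ℂ) (r : ℝ) :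
    IsOpen ((fun w => q.eval w) ⁻¹' ball z r) :=
  isOpen_ball.preimage q.continuous

lemma isOpen_pcomp (q : Polynomial ℂ) (z : ℂ) (r : ℝ) (x : ℂ) : IsOpen (pcomp q z r x) :=
  (isOpen_preimage_ball q z r).connectedComponentIn

lemma norm_lt_of_mem_pcomp {q : Polynomial ℂ} {z : ℂ} {r : ℝ} {x w : ℂ}
    (hw : w ∈ pcomp q z r x) : ‖q.eval w - z‖ < r := by
  have := connectedComponentIn_subset _ _ hw
  simpa [dist_eq_norm] using this

lemma self_mem_pcomp {q : Polynomial ℂ} {z : ℂ} {r : ℝ} {x : ℂ}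
    (hx : ‖q.eval x - z‖ < r) : x ∈ pcomp q z r x :=
  mem_connectedComponentIn (by simpa [dist_eq_norm] using hx)

lemma pcomp_eq {q : Polynomial ℂ} {z : ℂ} {r : ℝ} {x w : ℂ}
    (hw : w ∈ pcomp q z r x) : pcomp q z r x = pcomp q z r w :=
  connectedComponentIn_eq hw

lemma pcomp_nonempty_imp {q : Polynomial ℂ} {z : ℂ} {r : ℝ} {x w : ℂ}
    (hw : w ∈ pcomp q z r x) : ‖q.eval x - z‖ < r := by
  have h : (pcomp q z r x).Nonempty := ⟨w, hw⟩
  have := connectedComponentIn_nonempty_iff.1 h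
  simpa [dist_eq_norm] using this

lemma subset_pcomp {q : Polynomial ℂ} {z : ℂ} {r : ℝ} {x w : ℂ} {S : Set ℂ}
    (hS : IsPreconnected S) (h : ∀ v ∈ S, ‖q.eval v - z‖ < r) (hwS : w ∈ S)
    (hw : w ∈ pcomp q z r x) : S ⊆ pcomp q z r x := by
  rw [pcomp_eq hw]
  exact hS.subset_connectedComponentIn hwS (fun v hv => by simpa [dist_eq_norm] using h v hv)

lemma isPreconnected_pcomp (q : Polynomial ℂ) (z : ℂ) (r : ℝ) (x : ℂ) :
    IsPreconnected (pcomp q z r x) := isPreconnected_connectedComponentIn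

lemma mem_pcomp_of_mem_closure {q : Polynomial ℂ} {z : ℂ} {r : ℝ} {x w : ℂ}
    (hw : w ∈ closure (pcomp q z r x)) (hr : ‖q.eval w - z‖ < r) : w ∈ pcomp q z r x := by
  obtain ⟨v, hv1, hv2⟩ := mem_closure_iff.1 hw _ (isOpen_pcomp q z r w) (self_mem_pcomp hr)
  rw [pcomp_eq hv2, ← pcomp_eq hv1]
  exact self_mem_pcomp hr

lemma norm_le_of_mem_closure_pcomp {q : Polynomial ℂ} {z : ℂ} {r : ℝ} {x w : ℂ}
    (hw : w ∈ closure (pcomp q z r x)) : ‖q.eval w - z‖ ≤ r := by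
  have hc : IsClosed {w : ℂ | ‖q.eval w - z‖ ≤ r} :=
    isClosed_le (by fun_prop) continuous_const
  exact closure_minimal (fun v hv => (norm_lt_of_mem_pcomp hv).le) hc hw

lemma norm_eq_of_mem_frontier_pcomp {q : Polynomial ℂ} {z : ℂ} {r : ℝ} {x w : ℂ}
    (hw : w ∈ frontier (pcomp q z r x)) : ‖q.eval w - z‖ = r := by
  rw [frontier, (isOpen_pcomp q z r x).interior_eq] at hw
  refine le_antisymm (norm_le_of_mem_closure_pcomp hw.1) ?_
  by_contra! h
  exact hw.2 (mem_pcomp_of_mem_closure hw.1 h)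

lemma isBounded_preimage_ball {q : Polynomial ℂ} (hq : 1 ≤ q.natDegree) (z : ℂ) (r : ℝ) :
    Bornology.IsBounded {w : ℂ | ‖q.eval w - z‖ ≤ r} := by
  have h1 : Tendsto (fun w : ℂ => ‖q.eval w‖) (Bornology.cobounded ℂ) atTop :=
    Polynomial.tendsto_norm_atTop q (Polynomial.natDegree_pos_iff_degree_pos.1 hq)
      tendsto_norm_cobounded_atTop
  have h2 := h1.eventually_gt_atTop (r + ‖z‖)
  have : Bornology.IsBounded {w : ℂ | r + ‖z‖ < ‖q.eval w‖}ᶜ :=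
    Bornology.isBounded_compl_iff.2 (Bornology.isCobounded_def.2 h2)
  refine this.subset fun w hw => ?_
  simp only [mem_compl_iff, mem_ofPred_eq, not_lt] at hw ⊢
  calc ‖q.eval w‖ = ‖(q.eval w - z) + z‖ := by ring_nf
    _ ≤ _ := (norm_add_le _ _).trans (by linarith)

lemma isBounded_pcomp {q : Polynomial ℂ} (hq : 1 ≤ q.natDegree) (z : ℂ) (r : ℝ) (x : ℂ) :
    Bornology.IsBounded (pcomp q z r x) :=
  (isBounded_preimage_ball hq z r).subset fun _ hw => (norm_lt_of_mem_pcomp hw).le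

lemma image_pcomp {q : Polynomial ℂ} (hq : 1 ≤ q.natDegree) {z : ℂ} {r : ℝ} {x : ℂ}
    (hx : ‖q.eval x - z‖ < r) : ball z r ⊆ (fun w => q.eval w) '' pcomp q z r x := by
  have hopen : IsOpen ((fun w => q.eval w) '' pcomp q z r x) :=
    (Polynomial.isOpenQuotientMap_eval q (by omega)).isOpenMap _ (isOpen_pcomp q z r x)
  refine IsPreconnected.subset_of_closure_inter_subset (convex_ball z r).isPreconnected hopen
    ⟨q.eval x, by simpa [dist_eq_norm] using hx, mem_image_of_mem _ (self_mem_pcomp hx)⟩ ?_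
  rintro v ⟨hv, hvb⟩
  have hK : IsCompact (closure (pcomp q z r x)) := (isBounded_pcomp hq z r x).isCompact_closure
  have hcl : closure ((fun w => q.eval w) '' pcomp q z r x) ⊆
      (fun w => q.eval w) '' closure (pcomp q z r x) :=
    closure_minimal (image_mono subset_closure) (hK.image q.continuous).isClosed
  obtain ⟨w, hw, rfl⟩ := hcl hv
  exact ⟨w, mem_pcomp_of_mem_closure hw (by simpa [dist_eq_norm] using hvb), rfl⟩

lemma pcomp_mono {q : Polynomial ℂ} {z z' : ℂ} {r r' : ℝ} {x : ℂ}
    (h : ball z r ⊆ ball z' r') : pcomp q z r x ⊆ pcomp q z' r' x :=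
  connectedComponentIn_mono x (preimage_mono h)

/-- The maximum principle on the closure of a component of the preimage of a disc. -/
lemma norm_le_on_pcomp {q : Polynomial ℂ} (hq : 1 ≤ q.natDegree) {z : ℂ} {r : ℝ} {x : ℂ}
    {F : ℂ → ℂ} (hF : ∀ w ∈ closure (pcomp q z r x), DifferentiableAt ℂ F w) {C : ℝ}
    (hC : ∀ w ∈ closure (pcomp q z r x), ‖q.eval w - z‖ = r → ‖F w‖ ≤ C) {w : ℂ}
    (hw : w ∈ closure (pcomp q z r x)) : ‖F w‖ ≤ C := by
  refine Complex.norm_le_of_forall_mem_frontier_norm_le (isBounded_pcomp hq z r x)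
    ⟨fun v hv => (hF v (subset_closure hv)).differentiableWithinAt,
      fun v hv => (hF v hv).continuousAt.continuousWithinAt⟩ (fun v hv => ?_) hw
  exact hC v (frontier_subset_closure hv) (norm_eq_of_mem_frontier_pcomp hv)

lemma exists_isOpen_injOn {f : ℂ → ℂ} (hf : Differentiable ℂ f) {x : ℂ} (hx : deriv f x ≠ 0) :
    ∃ U : Set ℂ, IsOpen U ∧ x ∈ U ∧ InjOn f U := by
  have h : HasStrictDerivAt f (deriv f x) x := (hf.analyticAt x).hasStrictDerivAt
  have h2 := h.hasStrictFDerivAt_equiv hx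
  exact ⟨(h2.toOpenPartialHomeomorph f).source, (h2.toOpenPartialHomeomorph f).open_source,
    h2.mem_toOpenPartialHomeomorph_source, (h2.toOpenPartialHomeomorph f).injOn⟩

lemma lintegral_image_holo {f : ℂ → ℂ} (hf : Differentiable ℂ f) {s : Set ℂ}
    (hs : MeasurableSet s) (hinj : InjOn f s) (h : ℂ → ℝ≥0∞) :
    ∫⁻ u in f '' s, h u = ∫⁻ x in s, ENNReal.ofReal (‖deriv f x‖ ^ 2) * h (f x) := by
  rw [lintegral_image_eq_lintegral_abs_det_fderiv_mul volume hs
    (fun x _ => (hf x).hasDerivAt.complexToReal_fderiv.hasFDerivWithinAt) hinj]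
  congr 1 with x
  congr 2
  have h1 : ((deriv f x • (1 : ℂ →L[ℝ] ℂ) : ℂ →L[ℝ] ℂ) : ℂ →ₗ[ℝ] ℂ) =
      (deriv f x • (LinearMap.id : ℂ →ₗ[ℂ] ℂ)).restrictScalars ℝ := rfl
  rw [ContinuousLinearMap.det, h1, LinearMap.det_restrictScalars]
  simp [Algebra.norm_complex_eq, Complex.normSq_eq_norm_sq]

lemma lintegral_valence {f : ℂ → ℂ} (hf : Differentiable ℂ f) {s T : Set ℂ}
    (hs : MeasurableSet s) (hT : MapsTo f s T) {N : ℕ}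
    (hN : ∀ u, (s ∩ f ⁻¹' {u}).encard ≤ N) {h : ℂ → ℝ≥0∞} (hh : Measurable h) :
    ∫⁻ x in s, ENNReal.ofReal (‖deriv f x‖ ^ 2) * h (f x) ≤ N * ∫⁻ u in T, h u := by
  have hmd : Measurable (deriv f) := measurable_deriv f
  set s' := s ∩ {x | deriv f x ≠ 0} with hs'
  have hs'm : MeasurableSet s' := hs.inter (hmd (measurableSet_singleton 0).compl)
  have e1 : ∫⁻ x in s, ENNReal.ofReal (‖deriv f x‖ ^ 2) * h (f x) =
      ∫⁻ x in s', ENNReal.ofReal (‖deriv f x‖ ^ 2) * h (f x) := by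
    rw [← lintegral_indicator hs, ← lintegral_indicator hs'm]
    congr 1 with x
    by_cases hx : deriv f x = 0 <;> by_cases hxs : x ∈ s <;> simp [indicator, hs', hx, hxs]
  rw [e1]
  choose! U hUo hUx hUi using fun x (hx : x ∈ s') => exists_isOpen_injOn hf hx.2
  obtain ⟨t, hts, htc, hcov⟩ := TopologicalSpace.countable_cover_nhdsWithin
    (f := U) (s := s') fun x hx => mem_nhdsWithin_of_mem_nhds ((hUo x hx).mem_nhds (hUx x hx))
  rcases t.eq_empty_or_nonempty with rfl | htne
  · have : s' = ∅ := by simpa using hcov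
    simp [this]
  obtain ⟨e, rfl⟩ := htc.exists_eq_range htne
  have heo : ∀ n, MeasurableSet (U (e n)) := fun n => (hUo _ (hts ⟨n, rfl⟩)).measurableSet
  set P : ℕ → Set ℂ := fun n => s' ∩ disjointed (fun n => U (e n)) n with hP
  have hPm : ∀ n, MeasurableSet (P n) := fun n =>
    hs'm.inter (MeasurableSet.disjointed heo n)
  have hPd : Pairwise (Function.onFun Disjoint P) := fun i j hij =>
    (disjoint_disjointed _ hij).mono inter_subset_right inter_subset_right
  have hPU : s' = ⋃ n, P n := by
    rw [hP, ← inter_iUnion, iUnion_disjointed, left_eq_inter]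
    simpa using hcov
  have hPi : ∀ n, InjOn f (P n) := fun n => (hUi _ (hts ⟨n, rfl⟩)).mono
    (inter_subset_right.trans (disjointed_subset _ _))
  have hPim : ∀ n, MeasurableSet (f '' P n) := fun n =>
    measurable_image_of_fderivWithin (hPm n)
      (fun x _ => (hf x).hasDerivAt.complexToReal_fderiv.hasFDerivWithinAt) (hPi n)
  rw [hPU, lintegral_iUnion hPm hPd]
  calc ∑' n, ∫⁻ x in P n, ENNReal.ofReal (‖deriv f x‖ ^ 2) * h (f x)
      = ∑' n, ∫⁻ u, (f '' P n).indicator h u := by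
        congr 1 with n
        rw [← lintegral_image_holo hf (hPm n) (hPi n), lintegral_indicator (hPim n)]
    _ = ∫⁻ u, ∑' n, (f '' P n).indicator h u :=
        (lintegral_tsum fun n => (hh.indicator (hPim n)).aemeasurable).symm
    _ ≤ ∫⁻ u, T.indicator (fun u => N * h u) u := by
        refine lintegral_mono fun u => ?_
        have key : ∑' n, (f '' P n).indicator h u =
            (∑' n, (f '' P n).indicator (fun _ => 1) u) * h u := by
          rw [← ENNReal.tsum_mul_right]
          congr 1 with n
          by_cases hu : u ∈ f '' P n <;> simp [hu, indicator]
        by_cases huT : u ∈ T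
        · simp only [indicator_of_mem huT]
          rw [key]
          gcongr
          set I : Set ℕ := {n | u ∈ f '' P n} with hI
          have h1 : ∑' n, (f '' P n).indicator (fun _ => (1 : ℝ≥0∞)) u = (I.encard : ℝ≥0∞) := by
            rw [← ENNReal.tsum_set_one, tsum_subtype I (fun _ => (1 : ℝ≥0∞))]
            congr 1
          rw [h1]
          choose! x hx1 hx2 using fun n (hn : n ∈ I) => hn
          have hinj : InjOn x I := by
            intro i hi j hj hij
            by_contra hne
            exact (disjoint_left.1 (hPd hne) (hx1 i hi)) (hij ▸ hx1 j hj)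
          have h2 : I.encard ≤ (s ∩ f ⁻¹' {u}).encard := by
            rw [← hinj.encard_image]
            refine encard_le_encard ?_
            rintro _ ⟨n, hn, rfl⟩
            exact ⟨(hx1 n hn).1.1, hx2 n hn⟩
          have h3 := h2.trans (hN u)
          exact_mod_cast h3
        · have : ∀ n, u ∉ f '' P n := fun n ⟨x, hx, hxu⟩ => huT (hxu ▸ hT hx.1.1)
          simp [this]
    _ ≤ ∫⁻ u in T, N * h u := lintegral_indicator_le _ _
    _ = N * ∫⁻ u in T, h u := lintegral_const_mul _ hh

/-- Lower bound for the Dirichlet integral of a holomorphic function along a circle leaving an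
open set. -/
lemma circle_energy {g : ℂ → ℂ} (hg : Differentiable ℂ g) {b z : ℂ} {t r : ℝ}
    (ht : 0 < t) (hr : 0 < r) {O : Set ℂ} (hO : IsOpen O)
    (hb : ∀ w ∈ closure O, w ∉ O → 2 * r ≤ ‖g w - z‖) {v w : ℂ}
    (hv : v ∈ O) (hvr : ‖g v - z‖ < r) (hvt : ‖v - b‖ = t) (hw : w ∉ O) (hwt : ‖w - b‖ = t) :
    ENNReal.ofReal (r ^ 2 / (2 * Real.pi) / t) ≤
      ∫⁻ θ in Ioo (-Real.pi) Real.pi, ENNReal.ofReal t *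
        O.indicator (fun u => ENNReal.ofReal (‖deriv g u‖ ^ 2))
          (b + Complex.polarCoord.symm (t, θ)) := by
  set c : ℝ → ℂ := fun θ => b + t * Complex.exp (θ * Complex.I) with hc
  have hcp : ∀ θ : ℝ, b + Complex.polarCoord.symm (t, θ) = c θ := by
    intro θ
    simp [hc, Complex.polarCoord_symm_apply, Complex.exp_mul_I]
  have hcd : ∀ θ : ℝ, HasDerivAt c (t * (Complex.exp (θ * Complex.I) * Complex.I)) θ := by
    intro θ
    have h1 : HasDerivAt (fun θ : ℝ => (θ : ℂ) * Complex.I) Complex.I θ := by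
      simpa using (Complex.ofRealCLM.hasDerivAt (x := θ)).mul_const Complex.I
    exact (h1.cexp.const_mul (t : ℂ)).const_add b
  have hcc : Continuous c := by fun_prop
  have hsurj : ∀ u : ℂ, ‖u - b‖ = t → ∃ θ ∈ Icc (-Real.pi) Real.pi, c θ = u := by
    intro u hu
    refine ⟨Complex.arg (u - b), ⟨(Complex.neg_pi_lt_arg _).le, Complex.arg_le_pi _⟩, ?_⟩
    rw [hc, ← hu]
    simp [Complex.norm_mul_exp_arg_mul_I]
  obtain ⟨α, hα, hcα⟩ := hsurj v hvt
  obtain ⟨β, hβ, hcβ⟩ := hsurj w hwt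
  -- the exit time closest to `α`
  have hK : IsCompact (uIcc α β ∩ (c ⁻¹' O)ᶜ) :=
    isCompact_uIcc.inter_right (hO.preimage hcc).isClosed_compl
  obtain ⟨τ, ⟨hτ1, hτ2⟩, hτ3⟩ := hK.exists_isMinOn (f := fun θ => |θ - α|)
    ⟨β, right_mem_uIcc, by simpa [hcβ] using hw⟩ (by fun_prop)
  have hατ : α ≠ τ := by
    rintro rfl
    exact hτ2 (by simpa [hcα] using hv)
  have hseg : ∀ θ ∈ openSegment ℝ α τ, c θ ∈ O := by
    intro θ hθ
    by_contra hθO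
    have h1 : θ ∈ uIcc α β := by
      have : θ ∈ segment ℝ α τ := openSegment_subset_segment _ _ _ hθ
      rw [segment_eq_uIcc] at this
      exact uIcc_subset_uIcc_left hτ1 this
    have h2 : |τ - α| ≤ |θ - α| := hτ3 ⟨h1, hθO⟩
    obtain ⟨x, y, hx, hy, hxy, rfl⟩ := hθ
    have h3 : x • α + y • τ - α = y * (τ - α) := by
      simp only [smul_eq_mul]; rw [show x = 1 - y by linarith]; ring
    rw [h3, abs_mul, abs_of_pos hy] at h2
    have : 0 < |τ - α| := abs_pos.2 (sub_ne_zero.2 hατ.symm)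
    nlinarith
  have hτcl : c τ ∈ closure O := by
    have h1 : τ ∈ closure (openSegment ℝ α τ) :=
      segment_subset_closure_openSegment (right_mem_segment ℝ α τ)
    exact map_mem_closure hcc h1 hseg
  have hτr : 2 * r ≤ ‖g (c τ) - z‖ := hb _ hτcl hτ2
  set φ : ℝ → ℂ := fun θ => deriv g (c θ) * (t * (Complex.exp (θ * Complex.I) * Complex.I)) with hφ
  have hGd : ∀ θ : ℝ, HasDerivAt (fun θ => g (c θ)) (φ θ) θ := fun θ => by
    have := (hg (c θ)).hasDerivAt.comp θ (hcd θ)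
    exact this
  have hdc : Continuous (deriv g) := (hg.contDiff (n := 1)).continuous_deriv le_rfl
  have hφc : Continuous φ := by fun_prop
  have hφn : ∀ θ, ‖φ θ‖ = ‖deriv g (c θ)‖ * t := by
    intro θ
    simp [hφ, Complex.norm_exp_ofReal_mul_I, abs_of_pos ht]
  have hint : ∫ θ in α..τ, φ θ = g (c τ) - g (c α) :=
    intervalIntegral.integral_eq_sub_of_hasDerivAt (fun θ _ => hGd θ)
      (hφc.intervalIntegrable _ _)
  have h4 : r ≤ ∫ θ in uIoc α τ, ‖φ θ‖ := by
    have h5 := intervalIntegral.norm_integral_le_integral_norm_uIoc (f := φ) (a := α) (b := τ)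
      (μ := volume)
    rw [hint] at h5
    have h6 : ‖g (c τ) - z‖ ≤ ‖g (c τ) - g (c α)‖ + ‖g (c α) - z‖ :=
      norm_sub_le_norm_sub_add_norm_sub _ _ _
    rw [hcα] at h6 h5
    linarith
  have h7 : ENNReal.ofReal r ≤ ∫⁻ θ in uIoc α τ, ENNReal.ofReal ‖φ θ‖ := by
    rw [← ofReal_integral_eq_lintegral_ofReal]
    · exact ENNReal.ofReal_le_ofReal h4
    · exact (hφc.norm.intervalIntegrable α τ).def'
    · exact Eventually.of_forall fun _ => norm_nonneg _
  have hpi := Real.pi_pos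
  set E : Set ℝ := Ioo (-Real.pi) Real.pi ∩ c ⁻¹' O with hE
  have hEm : MeasurableSet E := measurableSet_Ioo.inter (hO.preimage hcc).measurableSet
  have h8 : ∫⁻ θ in uIoc α τ, ENNReal.ofReal ‖φ θ‖ ≤ ∫⁻ θ in E, ENNReal.ofReal ‖φ θ‖ := by
    rw [uIoc, ← Measure.restrict_congr_set Ioo_ae_eq_Ioc]
    refine lintegral_mono_set ?_
    intro θ hθ
    have hτ4 : τ ∈ Icc (-Real.pi) Real.pi := uIcc_subset_Icc hα hβ hτ1
    refine ⟨⟨?_, ?_⟩, hseg θ (by rw [openSegment_eq_Ioo' hατ]; exact hθ)⟩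
    · exact (le_min hα.1 hτ4.1).trans_lt hθ.1
    · exact hθ.2.trans_le (max_le hα.2 hτ4.2)
  have h9 : ∫⁻ θ in E, ENNReal.ofReal ‖φ θ‖ ≤
      ∫⁻ θ in E, (ENNReal.ofReal (Real.pi / r) * ENNReal.ofReal (‖φ θ‖ ^ 2) +
        ENNReal.ofReal (r / (4 * Real.pi))) := by
    refine lintegral_mono fun θ => ?_
    rw [← ENNReal.ofReal_mul (by positivity), ← ENNReal.ofReal_add (by positivity) (by positivity)]
    refine ENNReal.ofReal_le_ofReal ?_
    have : Real.pi / r * ‖φ θ‖ ^ 2 + r / (4 * Real.pi) - ‖φ θ‖ =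
        (2 * Real.pi * ‖φ θ‖ - r) ^ 2 / (4 * Real.pi * r) := by
      field_simp; ring
    have h0 : 0 ≤ (2 * Real.pi * ‖φ θ‖ - r) ^ 2 / (4 * Real.pi * r) := by positivity
    linarith
  have hEv : volume E ≤ ENNReal.ofReal (2 * Real.pi) := by
    refine (measure_mono inter_subset_left).trans ?_
    rw [Real.volume_Ioo]; ring_nf; rfl
  have hmeas : Measurable fun θ => ENNReal.ofReal (‖φ θ‖ ^ 2) := by fun_prop
  rw [lintegral_add_right _ measurable_const, lintegral_const_mul _ hmeas, setLIntegral_const] at h9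
  set A := ∫⁻ θ in E, ENNReal.ofReal (‖φ θ‖ ^ 2) with hA
  have h10 : ENNReal.ofReal r ≤ ENNReal.ofReal (Real.pi / r) * A + ENNReal.ofReal (r / 2) := by
    refine (h7.trans h8).trans (h9.trans ?_)
    gcongr
    calc ENNReal.ofReal (r / (4 * Real.pi)) * volume E
        ≤ ENNReal.ofReal (r / (4 * Real.pi)) * ENNReal.ofReal (2 * Real.pi) := by gcongr
      _ = _ := by
        rw [← ENNReal.ofReal_mul (by positivity)]; congr 1; field_simp; ring
  have h11 : ENNReal.ofReal (r / 2) ≤ ENNReal.ofReal (Real.pi / r) * A := by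
    have : ENNReal.ofReal r = ENNReal.ofReal (r / 2) + ENNReal.ofReal (r / 2) := by
      rw [← ENNReal.ofReal_add (by positivity) (by positivity)]; congr 1; ring
    rw [this] at h10
    exact (ENNReal.add_le_add_iff_right ENNReal.ofReal_ne_top).1 h10
  have h12 : ENNReal.ofReal (r ^ 2 / (2 * Real.pi)) ≤ A := by
    calc ENNReal.ofReal (r ^ 2 / (2 * Real.pi))
        = ENNReal.ofReal (r / Real.pi) * ENNReal.ofReal (r / 2) := by
          rw [← ENNReal.ofReal_mul (by positivity)]; congr 1; field_simp
      _ ≤ ENNReal.ofReal (r / Real.pi) * (ENNReal.ofReal (Real.pi / r) * A) := by gcongr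
      _ = A := by
        rw [← mul_assoc, ← ENNReal.ofReal_mul (by positivity)]
        rw [show r / Real.pi * (Real.pi / r) = 1 by field_simp]; simp
  calc ENNReal.ofReal (r ^ 2 / (2 * Real.pi) / t)
      = ENNReal.ofReal (1 / t) * ENNReal.ofReal (r ^ 2 / (2 * Real.pi)) := by
        rw [← ENNReal.ofReal_mul (by positivity)]; congr 1; field_simp
    _ ≤ ENNReal.ofReal (1 / t) * A := by gcongr
    _ = ∫⁻ θ in E, ENNReal.ofReal t * ENNReal.ofReal (‖deriv g (c θ)‖ ^ 2) := by
        rw [hA, ← lintegral_const_mul _ hmeas]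
        congr 1 with θ
        rw [← ENNReal.ofReal_mul (by positivity), ← ENNReal.ofReal_mul (by positivity), hφn]
        congr 1; field_simp
    _ ≤ _ := by
        rw [← lintegral_indicator hEm, ← lintegral_indicator measurableSet_Ioo]
        refine lintegral_mono fun θ => ?_
        by_cases hθ : θ ∈ E
        · rw [indicator_of_mem hθ, indicator_of_mem hθ.1, hcp,
            indicator_of_mem (show c θ ∈ O from hθ.2)]
        · rw [indicator_of_notMem hθ]; exact zero_le

lemma lintegral_annulus_polar (b : ℂ) {F : ℂ → ℝ≥0∞} (hF : Measurable F) (ρ T : ℝ) (hρ : 0 ≤ ρ) :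
    ∫⁻ t in Ioo ρ T, ∫⁻ θ in Ioo (-Real.pi) Real.pi,
      ENNReal.ofReal t * F (b + Complex.polarCoord.symm (t, θ)) ≤ ∫⁻ w, F w := by
  have hm : Measurable fun p : ℝ × ℝ =>
      ENNReal.ofReal p.1 * F (b + Complex.polarCoord.symm p) := by
    have : Measurable fun p : ℝ × ℝ => (Complex.polarCoord.symm p : ℂ) := by
      simp only [Complex.polarCoord_symm_apply]
      fun_prop
    fun_prop
  calc _ = ∫⁻ p in Ioo ρ T ×ˢ Ioo (-Real.pi) Real.pi,
        ENNReal.ofReal p.1 * F (b + Complex.polarCoord.symm p) := by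
        rw [Measure.volume_eq_prod, ← Measure.prod_restrict, lintegral_prod _ hm.aemeasurable]
    _ ≤ ∫⁻ p in polarCoord.target,
        ENNReal.ofReal p.1 * F (b + Complex.polarCoord.symm p) := by
        refine lintegral_mono_set ?_
        rintro ⟨t, θ⟩ ⟨ht, hθ⟩
        exact ⟨hρ.trans_lt ht.1, hθ⟩
    _ = ∫⁻ w, F (b + w) := Complex.lintegral_comp_polarCoord_symm fun w => F (b + w)
    _ = ∫⁻ w, F w := lintegral_add_left_eq_self F b

/-- Distance distortion for components of preimages of discs. -/
lemma pcomp_dist_le {q : Polynomial ℂ} {z : ℂ} {r : ℝ} (hr : 0 < r)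
    {x : ℂ} {N : ℕ}
    (hN : ∀ u, (pcomp q z (2 * r) x ∩ (fun w => q.eval w) ⁻¹' {u}).encard ≤ N)
    {a y b : ℂ} (ha : a ∈ pcomp q z r x) (hy : y ∈ pcomp q z r x)
    (hb : b ∉ pcomp q z (2 * r) x) :
    ‖a - y‖ ≤ 2 * Real.exp (8 * Real.pi ^ 2 * N) * ‖a - b‖ := by
  set g : ℂ → ℂ := fun w => q.eval w with hg
  have hgd : Differentiable ℂ g := q.differentiable
  set V := pcomp q z (2 * r) x with hV
  have hsub : pcomp q z r x ⊆ V := pcomp_mono (ball_subset_ball (by linarith))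
  set ρ := ‖a - b‖ with hρ
  set T := ‖a - y‖ - ρ with hT
  have hρ0 : 0 < ρ := norm_pos_iff.2 (sub_ne_zero.2 fun h => hb (h ▸ hsub ha))
  have he1 : 1 ≤ Real.exp (8 * Real.pi ^ 2 * N) := Real.one_le_exp (by positivity)
  rcases le_or_gt T ρ with h | hTρ
  · nlinarith
  have hdm : Measurable fun u => ENNReal.ofReal (‖deriv g u‖ ^ 2) := by fun_prop
  have hVm : MeasurableSet V := (isOpen_pcomp q z (2 * r) x).measurableSet
  set F : ℂ → ℝ≥0∞ := V.indicator fun u => ENNReal.ofReal (‖deriv g u‖ ^ 2) with hF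
  have hFm : Measurable F := hdm.indicator hVm
  have hcircle : ∀ t ∈ Ioo ρ T, ENNReal.ofReal (r ^ 2 / (2 * Real.pi) / t) ≤
      ∫⁻ θ in Ioo (-Real.pi) Real.pi, ENNReal.ofReal t *
        F (b + Complex.polarCoord.symm (t, θ)) := by
    rintro t ⟨ht1, ht2⟩
    have ht0 : 0 < t := hρ0.trans ht1
    have hyb : T ≤ ‖y - b‖ := by
      have := norm_sub_le_norm_sub_add_norm_sub a b y
      rw [norm_sub_rev b y] at this
      linarith
    obtain ⟨v, hv1, hv2⟩ : t ∈ (fun v => ‖v - b‖) '' pcomp q z r x :=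
      (isPreconnected_pcomp q z r x).intermediate_value ha hy (by fun_prop)
        ⟨by simpa using ht1.le, by simpa using ht2.le.trans hyb⟩
    obtain ⟨w, hw1, hw2⟩ : ∃ w, ‖w - b‖ = t ∧ w ∉ V := by
      by_contra! hcon
      have hsph : sphere b t ⊆ V := fun w hw => hcon w (by simpa [dist_eq_norm] using hw)
      have hcb : ∀ w ∈ closedBall b t, ‖q.eval w - z‖ < 2 * r := by
        obtain ⟨w₀, hw₀, hmax⟩ := (isCompact_sphere b t).exists_isMaxOn
          (f := fun w => ‖q.eval w - z‖) ⟨v, by simpa [dist_eq_norm] using hv2⟩ (by fun_prop)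
        intro w hw
        refine lt_of_le_of_lt ?_ (norm_lt_of_mem_pcomp (hsph hw₀))
        refine Complex.norm_le_of_forall_mem_frontier_norm_le (f := fun w => q.eval w - z)
          (U := ball b t) isBounded_ball (Differentiable.diffContOnCl (by fun_prop)) ?_
          (by rwa [closure_ball b ht0.ne'])
        rw [frontier_ball b ht0.ne']
        exact fun w hw => hmax hw
      have hvs : v ∈ closedBall b t := by simp [dist_eq_norm]; exact hv2.le
      exact hb (subset_pcomp (convex_closedBall b t).isPreconnected hcb hvs (hsub hv1)
        (mem_closedBall_self ht0.le))
    refine circle_energy hgd ht0 hr (isOpen_pcomp q z (2 * r) x) (z := z) ?_ (hsub hv1)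
      (norm_lt_of_mem_pcomp hv1) hv2 hw2 hw1
    intro u hu hu2
    by_contra! h
    exact hu2 (mem_pcomp_of_mem_closure hu h)
  have h1 : ∫⁻ t in Ioo ρ T, ENNReal.ofReal (r ^ 2 / (2 * Real.pi) / t) ≤
      N * ENNReal.ofReal (4 * Real.pi * r ^ 2) := by
    calc _ ≤ ∫⁻ t in Ioo ρ T, ∫⁻ θ in Ioo (-Real.pi) Real.pi, ENNReal.ofReal t *
        F (b + Complex.polarCoord.symm (t, θ)) := setLIntegral_mono' measurableSet_Ioo hcircle
      _ ≤ ∫⁻ w, F w := lintegral_annulus_polar b hFm ρ T hρ0.le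
      _ = ∫⁻ w in V, ENNReal.ofReal (‖deriv g w‖ ^ 2) * (fun _ => (1 : ℝ≥0∞)) (g w) := by
        rw [hF, lintegral_indicator hVm]; simp
      _ ≤ N * ∫⁻ u in ball z (2 * r), (1 : ℝ≥0∞) :=
        lintegral_valence hgd hVm (T := ball z (2 * r))
          (fun w hw => by simpa [dist_eq_norm] using norm_lt_of_mem_pcomp hw) hN measurable_const
      _ = N * ENNReal.ofReal (4 * Real.pi * r ^ 2) := by
        rw [setLIntegral_one, Complex.volume_ball]
        congr 1
        rw [← ENNReal.ofReal_coe_nnreal, ← ENNReal.ofReal_pow (by positivity),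
          ← ENNReal.ofReal_mul (by positivity), NNReal.coe_real_pi]
        congr 1; ring
  have h2 : ∫⁻ t in Ioo ρ T, ENNReal.ofReal (r ^ 2 / (2 * Real.pi) / t) =
      ENNReal.ofReal (r ^ 2 / (2 * Real.pi) * Real.log (T / ρ)) := by
    have hpos : ∀ t ∈ uIcc ρ T, t ≠ 0 := by
      intro t ht
      rw [uIcc_of_le hTρ.le] at ht
      linarith [ht.1]
    have hi : IntervalIntegrable (fun t => r ^ 2 / (2 * Real.pi) / t) volume ρ T := by
      apply ContinuousOn.intervalIntegrable
      exact continuousOn_const.div continuousOn_id hpos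
    rw [Measure.restrict_congr_set Ioo_ae_eq_Ioc, ← ofReal_integral_eq_lintegral_ofReal]
    · rw [← intervalIntegral.integral_of_le hTρ.le]
      congr 1
      simp only [div_eq_mul_inv (r ^ 2 / (2 * Real.pi))]
      rw [intervalIntegral.integral_const_mul, integral_inv_of_pos hρ0 (hρ0.trans hTρ)]
    · exact (intervalIntegrable_iff_integrableOn_Ioc_of_le hTρ.le).1 hi
    · refine (ae_restrict_iff' measurableSet_Ioc).2 (Eventually.of_forall fun t ht => ?_)
      have : 0 < t := hρ0.trans ht.1
      positivity
  rw [h2, ← ENNReal.ofReal_natCast, ← ENNReal.ofReal_mul (by positivity),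
    ENNReal.ofReal_le_ofReal_iff (by positivity)] at h1
  have h3 : Real.log (T / ρ) ≤ 8 * Real.pi ^ 2 * N := by
    have hpi := Real.pi_pos
    have h5 : 0 < r ^ 2 / (2 * Real.pi) := by positivity
    refine le_of_mul_le_mul_left (h1.trans (le_of_eq ?_)) h5
    field_simp
    ring
  have hT0 : 0 < T := hρ0.trans hTρ
  have h4 : T / ρ ≤ Real.exp (8 * Real.pi ^ 2 * N) := by
    rwa [← Real.log_le_iff_le_exp (by positivity)]
  rw [div_le_iff₀ hρ0] at h4
  nlinarith

lemma volume_ball_eq (a : ℂ) {r : ℝ} (hr : 0 ≤ r) :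
    volume (ball a r) = ENNReal.ofReal (Real.pi * r ^ 2) := by
  rw [Complex.volume_ball, ← ENNReal.ofReal_coe_nnreal, ← ENNReal.ofReal_pow hr,
    ← ENNReal.ofReal_mul (by positivity), NNReal.coe_real_pi, mul_comm]

lemma exists_separated_or_cover (E : Set ℂ) {δ : ℝ} (hδ : 0 < δ) (n : ℕ) :
    (∃ S : Finset ℂ, S.card = n ∧ (S : Set ℂ) ⊆ E ∧ ∀ x ∈ S, ∀ y ∈ S, x ≠ y → δ ≤ ‖x - y‖) ∨
    ∃ S : Finset ℂ, S.card ≤ n ∧ (S : Set ℂ) ⊆ E ∧ E ⊆ ⋃ x ∈ S, ball x δ := by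
  classical
  induction n with
  | zero => exact Or.inl ⟨∅, by simp⟩
  | succ n ih =>
    rcases ih with ⟨S, hc, hSE, hS⟩ | ⟨S, hc, hSE, hS⟩
    · by_cases h : E ⊆ ⋃ x ∈ S, ball x δ
      · exact Or.inr ⟨S, by omega, hSE, h⟩
      · obtain ⟨e, heE, he⟩ := not_subset.1 h
        simp only [mem_iUnion, mem_ball, dist_eq_norm, not_exists, not_lt, exists_prop,
          not_and] at he
        by_cases heS : e ∈ S
        · have := he e heS
          simp only [sub_self, norm_zero] at this
          linarith
        · refine Or.inl ⟨insert e S, by rw [Finset.card_insert_of_notMem heS, hc], ?_, ?_⟩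
          · rw [Finset.coe_insert]; exact insert_subset heE hSE
          · intro x hx y hy hxy
            rw [Finset.mem_insert] at hx hy
            rcases hx with rfl | hx <;> rcases hy with rfl | hy
            · exact absurd rfl hxy
            · exact he y hy
            · rw [norm_sub_rev]; exact he x hx
            · exact hS x hx y hy hxy
    · exact Or.inr ⟨S, by omega, hSE, hS⟩

lemma lagrange_bound {S : Finset ℂ} {δ t M : ℝ} (hδ : 0 < δ) (ht : 0 < t) (hδM : δ ≤ M)
    (hS : ∀ x ∈ S, ∀ y ∈ S, x ≠ y → δ ≤ ‖x - y‖) {F : Polynomial ℂ}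
    (hF : ∀ x ∈ S, ‖F.eval x‖ ≤ t) {w : ℂ} (hw : ∀ x ∈ S, ‖w - x‖ ≤ M) :
    ‖(Lagrange.interpolate S id fun x => F.eval x).eval w‖ ≤ S.card * t * (M / δ) ^ S.card := by
  have hM1 : 1 ≤ M / δ := by rwa [one_le_div hδ]
  rw [Lagrange.interpolate_apply, Polynomial.eval_finsetSum]
  have : ∀ x ∈ S, ‖(Polynomial.C (F.eval x) * Lagrange.basis S id x).eval w‖ ≤
      t * (M / δ) ^ S.card := by
    intro x hx
    rw [Polynomial.eval_mul, Polynomial.eval_C, norm_mul]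
    refine mul_le_mul (hF x hx) ?_ (norm_nonneg _) ht.le
    rw [Lagrange.basis, Polynomial.eval_prod, norm_prod]
    calc ∏ j ∈ S.erase x, ‖(Lagrange.basisDivisor (id x) (id j)).eval w‖
        ≤ ∏ j ∈ S.erase x, (M / δ) := by
          refine Finset.prod_le_prod (fun _ _ => norm_nonneg _) fun j hj => ?_
          have hj' := Finset.mem_erase.1 hj
          simp only [Lagrange.basisDivisor, id, Polynomial.eval_mul, Polynomial.eval_C,
            Polynomial.eval_sub, Polynomial.eval_X, norm_mul, norm_inv]
          rw [mul_comm, ← div_eq_mul_inv]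
          exact div_le_div₀ (hδ.le.trans hδM) (hw j hj'.2) hδ (hS x hx j hj'.2 hj'.1.symm)
      _ = (M / δ) ^ (S.erase x).card := by rw [Finset.prod_const]
      _ ≤ _ := pow_le_pow_right₀ hM1 (Finset.card_le_card (Finset.erase_subset _ _))
  calc _ ≤ ∑ x ∈ S, t * (M / δ) ^ S.card := (norm_sum_le _ _).trans (Finset.sum_le_sum this)
    _ = _ := by rw [Finset.sum_const, nsmul_eq_mul, mul_assoc]

lemma separated_sublevel {K : ℝ} {n : ℕ} (hn : K * (2 / 7) ^ n ≤ 1 / 4)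
    {F : Polynomial ℂ} {a : ℂ} {ρ : ℝ} (hρ : 0 < ρ)
    (hFK : ∀ w ∈ closedBall a (8 * ρ), ‖F.eval w‖ ≤ K)
    {b : ℂ} (hb : b ∈ closedBall a ρ) (hFb : 1 ≤ ‖F.eval b‖) {t δ : ℝ} (ht : 0 < t)
    (hδ : 0 < δ) (hδρ : δ ≤ ρ) {S : Finset ℂ} (hc : S.card = n)
    (hSE : (S : Set ℂ) ⊆ ball a ρ ∩ {w | ‖F.eval w‖ ≤ t})
    (hS : ∀ x ∈ S, ∀ y ∈ S, x ≠ y → δ ≤ ‖x - y‖) : 1 ≤ 4 * n * t * (9 * ρ / δ) ^ n := by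
  set P := Lagrange.interpolate S id fun x => F.eval x with hP
  set B := n * t * (9 * ρ / δ) ^ n with hB
  have hB0 : 0 ≤ B := by positivity
  have hxa : ∀ x ∈ S, ‖x - a‖ < ρ := fun x hx => by
    simpa [dist_eq_norm] using (hSE hx).1
  have hPb : ∀ w ∈ closedBall a (8 * ρ), ‖P.eval w‖ ≤ B := by
    intro w hw
    rw [hB, ← hc]
    refine lagrange_bound hδ ht (by linarith) hS (fun x hx => (hSE hx).2) fun x hx => ?_
    have h1 := norm_sub_le_norm_sub_add_norm_sub w a x
    rw [norm_sub_rev a x] at h1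
    have h2 : ‖w - a‖ ≤ 8 * ρ := by simpa [dist_eq_norm] using hw
    linarith [hxa x hx]
  set ω : Polynomial ℂ := ∏ x ∈ S, (Polynomial.X - Polynomial.C x) with hω
  have hdvd : ω ∣ F - P := by
    refine Finset.prod_dvd_of_coprime ?_ ?_
    · intro x _ y _ hxy
      exact Polynomial.pairwise_coprime_X_sub_C (fun _ _ h => h) hxy
    · intro x hx
      rw [Polynomial.dvd_iff_isRoot, Polynomial.IsRoot, Polynomial.eval_sub, hP]
      have := Lagrange.eval_interpolate_at_node (s := S) (v := id) (fun x => F.eval x)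
        (fun _ _ _ _ h => h) hx
      simp only [id] at this
      rw [this, sub_self]
  obtain ⟨Q, hQ⟩ := hdvd
  have hωe : ∀ w, ‖ω.eval w‖ = ∏ x ∈ S, ‖w - x‖ := by
    intro w
    rw [hω, Polynomial.eval_prod, norm_prod]
    simp
  have h7 : (0 : ℝ) < (7 * ρ) ^ n := by positivity
  have hQb : ‖Q.eval b‖ ≤ (K + B) / (7 * ρ) ^ n := by
    refine Complex.norm_le_of_forall_mem_frontier_norm_le (f := fun w => Q.eval w)
      (U := ball a (8 * ρ)) isBounded_ball (Differentiable.diffContOnCl Q.differentiable) ?_ ?_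
    · intro w hw
      rw [frontier_ball a (by positivity), mem_sphere, dist_eq_norm] at hw
      have hwc : w ∈ closedBall a (8 * ρ) := by simp [dist_eq_norm, hw]
      rw [le_div_iff₀ h7]
      calc ‖Q.eval w‖ * (7 * ρ) ^ n ≤ ‖Q.eval w‖ * ‖ω.eval w‖ := by
            gcongr
            rw [hωe, ← hc, ← Finset.prod_const]
            refine Finset.prod_le_prod (fun _ _ => by positivity) fun x hx => ?_
            have h1 := norm_sub_le_norm_sub_add_norm_sub w x a
            linarith [hxa x hx]
        _ = ‖(F - P).eval w‖ := by rw [hQ, Polynomial.eval_mul, norm_mul, mul_comm]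
        _ ≤ _ := by
            rw [Polynomial.eval_sub]
            exact (norm_sub_le _ _).trans (add_le_add (hFK w hwc) (hPb w hwc))
    · rw [closure_ball a (by positivity)]
      exact closedBall_subset_closedBall (by linarith) hb
  have hba : ‖b - a‖ ≤ ρ := by simpa [dist_eq_norm] using hb
  have hωb : ‖ω.eval b‖ ≤ (2 * ρ) ^ n := by
    rw [hωe, ← hc, ← Finset.prod_const]
    refine Finset.prod_le_prod (fun _ _ => by positivity) fun x hx => ?_
    have h1 := norm_sub_le_norm_sub_add_norm_sub b a x
    rw [norm_sub_rev a x] at h1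
    linarith [hxa x hx]
  have hK0 : 0 ≤ K := (norm_nonneg _).trans (hFK a (mem_closedBall_self (by positivity)))
  have h27 : ((2 : ℝ) / 7) ^ n ≤ 1 := pow_le_one₀ (by norm_num) (by norm_num)
  have hfin : ‖F.eval b‖ ≤ B + (2 / 7) ^ n * (K + B) := by
    calc ‖F.eval b‖ = ‖P.eval b + (F - P).eval b‖ := by rw [Polynomial.eval_sub]; ring_nf
      _ ≤ ‖P.eval b‖ + ‖(F - P).eval b‖ := norm_add_le _ _
      _ ≤ B + (2 * ρ) ^ n * ((K + B) / (7 * ρ) ^ n) := by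
        rw [hQ, Polynomial.eval_mul, norm_mul]
        refine add_le_add (hPb b (closedBall_subset_closedBall (by linarith) hb)) ?_
        exact mul_le_mul hωb hQb (norm_nonneg _) (by positivity)
      _ = _ := by
        rw [mul_pow, mul_pow, div_pow]
        field_simp
  have h8 : (2 / 7) ^ n * (K + B) ≤ 1 / 4 + B := by nlinarith
  have : 1 ≤ 4 * B := by linarith
  calc (1 : ℝ) ≤ 4 * B := this
    _ = _ := by rw [hB]; ring

/-- A Remez type inequality: sublevel sets of a polynomial with controlled growth are small. -/
lemma remez {K : ℝ} : ∃ C s : ℝ, 0 < C ∧ 0 < s ∧ ∀ (F : Polynomial ℂ) (a : ℂ) (ρ : ℝ), 0 < ρ →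
    (∀ w ∈ closedBall a (8 * ρ), ‖F.eval w‖ ≤ K) → (∃ b ∈ closedBall a ρ, 1 ≤ ‖F.eval b‖) →
    ∀ t : ℝ, 0 < t →
      volume (ball a ρ ∩ {w | ‖F.eval w‖ ≤ t}) ≤ ENNReal.ofReal (C * ρ ^ 2 * t ^ s) := by
  obtain ⟨n, hn1, hn⟩ : ∃ n : ℕ, 1 ≤ n ∧ K * (2 / 7) ^ n ≤ 1 / 4 := by
    have h1 : Tendsto (fun n : ℕ => K * (2 / 7 : ℝ) ^ n) atTop (𝓝 (K * 0)) :=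
      (_root_.tendsto_pow_atTop_nhds_zero_of_lt_one (by norm_num) (by norm_num)).const_mul K
    rw [mul_zero] at h1
    exact ((eventually_ge_atTop 1).and (h1.eventually_le_const (by norm_num))).exists
  have hn0 : (0 : ℝ) < n := by exact_mod_cast hn1
  set A : ℝ := 8 * n * 9 ^ n with hA
  have hA0 : 0 < A := by positivity
  refine ⟨n * Real.pi * A ^ (2 / n : ℝ), 2 / n, by positivity, by positivity, ?_⟩
  intro F a ρ hρ hFK ⟨b, hb, hFb⟩ t ht
  set κ := (A * t) ^ (1 / n : ℝ) with hκ
  have hκ0 : 0 < κ := by positivity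
  have hκn : κ ^ n = A * t := by
    rw [hκ, ← Real.rpow_natCast, ← Real.rpow_mul (by positivity), one_div_mul_cancel hn0.ne',
      Real.rpow_one]
  have hκ2 : A ^ (2 / n : ℝ) * t ^ (2 / n : ℝ) = κ ^ 2 := by
    rw [hκ, ← Real.rpow_natCast, ← Real.rpow_mul (by positivity),
      ← Real.mul_rpow hA0.le ht.le]
    congr 1; push_cast; ring
  have hgoal : n * Real.pi * A ^ (2 / n : ℝ) * ρ ^ 2 * t ^ (2 / n : ℝ) =
      n * (Real.pi * (κ * ρ) ^ 2) := by
    rw [mul_pow, ← hκ2]; ring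
  rw [hgoal]
  rcases lt_or_ge 1 κ with h | h
  · refine (measure_mono inter_subset_left).trans ?_
    rw [volume_ball_eq a hρ.le]
    refine ENNReal.ofReal_le_ofReal ?_
    have h1 : Real.pi * ρ ^ 2 ≤ Real.pi * (κ * ρ) ^ 2 := by
      gcongr
      nlinarith
    have h2 : (1 : ℝ) ≤ n := by exact_mod_cast hn1
    nlinarith [show 0 ≤ Real.pi * (κ * ρ) ^ 2 by positivity]
  · have hδρ : κ * ρ ≤ ρ := by nlinarith
    rcases exists_separated_or_cover (ball a ρ ∩ {w | ‖F.eval w‖ ≤ t})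
      (show 0 < κ * ρ by positivity) n with
      ⟨S, hc, hSE, hS⟩ | ⟨S, hc, -, hS⟩
    · exfalso
      have h1 := separated_sublevel hn hρ hFK hb hFb ht (by positivity) hδρ hc hSE hS
      have h2 : 9 * ρ / (κ * ρ) = 9 / κ := by field_simp
      rw [h2, div_pow, hκn] at h1
      have h3 : 4 * n * t * (9 ^ n / (A * t)) = 1 / 2 := by
        rw [hA]; field_simp; norm_num
      rw [h3] at h1
      norm_num at h1
    · calc _ ≤ volume (⋃ x ∈ S, ball x (κ * ρ)) := measure_mono hS
        _ ≤ ∑ x ∈ S, volume (ball x (κ * ρ)) := measure_biUnion_finset_le _ _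
        _ = ∑ x ∈ S, ENNReal.ofReal (Real.pi * (κ * ρ) ^ 2) :=
          Finset.sum_congr rfl fun x _ => volume_ball_eq x (by positivity)
        _ = ENNReal.ofReal (S.card * (Real.pi * (κ * ρ) ^ 2)) := by
          rw [Finset.sum_const, nsmul_eq_mul, ← ENNReal.ofReal_natCast,
            ← ENNReal.ofReal_mul (by positivity)]
        _ ≤ _ := by
          refine ENNReal.ofReal_le_ofReal ?_
          gcongr

/-- Every fibre in every component of the preimage of the disc has at most `N` points. -/
def FibreBound (q : Polynomial ℂ) (z : ℂ) (r : ℝ) (N : ℕ) : Prop :=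
  ∀ x u, (pcomp q z r x ∩ (fun w => q.eval w) ⁻¹' {u}).encard ≤ N

/-- The distortion constant. -/
noncomputable def distC (N : ℕ) : ℝ := 2 * Real.exp (8 * Real.pi ^ 2 * N)

lemma one_le_distC (N : ℕ) : 1 ≤ distC N := by
  have : 1 ≤ Real.exp (8 * Real.pi ^ 2 * N) := Real.one_le_exp (by positivity)
  rw [distC]; linarith

lemma diam_pcomp_pos {q : Polynomial ℂ} (hq : 1 ≤ q.natDegree) {z : ℂ} {r : ℝ} {x : ℂ}
    (hx : x ∈ pcomp q z r x) : 0 < diam (pcomp q z r x) := by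
  obtain ⟨y, hy, hyx⟩ : ∃ y ∈ pcomp q z r x, y ≠ x := by
    have : (pcomp q z r x).Nontrivial :=
      (infinite_of_mem_nhds x ((isOpen_pcomp q z r x).mem_nhds hx)).nontrivial
    exact this.exists_ne x
  exact (dist_pos.2 hyx).trans_le (dist_le_diam_of_mem (isBounded_pcomp hq z r x) hy hx)

lemma ball_subset_pcomp {q : Polynomial ℂ} {z : ℂ} {r : ℝ} (hr : 0 < r)
    {x : ℂ} {N : ℕ} (hN : FibreBound q z (2 * r) N) {a : ℂ} (ha : a ∈ pcomp q z r x) :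
    ball a (diam (pcomp q z r x) / (2 * distC N)) ⊆ pcomp q z (2 * r) x := by
  intro b hb
  by_contra hbV
  have hD := one_le_distC N
  rw [mem_ball, dist_comm, dist_eq_norm, lt_div_iff₀ (by positivity)] at hb
  have h1 : ∀ y ∈ pcomp q z r x, ‖a - y‖ ≤ distC N * ‖a - b‖ := fun y hy =>
    pcomp_dist_le hr (hN x) ha hy hbV
  have h2 : diam (pcomp q z r x) ≤ 2 * (distC N * ‖a - b‖) := by
    refine diam_le_of_forall_dist_le (by positivity) fun y hy y' hy' => ?_
    have := dist_triangle y a y'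
    rw [dist_comm y a, dist_eq_norm a y, dist_eq_norm a y'] at this
    linarith [h1 y hy, h1 y' hy']
  linarith

lemma exists_noncritical {q : Polynomial ℂ} (hq : 1 ≤ q.natDegree) {u₀ : ℂ} {O : Set ℂ}
    (hO : O ∈ 𝓝 u₀) : ∃ u ∈ O, ∀ s, q.eval s = u → q.derivative.eval s ≠ 0 := by
  classical
  have hne : q.derivative ≠ 0 := fun h => by
    have := Polynomial.derivative_eq_zero.1 h
    omega
  obtain ⟨u, huO, hu⟩ := (infinite_of_mem_nhds u₀ hO).exists_notMem_finset
    (q.derivative.roots.toFinset.image fun s => q.eval s)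
  refine ⟨u, huO, fun s hs h0 => hu ?_⟩
  rw [Finset.mem_image]
  exact ⟨s, by simpa [hne] using h0, hs⟩

/-- Lower bound for the distance to a noncritical value inside a component. -/
lemma norm_sub_ge_prod {q : Polynomial ℂ} (hq : 1 ≤ q.natDegree) {z : ℂ} {r : ℝ} (hr : 0 < r)
    {x u : ℂ} (hu : ‖u - z‖ < r / 2) (hus : ∀ s, q.eval s = u → q.derivative.eval s ≠ 0)
    {S : Finset ℂ} (hS : (S : Set ℂ) = pcomp q z r x ∩ (fun w => q.eval w) ⁻¹' {u})
    {w : ℂ} (hw : w ∈ pcomp q z r x) :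
    r / 2 * ∏ s ∈ S, (‖w - s‖ / diam (pcomp q z r x)) ≤ ‖q.eval w - u‖ := by
  set V := pcomp q z r x with hV
  set d := diam V with hd
  have hxV : x ∈ V := self_mem_pcomp (pcomp_nonempty_imp hw)
  have hd0 : 0 < d := diam_pcomp_pos hq hxV
  have hSV : ∀ s ∈ S, s ∈ V ∧ q.eval s = u := fun s hs => by
    have : s ∈ (S : Set ℂ) := hs
    rw [hS] at this
    exact this
  set ω : Polynomial ℂ := ∏ s ∈ S, (Polynomial.X - Polynomial.C s) with hω
  have hωe : ∀ w, ‖ω.eval w‖ = ∏ s ∈ S, ‖w - s‖ := by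
    intro w
    rw [hω, Polynomial.eval_prod, norm_prod]
    simp
  have hdvd : ω ∣ q - Polynomial.C u := by
    refine Finset.prod_dvd_of_coprime ?_ ?_
    · intro x _ y _ hxy
      exact Polynomial.pairwise_coprime_X_sub_C (fun _ _ h => h) hxy
    · intro s hs
      rw [Polynomial.dvd_iff_isRoot, Polynomial.IsRoot, Polynomial.eval_sub, (hSV s hs).2]
      simp
  obtain ⟨Q, hQ⟩ := hdvd
  have hQe : ∀ w, q.eval w - u = ω.eval w * Q.eval w := by
    intro w
    rw [← Polynomial.eval_mul, ← hQ]; simp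
  have hωs : ∀ s ∈ S, ω.eval s = 0 := by
    intro s hs
    rw [← norm_eq_zero, hωe]
    exact Finset.prod_eq_zero hs (by simp)
  have hQ0 : ∀ v ∈ closure V, Q.eval v ≠ 0 := by
    intro v hv h0
    have hvu : q.eval v = u := by
      rw [← sub_eq_zero, hQe, h0, mul_zero]
    have hvV : v ∈ V := mem_pcomp_of_mem_closure hv (by rw [hvu]; linarith)
    have hvS : v ∈ S := by
      have : v ∈ (S : Set ℂ) := by rw [hS]; exact ⟨hvV, hvu⟩
      exact this
    apply hus v hvu
    have h1 : q.derivative = ω.derivative * Q + ω * Q.derivative := by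
      rw [← Polynomial.derivative_mul, ← hQ]; simp
    rw [h1]
    simp [h0, hωs v hvS]
  have hdist : ∀ v ∈ closure V, ∀ s ∈ S, ‖v - s‖ ≤ d := by
    intro v hv s hs
    rw [← dist_eq_norm, hd, ← diam_closure]
    exact dist_le_diam_of_mem (isBounded_pcomp hq z r x).closure hv (subset_closure (hSV s hs).1)
  have hmax : ‖(Q.eval w)⁻¹‖ ≤ d ^ S.card / (r / 2) := by
    refine norm_le_on_pcomp hq (F := fun w => (Q.eval w)⁻¹)
      (fun v hv => (Q.differentiable v).inv (hQ0 v hv)) ?_ (subset_closure hw)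
    intro v hv hvr
    have h1 : r / 2 ≤ ‖q.eval v - u‖ := by
      have := norm_sub_le_norm_sub_add_norm_sub (q.eval v) u z
      linarith
    have h2 : ‖q.eval v - u‖ ≤ d ^ S.card * ‖Q.eval v‖ := by
      rw [hQe, norm_mul, hωe]
      gcongr
      rw [← Finset.prod_const]
      exact Finset.prod_le_prod (fun _ _ => norm_nonneg _) fun s hs => hdist v hv s hs
    have h3 : 0 < ‖Q.eval v‖ := norm_pos_iff.2 (hQ0 v hv)
    rw [norm_inv, inv_eq_one_div, div_le_div_iff₀ h3 (by positivity)]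
    linarith
  rw [norm_inv, inv_eq_one_div, div_le_div_iff₀ (norm_pos_iff.2 (hQ0 w (subset_closure hw)))
    (by positivity)] at hmax
  rw [Finset.prod_div_distrib, Finset.prod_const, hQe, norm_mul, hωe]
  rw [← mul_div_assoc, div_le_iff₀ (by positivity)]
  have : 0 ≤ ∏ s ∈ S, ‖w - s‖ := Finset.prod_nonneg fun _ _ => norm_nonneg _
  nlinarith

lemma exists_far_from_finset (a : ℂ) {ρ : ℝ} (hρ : 0 < ρ) (S : Finset ℂ) {N : ℕ}
    (hS : S.card ≤ N) : ∃ w ∈ ball a ρ, ∀ s ∈ S, ρ / (N + 1) ≤ ‖w - s‖ := by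
  by_contra! hcon
  have hsub : ball a ρ ⊆ ⋃ s ∈ S, ball s (ρ / (N + 1)) := by
    intro w hw
    obtain ⟨s, hs, hws⟩ := hcon w hw
    simp only [mem_iUnion, mem_ball, dist_eq_norm]
    exact ⟨s, hs, hws⟩
  have h1 : volume (ball a ρ) ≤ ENNReal.ofReal (N * (Real.pi * (ρ / (N + 1)) ^ 2)) := by
    calc _ ≤ volume (⋃ s ∈ S, ball s (ρ / (N + 1))) := measure_mono hsub
      _ ≤ ∑ s ∈ S, volume (ball s (ρ / (N + 1))) := measure_biUnion_finset_le _ _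
      _ = ∑ s ∈ S, ENNReal.ofReal (Real.pi * (ρ / (N + 1)) ^ 2) :=
        Finset.sum_congr rfl fun s _ => volume_ball_eq s (by positivity)
      _ = ENNReal.ofReal (S.card * (Real.pi * (ρ / (N + 1)) ^ 2)) := by
        rw [Finset.sum_const, nsmul_eq_mul, ← ENNReal.ofReal_natCast,
          ← ENNReal.ofReal_mul (by positivity)]
      _ ≤ _ := by
        refine ENNReal.ofReal_le_ofReal ?_
        gcongr
  rw [volume_ball_eq a hρ.le, ENNReal.ofReal_le_ofReal_iff (by positivity)] at h1
  have hpi := Real.pi_pos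
  have h2 : (N : ℝ) * (Real.pi * (ρ / (N + 1)) ^ 2) = Real.pi * ρ ^ 2 * (N / (N + 1) ^ 2) := by
    field_simp
  rw [h2] at h1
  have h3 : (N : ℝ) / (N + 1) ^ 2 < 1 := by
    rw [div_lt_one (by positivity)]; nlinarith [(Nat.cast_nonneg N : (0 : ℝ) ≤ N)]
  have h4 : 0 < Real.pi * ρ ^ 2 := by positivity
  nlinarith

/-- The oscillation constant. -/
noncomputable def oscC (N : ℕ) : ℝ := (1 / 4) * (1 / (64 * distC N * (N + 1))) ^ N

lemma oscC_pos (N : ℕ) : 0 < oscC N := by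
  have := one_le_distC N
  rw [oscC]; positivity

lemma oscC_le (N : ℕ) : oscC N ≤ 1 / 4 := by
  have := one_le_distC N
  rw [oscC]
  have h1 : (1 / (64 * distC N * (N + 1)) : ℝ) ≤ 1 := by
    rw [div_le_one (by positivity)]
    nlinarith [(Nat.cast_nonneg N : (0 : ℝ) ≤ N)]
  have h2 := pow_le_one₀ (n := N) (by positivity) h1
  linarith

/-- Lower bound for the oscillation on small discs. -/
lemma exists_osc {q : Polynomial ℂ} (hq : 1 ≤ q.natDegree) {z : ℂ} {r : ℝ} (hr : 0 < r)
    {x : ℂ} {N : ℕ} (hN : FibreBound q z (2 * r) N) {a : ℂ} (ha : a ∈ pcomp q z r x)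
    (har : ‖q.eval a - z‖ < r / 2) :
    ∃ b ∈ closedBall a (diam (pcomp q z r x) / (64 * distC N)),
      oscC N * r ≤ ‖q.eval b - q.eval a‖ := by
  have hD := one_le_distC N
  have hc := oscC_pos N
  have hc4 := oscC_le N
  have hd0 : 0 < diam (pcomp q z r x) := by
    rw [pcomp_eq ha]; exact diam_pcomp_pos hq (self_mem_pcomp (norm_lt_of_mem_pcomp ha))
  set d := diam (pcomp q z r x) with hd
  set ρ := d / (64 * distC N) with hρ
  have hρ0 : 0 < ρ := by positivity
  by_cases hsub : closedBall a ρ ⊆ pcomp q z r x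
  · have hO : ball (q.eval a) (oscC N * r) ∩ ball z (r / 2) ∈ 𝓝 (q.eval a) :=
      inter_mem (ball_mem_nhds _ (by positivity))
        (isOpen_ball.mem_nhds (by simpa [dist_eq_norm] using har))
    obtain ⟨u, ⟨hu1, hu2⟩, hus⟩ := exists_noncritical hq hO
    rw [mem_ball, dist_eq_norm] at hu1 hu2
    have henc : (pcomp q z r x ∩ (fun w => q.eval w) ⁻¹' {u}).encard ≤ N :=
      (encard_le_encard (inter_subset_inter_left _
        (pcomp_mono (ball_subset_ball (by linarith))))).trans (hN x u)
    have hfin := finite_of_encard_le_coe henc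
    have hcoe : (hfin.toFinset : Set ℂ) = pcomp q z r x ∩ (fun w => q.eval w) ⁻¹' {u} :=
      hfin.coe_toFinset
    have hcard : hfin.toFinset.card ≤ N := by
      rw [← hcoe, encard_coe_eq_coe_finsetCard] at henc
      exact_mod_cast henc
    obtain ⟨w, hw, hws⟩ := exists_far_from_finset a hρ0 hfin.toFinset hcard
    refine ⟨w, ball_subset_closedBall hw, ?_⟩
    have h1 := norm_sub_ge_prod hq hr hu2 hus hcoe (hsub (ball_subset_closedBall hw))
    have h2 : (1 / (64 * distC N * (N + 1))) ^ N ≤ ∏ s ∈ hfin.toFinset, (‖w - s‖ / d) := by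
      have hk1 : (1 / (64 * distC N * (N + 1)) : ℝ) ≤ 1 := by
        rw [div_le_one (by positivity)]
        nlinarith [(Nat.cast_nonneg N : (0 : ℝ) ≤ N)]
      calc _ ≤ (1 / (64 * distC N * (N + 1)) : ℝ) ^ hfin.toFinset.card :=
            pow_le_pow_of_le_one (by positivity) hk1 hcard
        _ ≤ _ := by
          rw [← Finset.prod_const]
          refine Finset.prod_le_prod (fun _ _ => by positivity) fun s hs => ?_
          rw [le_div_iff₀ hd0]
          refine le_trans (le_of_eq ?_) (hws s hs)
          rw [hρ]; field_simp
    have h3 : 2 * oscC N * r ≤ ‖q.eval w - u‖ := by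
      refine le_trans ?_ h1
      rw [oscC]
      nlinarith
    have h4 := norm_sub_le_norm_sub_add_norm_sub (q.eval w) (q.eval a) u
    rw [norm_sub_rev (q.eval a) u] at h4
    linarith
  · obtain ⟨w, hw, hwV⟩ := not_subset.1 hsub
    have : ∃ b ∈ segment ℝ a w, r ≤ ‖q.eval b - z‖ := by
      by_contra! hcon
      exact hwV (subset_pcomp (convex_segment a w).isPreconnected hcon
        (left_mem_segment ℝ a w) ha (right_mem_segment ℝ a w))
    obtain ⟨b, hb, hbr⟩ := this
    refine ⟨b, (convex_closedBall a ρ).segment_subset (mem_closedBall_self hρ0.le) hw hb, ?_⟩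
    have h4 := norm_sub_le_norm_sub_add_norm_sub (q.eval b) (q.eval a) z
    nlinarith

lemma card_separated_le {A : Set ℂ} {x : ℂ} {d ρ : ℝ} (hρ : 0 < ρ) (hρd : ρ ≤ d)
    (hA : A ⊆ closedBall x d) {S : Finset ℂ} (hSA : (S : Set ℂ) ⊆ A)
    (hS : ∀ y ∈ S, ∀ y' ∈ S, y ≠ y' → ρ ≤ ‖y - y'‖) : (S.card : ℝ) ≤ 16 * (d / ρ) ^ 2 := by
  have hdis : (S : Set ℂ).PairwiseDisjoint fun y => ball y (ρ / 2) := by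
    intro y hy y' hy' hne
    refine ball_disjoint_ball ?_
    rw [dist_eq_norm]
    linarith [hS y hy y' hy' hne]
  have h1 : ∑ y ∈ S, volume (ball y (ρ / 2)) ≤ volume (ball x (2 * d)) := by
    rw [← measure_biUnion_finset hdis fun _ _ => measurableSet_ball]
    refine measure_mono (iUnion₂_subset fun y hy => ?_)
    have := mem_closedBall.1 (hA (hSA hy))
    exact ball_subset_ball' (by linarith)
  rw [Finset.sum_congr rfl fun y _ => volume_ball_eq y (by positivity),
    volume_ball_eq x (by linarith), Finset.sum_const, nsmul_eq_mul, ← ENNReal.ofReal_natCast,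
    ← ENNReal.ofReal_mul (by positivity), ENNReal.ofReal_le_ofReal_iff (by positivity)] at h1
  have hpi := Real.pi_pos
  have h2 : (S.card : ℝ) * (ρ / 2) ^ 2 ≤ (2 * d) ^ 2 := by
    refine le_of_mul_le_mul_left ?_ hpi
    linarith
  rw [div_pow, ← mul_div_assoc, le_div_iff₀ (by positivity)]
  nlinarith

/-- Inside a component, the set where the derivative is small has small area. -/
lemma volume_small_deriv (N : ℕ) : ∃ C s : ℝ, 0 < C ∧ 0 < s ∧ ∀ (q : Polynomial ℂ),
    1 ≤ q.natDegree → ∀ (z : ℂ) (r : ℝ), 0 < r → FibreBound q z (2 * r) N → ∀ x : ℂ, ∀ t : ℝ,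
    0 < t → volume {w ∈ pcomp q z r x | ‖q.eval w - z‖ < r / 2 ∧ ‖q.derivative.eval w‖ ≤ t} ≤
      ENNReal.ofReal (C * diam (pcomp q z r x) ^ 2 * (t * diam (pcomp q z r x) / r) ^ s) := by
  obtain ⟨C, s, hC, hs, hrem⟩ := remez (K := 1 / oscC N)
  have hD := one_le_distC N
  have hc := oscC_pos N
  obtain ⟨M, hM⟩ := exists_nat_gt (16 * (64 * distC N) ^ 2)
  have hM0 : (0 : ℝ) < M := lt_trans (by positivity) hM
  refine ⟨M * C * (1 / oscC N) ^ s, s, by positivity, hs, ?_⟩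
  intro q hq z r hr hN x t ht
  set V := pcomp q z r x with hV
  rcases V.eq_empty_or_nonempty with hVe | ⟨x₁, hx₁⟩
  · have : {w ∈ V | ‖q.eval w - z‖ < r / 2 ∧ ‖q.derivative.eval w‖ ≤ t} = ∅ := by
      rw [hVe]; simp
    rw [this, measure_empty]; exact zero_le
  have hd0 : 0 < diam V := by
    rw [hV, pcomp_eq hx₁]; exact diam_pcomp_pos hq (self_mem_pcomp (norm_lt_of_mem_pcomp hx₁))
  set d := diam V with hd
  set ρ := d / (64 * distC N) with hρ
  have hρ0 : 0 < ρ := by positivity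
  set A := {w ∈ V | ‖q.eval w - z‖ < r / 2} with hA
  have hAsub : A ⊆ closedBall x₁ d := fun w hw =>
    mem_closedBall.2 (dist_le_diam_of_mem (isBounded_pcomp hq z r x) hw.1 hx₁)
  have hρd : ρ ≤ d := div_le_self hd0.le (by linarith)
  have hlocal : ∀ a ∈ A, volume (ball a ρ ∩ {w | ‖q.derivative.eval w‖ ≤ t}) ≤
      ENNReal.ofReal (C * (1 / oscC N) ^ s * d ^ 2 * (t * d / r) ^ s) := by
    intro a ha
    have hball : ∀ w ∈ closedBall a (16 * ρ), ‖q.eval w - z‖ < 2 * r := by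
      intro w hw
      refine norm_lt_of_mem_pcomp (ball_subset_pcomp hr hN ha.1 ?_)
      refine closedBall_subset_ball ?_ hw
      rw [← hV, ← hd, hρ, ← mul_div_assoc, div_lt_div_iff₀ (by positivity) (by positivity)]
      nlinarith [mul_pos hd0 (show 0 < distC N by linarith)]
    obtain ⟨b, hb, hbo⟩ := exists_osc hq hr hN ha.1 ha.2
    obtain ⟨b', hb', hbm⟩ : ∃ b' ∈ closedBall a ρ, oscC N * r / ρ ≤ ‖q.derivative.eval b'‖ := by
      by_contra! hcon
      obtain ⟨v, hv, hvm⟩ := (isCompact_closedBall a ρ).exists_isMaxOn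
        (f := fun w => ‖q.derivative.eval w‖) ⟨a, mem_closedBall_self hρ0.le⟩ (by fun_prop)
      have h1 := (convex_closedBall a ρ).norm_image_sub_le_of_norm_deriv_le
        (f := fun w => q.eval w) (C := ‖q.derivative.eval v‖) (fun w _ => q.differentiable w)
        (fun w hw => by rw [Polynomial.deriv]; exact hvm hw) (mem_closedBall_self hρ0.le) hb
      have h2 : ‖b - a‖ ≤ ρ := by simpa [dist_eq_norm] using hb
      have h3 := hcon v hv
      rw [lt_div_iff₀ hρ0] at h3
      have h4 : ‖q.derivative.eval v‖ * ‖b - a‖ ≤ ‖q.derivative.eval v‖ * ρ := by gcongr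
      linarith
    have hup : ∀ w ∈ closedBall a (8 * ρ), ‖q.derivative.eval w‖ ≤ r / ρ := by
      intro w hw
      have h1 := Complex.norm_deriv_le_of_forall_mem_sphere_norm_le (c := w) (R := 8 * ρ)
        (C := 2 * r) (f := fun v => q.eval v - z) (by positivity)
        (Differentiable.diffContOnCl (by fun_prop)) (fun v hv => (hball v ?_).le)
      · rw [deriv_sub_const, Polynomial.deriv] at h1
        refine h1.trans ?_
        rw [div_le_div_iff₀ (by positivity) (by positivity)]
        nlinarith [mul_pos hr hρ0]
      · have := mem_sphere.1 hv
        have := mem_closedBall.1 hw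
        have := dist_triangle v w a
        rw [mem_closedBall]; linarith
    set κ : ℝ := ρ / (oscC N * r) with hκ
    have hκ0 : 0 < κ := by positivity
    have hFe : ∀ w, ‖(Polynomial.C (κ : ℂ) * q.derivative).eval w‖ =
        κ * ‖q.derivative.eval w‖ := by
      intro w
      rw [Polynomial.eval_mul, Polynomial.eval_C, norm_mul, Complex.norm_real,
        Real.norm_of_nonneg hκ0.le]
    have h1 := hrem (Polynomial.C (κ : ℂ) * q.derivative) a ρ hρ0
      (fun w hw => by
        rw [hFe]
        calc κ * ‖q.derivative.eval w‖ ≤ κ * (r / ρ) := by gcongr; exact hup w hw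
          _ = _ := by rw [hκ]; field_simp)
      ⟨b', hb', by
        rw [hFe]
        calc (1 : ℝ) = κ * (oscC N * r / ρ) := by rw [hκ]; field_simp
          _ ≤ _ := by gcongr⟩ (κ * t) (by positivity)
    have h2 : {w | ‖(Polynomial.C (κ : ℂ) * q.derivative).eval w‖ ≤ κ * t} =
        {w | ‖q.derivative.eval w‖ ≤ t} := by
      ext w
      simp only [mem_ofPred_eq, hFe]
      exact mul_le_mul_iff_right₀ hκ0
    rw [h2] at h1
    refine h1.trans (ENNReal.ofReal_le_ofReal ?_)
    calc C * ρ ^ 2 * (κ * t) ^ s ≤ C * d ^ 2 * ((1 / oscC N) * (t * d / r)) ^ s := by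
          have hk : κ * t ≤ 1 / oscC N * (t * d / r) := ?_
          · gcongr
          rw [hκ]
          calc ρ / (oscC N * r) * t ≤ d / (oscC N * r) * t := by gcongr
            _ = 1 / oscC N * (t * d / r) := by field_simp
      _ = _ := by rw [Real.mul_rpow (by positivity) (by positivity)]; ring
  rcases exists_separated_or_cover A hρ0 M with ⟨S, hcard, hSA, hS⟩ | ⟨S, hcard, hSA, hS⟩
  · exfalso
    have h1 := card_separated_le hρ0 hρd hAsub hSA hS
    rw [hcard, hρ, div_div_cancel₀ hd0.ne'] at h1
    linarith
  · have hsub : {w ∈ V | ‖q.eval w - z‖ < r / 2 ∧ ‖q.derivative.eval w‖ ≤ t} ⊆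
        ⋃ a ∈ S, (ball a ρ ∩ {w | ‖q.derivative.eval w‖ ≤ t}) := by
      rintro w ⟨hw1, hw2, hw3⟩
      have hwA : w ∈ A := ⟨hw1, hw2⟩
      obtain ⟨a, haS, hwa⟩ := mem_iUnion₂.1 (hS hwA)
      exact mem_iUnion₂.2 ⟨a, haS, hwa, hw3⟩
    set B := C * (1 / oscC N) ^ s * d ^ 2 * (t * d / r) ^ s with hB
    have hB0 : 0 ≤ B := by positivity
    calc _ ≤ volume (⋃ a ∈ S, (ball a ρ ∩ {w | ‖q.derivative.eval w‖ ≤ t})) := measure_mono hsub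
      _ ≤ ∑ a ∈ S, volume (ball a ρ ∩ {w | ‖q.derivative.eval w‖ ≤ t}) :=
        measure_biUnion_finset_le _ _
      _ ≤ ∑ a ∈ S, ENNReal.ofReal B := Finset.sum_le_sum fun a ha => hlocal a (hSA ha)
      _ = ENNReal.ofReal (S.card * B) := by
        rw [Finset.sum_const, nsmul_eq_mul, ← ENNReal.ofReal_natCast,
          ← ENNReal.ofReal_mul (by positivity)]
      _ ≤ ENNReal.ofReal (M * B) := by
        refine ENNReal.ofReal_le_ofReal ?_
        gcongr
      _ = _ := by rw [hB]; congr 1; ring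

/-- A component has area comparable with the preimage of a smaller disc inside. -/
lemma volume_pcomp_le {N : ℕ} {q : Polynomial ℂ} (hq : 1 ≤ q.natDegree) {z : ℂ} {r : ℝ}
    (hr : 0 < r) (hN : FibreBound q z (2 * r) N) {z' : ℂ} {η : ℝ} (hη : 0 < η)
    (hzz : ball z' η ⊆ ball z r) (x : ℂ) :
    volume (pcomp q z r x) ≤ ENNReal.ofReal ((8 * distC N * r / η) ^ 2) *
      volume (pcomp q z r x ∩ (fun w => q.eval w) ⁻¹' ball z' η) := by
  have hD := one_le_distC N
  have hpi := Real.pi_pos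
  set V := pcomp q z r x with hV
  rcases V.eq_empty_or_nonempty with hVe | ⟨x₁, hx₁⟩
  · rw [hVe, measure_empty]; exact zero_le
  have hd0 : 0 < diam V := by
    rw [hV, pcomp_eq hx₁]; exact diam_pcomp_pos hq (self_mem_pcomp (norm_lt_of_mem_pcomp hx₁))
  set d := diam V with hd
  set ρ := d / (2 * distC N) with hρ
  have hρ0 : 0 < ρ := by positivity
  have hηr : η ≤ r := by
    have h1 := measure_mono (μ := volume) hzz
    rw [volume_ball_eq _ hη.le, volume_ball_eq _ hr.le,
      ENNReal.ofReal_le_ofReal_iff (by positivity)] at h1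
    exact le_of_sq_le_sq (by nlinarith) hr.le
  obtain ⟨a, haV, haz⟩ := image_pcomp hq (pcomp_nonempty_imp hx₁) (hzz (mem_ball_self hη))
  simp only at haz
  have hz' : ‖z' - z‖ < r := by simpa [dist_eq_norm] using hzz (mem_ball_self hη)
  set δ := ρ * η / (4 * r) with hδ
  have hδ0 : 0 < δ := by positivity
  have hδρ : δ ≤ ρ := by
    rw [hδ, div_le_iff₀ (by positivity)]
    nlinarith
  have hmaps : MapsTo (fun w => q.eval w) (ball a ρ) (ball (q.eval a) (4 * r)) := by
    intro w hw
    have h1 := norm_lt_of_mem_pcomp (ball_subset_pcomp hr hN haV hw)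
    rw [mem_ball, dist_eq_norm, haz]
    have h2 := norm_sub_le_norm_sub_add_norm_sub (q.eval w) z z'
    rw [norm_sub_rev z z'] at h2
    linarith
  have hsmall : ∀ w ∈ ball a δ, q.eval w ∈ ball z' η := by
    intro w hw
    have h1 := Complex.dist_le_div_mul_dist_of_mapsTo_ball (q.differentiable.differentiableOn)
      (hmaps.mono_right ball_subset_closedBall) (ball_subset_ball hδρ hw)
    rw [haz] at h1
    rw [mem_ball]
    calc dist (q.eval w) z' ≤ 4 * r / ρ * dist w a := h1
      _ < 4 * r / ρ * δ := by gcongr; exact hw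
      _ = η := by rw [hδ]; field_simp
  have hsub : ball a δ ⊆ V ∩ (fun w => q.eval w) ⁻¹' ball z' η := by
    refine subset_inter ?_ hsmall
    refine subset_pcomp (convex_ball a δ).isPreconnected (fun w hw => ?_) (mem_ball_self hδ0) haV
    simpa [dist_eq_norm] using hzz (hsmall w hw)
  have hsub2 : V ⊆ closedBall x₁ d := fun w hw =>
    mem_closedBall.2 (dist_le_diam_of_mem (isBounded_pcomp hq z r x) hw hx₁)
  calc volume V ≤ volume (closedBall x₁ d) := measure_mono hsub2
    _ = volume (ball x₁ d) := by rw [Complex.volume_closedBall, Complex.volume_ball]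
    _ = ENNReal.ofReal ((8 * distC N * r / η) ^ 2) * volume (ball a δ) := by
      rw [volume_ball_eq _ hd0.le, volume_ball_eq _ hδ0.le,
        ← ENNReal.ofReal_mul (by positivity)]
      congr 1
      rw [hδ, hρ]
      field_simp
      ring
    _ ≤ _ := by gcongr

/-- The components of the preimage of a disc. -/
noncomputable def pcomps (q : Polynomial ℂ) (z : ℂ) (r : ℝ) : Finset (Set ℂ) :=
  open Classical in ((q - Polynomial.C z).roots.toFinset).image fun s => pcomp q z r s

lemma card_pcomps_le (q : Polynomial ℂ) (z : ℂ) (r : ℝ) :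
    (pcomps q z r).card ≤ q.natDegree := by
  classical
  refine Finset.card_image_le.trans ((Multiset.toFinset_card_le _).trans ?_)
  refine (Polynomial.card_roots' _).trans ?_
  rw [Polynomial.natDegree_sub_C]

lemma exists_of_mem_pcomps {q : Polynomial ℂ} {z : ℂ} {r : ℝ} {V : Set ℂ}
    (hV : V ∈ pcomps q z r) : ∃ s, V = pcomp q z r s := by
  classical
  obtain ⟨s, -, rfl⟩ := Finset.mem_image.1 hV
  exact ⟨s, rfl⟩

lemma exists_mem_pcomps {q : Polynomial ℂ} (hq : 1 ≤ q.natDegree) {z : ℂ} {r : ℝ} {w : ℂ}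
    (hw : ‖q.eval w - z‖ < r) : ∃ V ∈ pcomps q z r, w ∈ V := by
  classical
  have hr : 0 < r := (norm_nonneg _).trans_lt hw
  obtain ⟨s, hs, hsz⟩ := image_pcomp hq hw (mem_ball_self hr)
  refine ⟨pcomp q z r s, ?_, ?_⟩
  · refine Finset.mem_image.2 ⟨s, ?_, rfl⟩
    have hne : q - Polynomial.C z ≠ 0 := by
      intro h
      have := congrArg Polynomial.natDegree h
      rw [Polynomial.natDegree_sub_C, Polynomial.natDegree_zero] at this
      omega
    simp only at hsz
    simp [hne, hsz]
  · rw [← pcomp_eq hs]; exact self_mem_pcomp hw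

lemma pcomps_pairwiseDisjoint (q : Polynomial ℂ) (z : ℂ) (r : ℝ) :
    (pcomps q z r : Set (Set ℂ)).PairwiseDisjoint id := by
  intro V hV W hW hne
  obtain ⟨s, rfl⟩ := exists_of_mem_pcomps hV
  obtain ⟨s', rfl⟩ := exists_of_mem_pcomps hW
  rw [Function.onFun, id, id, disjoint_left]
  intro w hw hw'
  exact hne (by rw [pcomp_eq hw, pcomp_eq hw'])

lemma volume_small_deriv_total (N : ℕ) (d₀ : ℝ) : ∃ C s : ℝ, 0 < C ∧ 0 < s ∧
    ∀ (q : Polynomial ℂ),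
    1 ≤ q.natDegree → ∀ (z : ℂ) (r : ℝ), 0 < r → FibreBound q z (2 * r) N →
    (∀ x, diam (pcomp q z r x) ≤ d₀) → ∀ t : ℝ, 0 < t →
    volume {w | ‖q.eval w - z‖ < r / 2 ∧ ‖q.derivative.eval w‖ ≤ t} ≤
      ENNReal.ofReal (C * q.natDegree * (t / r) ^ s) := by
  obtain ⟨C, s, hC, hs, h⟩ := volume_small_deriv N
  refine ⟨C * (|d₀| + 1) ^ 2 * (|d₀| + 1) ^ s, s, by positivity, hs, ?_⟩
  intro q hq z r hr hN hd t ht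
  have hsub : {w | ‖q.eval w - z‖ < r / 2 ∧ ‖q.derivative.eval w‖ ≤ t} ⊆
      ⋃ V ∈ pcomps q z r, {w ∈ V | ‖q.eval w - z‖ < r / 2 ∧ ‖q.derivative.eval w‖ ≤ t} := by
    intro w hw
    obtain ⟨V, hV, hwV⟩ := exists_mem_pcomps hq (show ‖q.eval w - z‖ < r by linarith [hw.1])
    exact mem_iUnion₂.2 ⟨V, hV, hwV, hw⟩
  set B := C * (|d₀| + 1) ^ 2 * (t * (|d₀| + 1) / r) ^ s with hB
  have hB0 : 0 ≤ B := by positivity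
  calc _ ≤ _ := measure_mono hsub
    _ ≤ ∑ V ∈ pcomps q z r,
        volume {w ∈ V | ‖q.eval w - z‖ < r / 2 ∧ ‖q.derivative.eval w‖ ≤ t} :=
      measure_biUnion_finset_le _ _
    _ ≤ ∑ V ∈ pcomps q z r, ENNReal.ofReal B := by
      refine Finset.sum_le_sum fun V hV => ?_
      obtain ⟨x, rfl⟩ := exists_of_mem_pcomps hV
      refine (h q hq z r hr hN x t ht).trans (ENNReal.ofReal_le_ofReal ?_)
      have h1 : diam (pcomp q z r x) ≤ |d₀| + 1 :=
        (hd x).trans ((le_abs_self d₀).trans (by linarith))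
      have h2 : 0 ≤ diam (pcomp q z r x) := diam_nonneg
      rw [hB]
      gcongr
    _ = ENNReal.ofReal ((pcomps q z r).card * B) := by
      rw [Finset.sum_const, nsmul_eq_mul, ← ENNReal.ofReal_natCast,
        ← ENNReal.ofReal_mul (by positivity)]
    _ ≤ ENNReal.ofReal (q.natDegree * B) := by
      refine ENNReal.ofReal_le_ofReal ?_
      gcongr
      exact card_pcomps_le q z r
    _ = _ := by
      rw [hB, show t * (|d₀| + 1) / r = (|d₀| + 1) * (t / r) by ring,
        Real.mul_rpow (by positivity) (by positivity)]
      congr 1; ring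

lemma volume_preimage_ball_le {N : ℕ} {q : Polynomial ℂ} (hq : 1 ≤ q.natDegree) {z : ℂ} {r : ℝ}
    (hr : 0 < r) (hN : FibreBound q z (2 * r) N) {z' : ℂ} {η : ℝ} (hη : 0 < η)
    (hzz : ball z' η ⊆ ball z r) :
    volume {w | ‖q.eval w - z‖ < r} ≤ ENNReal.ofReal ((8 * distC N * r / η) ^ 2) *
      volume ((fun w => q.eval w) ⁻¹' ball z' η) := by
  set B := (fun w => q.eval w) ⁻¹' ball z' η with hB
  have hBm : MeasurableSet B := (isOpen_preimage_ball q z' η).measurableSet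
  calc _ ≤ volume (⋃ V ∈ pcomps q z r, V) := by
        refine measure_mono fun w hw => ?_
        obtain ⟨V, hV, hwV⟩ := exists_mem_pcomps hq hw
        exact mem_iUnion₂.2 ⟨V, hV, hwV⟩
    _ ≤ ∑ V ∈ pcomps q z r, volume V := measure_biUnion_finset_le _ _
    _ ≤ ∑ V ∈ pcomps q z r, ENNReal.ofReal ((8 * distC N * r / η) ^ 2) * volume (V ∩ B) := by
      refine Finset.sum_le_sum fun V hV => ?_
      obtain ⟨x, rfl⟩ := exists_of_mem_pcomps hV
      exact volume_pcomp_le hq hr hN hη hzz x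
    _ = ENNReal.ofReal ((8 * distC N * r / η) ^ 2) *
        volume (⋃ V ∈ pcomps q z r, (V ∩ B)) := by
      rw [← Finset.mul_sum, measure_biUnion_finset]
      · exact fun V hV W hW hne => ((pcomps_pairwiseDisjoint q z r) hV hW hne).mono
          inter_subset_left inter_subset_left
      · intro V hV
        obtain ⟨x, rfl⟩ := exists_of_mem_pcomps hV
        exact (isOpen_pcomp q z r x).measurableSet.inter hBm
    _ ≤ _ := by
      gcongr
      exact iUnion₂_subset fun V _ => inter_subset_right

/-- The `n`-th iterate of a polynomial. -/
noncomputable def it (p : Polynomial ℂ) (n : ℕ) : Polynomial ℂ := p.comp^[n] Polynomial.X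

lemma eval_it (p : Polynomial ℂ) (n : ℕ) (z : ℂ) :
    (it p n).eval z = (fun w => p.eval w)^[n] z := by
  rw [it, Polynomial.iterate_comp_eval, Polynomial.eval_X]

lemma natDegree_it (p : Polynomial ℂ) (n : ℕ) : (it p n).natDegree = p.natDegree ^ n := by
  rw [it, Polynomial.natDegree_iterate_comp, Polynomial.natDegree_X, mul_one]

lemma one_le_natDegree_it {p : Polynomial ℂ} (hp : 1 ≤ p.natDegree) (n : ℕ) :
    1 ≤ (it p n).natDegree := by
  rw [natDegree_it]; exact Nat.one_le_pow _ _ hp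

lemma eval_it_add (p : Polynomial ℂ) (m n : ℕ) (z : ℂ) :
    (it p (m + n)).eval z = (it p m).eval ((it p n).eval z) := by
  simp only [eval_it, Function.iterate_add_apply]

lemma eval_it_zero (p : Polynomial ℂ) (z : ℂ) : (it p 0).eval z = z := by
  simp [eval_it]

lemma eval_it_one (p : Polynomial ℂ) (z : ℂ) : (it p 1).eval z = p.eval z := by
  simp [eval_it]

lemma eval_it_succ (p : Polynomial ℂ) (n : ℕ) (z : ℂ) :
    (it p (n + 1)).eval z = p.eval ((it p n).eval z) := by
  rw [add_comm, eval_it_add, eval_it_one]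

lemma hasDerivAt_it (p : Polynomial ℂ) (n : ℕ) (z : ℂ) :
    HasDerivAt (fun w => (it p n).eval w) ((it p n).derivative.eval z) z :=
  (it p n).hasDerivAt z

lemma derivative_it_add (p : Polynomial ℂ) (m n : ℕ) (z : ℂ) :
    (it p (m + n)).derivative.eval z =
      (it p m).derivative.eval ((it p n).eval z) * (it p n).derivative.eval z := by
  have h1 := hasDerivAt_it p (m + n) z
  have h2 := (hasDerivAt_it p m ((it p n).eval z)).comp z (hasDerivAt_it p n z)
  have : (fun w => (it p (m + n)).eval w) =
      (fun w => (it p m).eval w) ∘ fun w => (it p n).eval w :=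
    funext fun w => eval_it_add p m n w
  rw [this] at h1
  exact h1.unique h2

lemma iteratedDeriv_polynomial (q : Polynomial ℂ) (k : ℕ) :
    iteratedDeriv k (fun z => q.eval z) = fun z => (Polynomial.derivative^[k] q).eval z := by
  induction k with
  | zero => simp
  | succ k ih =>
    rw [iteratedDeriv_succ, ih, Function.iterate_succ_apply']
    funext z
    exact Polynomial.deriv _

lemma one_le_vanishingOrder {q : Polynomial ℂ} (hq : q ≠ 0) {z : ℂ} (hz : q.eval z = 0) :
    1 ≤ vanishingOrder (fun w => q.eval w) z := by
  rw [Nat.one_le_iff_ne_zero, vanishingOrder, Ne, Nat.sInf_eq_zero, not_or]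
  constructor
  · simp [hz]
  · rw [← Ne, ← nonempty_iff_ne_empty]
    refine ⟨q.natDegree, ?_⟩
    have hdeg : (Polynomial.derivative^[q.natDegree] q).natDegree = 0 := by
      have := Polynomial.natDegree_iterate_derivative q q.natDegree
      omega
    have hc : (Polynomial.derivative^[q.natDegree] q).coeff 0 ≠ 0 := by
      rw [Polynomial.coeff_iterate_derivative]
      simp only [zero_add, Nat.descFactorial_self, nsmul_eq_mul]
      refine mul_ne_zero (Nat.cast_ne_zero.2 (Nat.factorial_ne_zero _)) ?_
      simpa using hq
    change iteratedDeriv _ _ _ ≠ 0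
    rw [iteratedDeriv_polynomial]
    rw [Polynomial.eq_C_of_natDegree_eq_zero hdeg]
    simpa using hc

lemma fibreBound_natDegree {q : Polynomial ℂ} (hq : 1 ≤ q.natDegree) (z : ℂ) (r : ℝ) :
    FibreBound q z r q.natDegree := by
  classical
  intro x u
  have hne : q - Polynomial.C u ≠ 0 := fun h => by
    have := congrArg Polynomial.natDegree h
    rw [Polynomial.natDegree_sub_C, Polynomial.natDegree_zero] at this
    omega
  have hsub : pcomp q z r x ∩ (fun w => q.eval w) ⁻¹' {u} ⊆
      ((q - Polynomial.C u).roots.toFinset : Set ℂ) := by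
    rintro w ⟨-, hw⟩
    simp only [mem_preimage, mem_singleton_iff] at hw
    simp [hne, hw]
  refine (encard_le_encard hsub).trans ?_
  rw [encard_coe_eq_coe_finsetCard]
  have h1 := Multiset.toFinset_card_le (q - Polynomial.C u).roots
  have h2 := Polynomial.card_roots' (q - Polynomial.C u)
  rw [Polynomial.natDegree_sub_C] at h2
  exact_mod_cast h1.trans h2

lemma SemiHyperbolic.exists_fibreBound {p : Polynomial ℂ} (hp : 1 ≤ p.natDegree)
    (h : SemiHyperbolic p) : ∃ ε : ℝ, 0 < ε ∧ ∃ N : ℕ, ∀ z ∈ juliaSet (fun w => p.eval w),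
      ∀ n, FibreBound (it p n) z ε N := by
  classical
  obtain ⟨ε, hε, N, hN⟩ := h
  refine ⟨ε, hε, max N 1, fun z hz n => ?_⟩
  rcases Nat.eq_zero_or_pos n with rfl | hn
  · intro x u
    have := fibreBound_natDegree (one_le_natDegree_it hp 0) z ε x u
    rw [natDegree_it, pow_zero] at this
    exact this.trans (by exact_mod_cast le_max_right _ _)
  intro x u
  have hpre : (fun w => (it p n).eval w) ⁻¹' ball z ε = (fun w => p.eval w)^[n] ⁻¹' ball z ε := by
    ext w; simp [eval_it]
  rcases (pcomp (it p n) z ε x ∩ (fun w => (it p n).eval w) ⁻¹' {u}).eq_empty_or_nonempty with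
    he | ⟨w, hwV, hwu⟩
  · rw [he]; simp
  have hx := pcomp_nonempty_imp hwV
  have hu := norm_lt_of_mem_pcomp hwV
  have hwu' : (it p n).eval w = u := hwu
  rw [hwu'] at hu
  have key := hN z hz n hn (pcomp (it p n) z ε x) ⟨x, by
    rw [← hpre]; simpa [dist_eq_norm] using hx, by rw [← hpre]; rfl⟩ u
    (by simpa [dist_eq_norm] using hu)
  set V := pcomp (it p n) z ε x
  have hset : {v : ℂ | v ∈ V ∧ (fun v => p.eval v)^[n] v = u} =
      V ∩ (fun w => (it p n).eval w) ⁻¹' {u} := by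
    ext v; simp [eval_it]
  rw [hset] at key
  have hfun : (fun ζ => (fun v => p.eval v)^[n] ζ - u) =
      fun ζ => (it p n - Polynomial.C u).eval ζ := by
    funext ζ; simp [eval_it]
  rw [hfun] at key
  have hfb := fibreBound_natDegree (one_le_natDegree_it hp n) z ε x u
  have hfin : (V ∩ (fun w => (it p n).eval w) ⁻¹' {u}).Finite :=
    finite_of_encard_le_coe hfb
  rw [finsum_mem_eq_finite_toFinset_sum _ hfin] at key
  have hne : it p n - Polynomial.C u ≠ 0 := fun h => by
    have := congrArg Polynomial.natDegree h
    rw [Polynomial.natDegree_sub_C, Polynomial.natDegree_zero] at this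
    have := one_le_natDegree_it hp n
    omega
  have h1 : hfin.toFinset.card ≤ N := by
    refine le_trans ?_ key
    rw [Finset.card_eq_sum_ones]
    refine Finset.sum_le_sum fun v hv => one_le_vanishingOrder hne ?_
    have : (it p n).eval v = u := ((hfin.mem_toFinset).1 hv).2
    simp [this]
  rw [hfin.encard_eq_coe_toFinset_card]
  exact_mod_cast h1.trans (le_max_left _ _)

lemma exists_norm_eval_le (q : Polynomial ℂ) (n : ℕ) (hq : q.natDegree ≤ n) :
    ∃ C : ℝ, 0 ≤ C ∧ ∀ v : ℂ, 1 ≤ ‖v‖ → ‖q.eval v‖ ≤ C * ‖v‖ ^ n := by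
  refine ⟨∑ i ∈ Finset.range (n + 1), ‖q.coeff i‖, by positivity, fun v hv => ?_⟩
  rw [Polynomial.eval_eq_sum_range' (Nat.lt_succ_of_le hq), Finset.sum_mul]
  refine (norm_sum_le _ _).trans (Finset.sum_le_sum fun i hi => ?_)
  rw [norm_mul, norm_pow]
  have hi' := Nat.lt_succ_iff.1 (Finset.mem_range.1 hi)
  gcongr

/-- The radius `R` is large enough for the polynomial to behave like its leading term. -/
def EscR (p : Polynomial ℂ) (R : ℝ) : Prop :=
  2 ≤ R ∧ ∀ v : ℂ, R ≤ ‖v‖ → 2 * ‖v‖ ≤ ‖p.eval v‖ ∧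
    3 / 2 * Real.log ‖v‖ ≤ Real.log ‖p.eval v‖ ∧
    3 / 2 * ‖p.eval v‖ ≤ ‖v‖ * ‖p.derivative.eval v‖

lemma exists_escR_ge {p : Polynomial ℂ} (hd : 2 ≤ p.natDegree) (R₀ : ℝ) :
    ∃ R, R₀ ≤ R ∧ EscR p R := by
  obtain ⟨d, hdd⟩ : ∃ d, p.natDegree = d + 1 := ⟨p.natDegree - 1, by omega⟩
  have hlead : p.leadingCoeff ≠ 0 := by
    rw [Polynomial.leadingCoeff_ne_zero]; rintro rfl; simp at hd
  obtain ⟨C₁, hC₁0, hC₁⟩ := exists_norm_eval_le p.eraseLead d (by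
    have := Polynomial.eraseLead_natDegree_le p; omega)
  have hdeg2 : (Polynomial.C ((d : ℂ) + 1) * p - Polynomial.X * p.derivative).natDegree ≤ d := by
    rw [Polynomial.natDegree_le_iff_coeff_eq_zero]
    intro k hk
    rw [Polynomial.coeff_sub, Polynomial.coeff_C_mul]
    obtain ⟨k, rfl⟩ : ∃ j, k = j + 1 := ⟨k - 1, by omega⟩
    rw [Polynomial.coeff_X_mul, Polynomial.coeff_derivative]
    rcases Nat.lt_or_ge d k with h | h
    · rw [Polynomial.coeff_eq_zero_of_natDegree_lt (by omega)]; ring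
    · have : k = d := by omega
      subst this; ring
  obtain ⟨C₂, hC₂0, hC₂⟩ := exists_norm_eval_le _ d hdeg2
  set c := ‖p.leadingCoeff‖ / 2 with hc
  have hc0 : 0 < c := by rw [hc]; positivity
  set R := max R₀ (max 2 (max (C₁ / c) (max (2 / c) (max (1 / c ^ 2) (2 * C₂ / c))))) with hR
  have hle : R₀ ≤ R ∧ 2 ≤ R ∧ C₁ / c ≤ R ∧ 2 / c ≤ R ∧ 1 / c ^ 2 ≤ R ∧ 2 * C₂ / c ≤ R := by
    simp [hR]
  obtain ⟨h0, h2, hR1, hR2, hR3, hR4⟩ := hle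
  refine ⟨R, h0, h2, fun v hv => ?_⟩
  have hv1 : 1 ≤ ‖v‖ := by linarith
  have hv2 : 2 ≤ ‖v‖ := by linarith
  have e1 : p.eval v = p.eraseLead.eval v + p.leadingCoeff * v ^ (d + 1) := by
    conv_lhs => rw [← Polynomial.eraseLead_add_C_mul_X_pow p]
    simp [hdd]
  have hlow : c * ‖v‖ ^ (d + 1) ≤ ‖p.eval v‖ := by
    have a1 := hC₁ v hv1
    have a2 : ‖p.leadingCoeff * v ^ (d + 1)‖ ≤ ‖p.eval v‖ + ‖p.eraseLead.eval v‖ := by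
      have : p.leadingCoeff * v ^ (d + 1) = p.eval v - p.eraseLead.eval v := by rw [e1]; ring
      rw [this]; exact norm_sub_le _ _
    rw [norm_mul, norm_pow] at a2
    have a3 : C₁ ≤ c * ‖v‖ := by
      have := hR1.trans hv
      rw [div_le_iff₀ hc0] at this; linarith
    have a4 : C₁ * ‖v‖ ^ d ≤ c * ‖v‖ ^ (d + 1) := by
      rw [pow_succ]
      calc C₁ * ‖v‖ ^ d ≤ c * ‖v‖ * ‖v‖ ^ d := by gcongr
        _ = _ := by ring
    have a5 : ‖p.leadingCoeff‖ = 2 * c := by rw [hc]; ring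
    rw [a5] at a2
    linarith
  have hlow2 : c * ‖v‖ ^ 2 ≤ ‖p.eval v‖ := by
    refine le_trans ?_ hlow
    have : 2 ≤ d + 1 := by omega
    gcongr
  have hA : 2 * ‖v‖ ≤ ‖p.eval v‖ := by
    refine le_trans ?_ hlow2
    have := hR2.trans hv
    rw [div_le_iff₀ hc0] at this
    nlinarith
  refine ⟨hA, ?_, ?_⟩
  · have b1 : Real.log (c * ‖v‖ ^ 2) ≤ Real.log ‖p.eval v‖ :=
      Real.log_le_log (by positivity) hlow2
    rw [Real.log_mul hc0.ne' (by positivity), Real.log_pow] at b1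
    have b2 : Real.log (1 / c ^ 2) ≤ Real.log ‖v‖ :=
      Real.log_le_log (by positivity) (hR3.trans hv)
    rw [one_div, Real.log_inv, Real.log_pow] at b2
    push_cast at b1 b2
    linarith
  · have b1 := hC₂ v hv1
    simp only [Polynomial.eval_sub, Polynomial.eval_mul, Polynomial.eval_C, Polynomial.eval_X]
      at b1
    have b2 : ‖((d : ℂ) + 1) * p.eval v‖ ≤
        ‖((d : ℂ) + 1) * p.eval v - v * p.derivative.eval v‖ + ‖v * p.derivative.eval v‖ := by
      simpa using norm_add_le (((d : ℂ) + 1) * p.eval v - v * p.derivative.eval v)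
        (v * p.derivative.eval v)
    rw [norm_mul, norm_mul] at b2
    have b3 : ‖((d : ℂ) + 1)‖ = d + 1 := by
      have := Complex.norm_natCast (d + 1)
      push_cast at this; exact this
    have b4 : (1 : ℝ) ≤ d := by
      have : 1 ≤ d := by omega
      exact_mod_cast this
    have b5 : C₂ * ‖v‖ ^ d ≤ 1 / 2 * ‖p.eval v‖ := by
      have := hR4.trans hv
      rw [div_le_iff₀ hc0] at this
      have b6 : C₂ * ‖v‖ ^ d ≤ 1 / 2 * (c * ‖v‖ ^ (d + 1)) := by
        rw [pow_succ]
        calc C₂ * ‖v‖ ^ d ≤ (1 / 2 * (‖v‖ * c)) * ‖v‖ ^ d := by gcongr; linarith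
          _ = _ := by ring
      linarith
    rw [b3] at b2
    nlinarith [norm_nonneg (p.eval v)]

lemma EscR.iterate {p : Polynomial ℂ} {R : ℝ} (h : EscR p R) {v : ℂ} (hv : R ≤ ‖v‖) (n : ℕ) :
    2 ^ n * ‖v‖ ≤ ‖(it p n).eval v‖ := by
  induction n with
  | zero => simp [eval_it_zero]
  | succ n ih =>
    have h1 : R ≤ ‖(it p n).eval v‖ :=
      le_trans (hv.trans (le_mul_of_one_le_left (norm_nonneg _) (one_le_pow₀ (by norm_num)))) ih
    rw [eval_it_succ]
    have := (h.2 _ h1).1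
    rw [pow_succ]; linarith

lemma EscR.iterate_ge {p : Polynomial ℂ} {R : ℝ} (h : EscR p R) {v : ℂ} (hv : R ≤ ‖v‖) (n : ℕ) :
    R ≤ ‖(it p n).eval v‖ :=
  le_trans (hv.trans (le_mul_of_one_le_left (norm_nonneg _) (one_le_pow₀ (by norm_num))))
    (h.iterate hv n)

lemma EscR.mono_ge {p : Polynomial ℂ} {R : ℝ} (h : EscR p R) {v : ℂ} {k n : ℕ} (hkn : k ≤ n)
    (hv : R ≤ ‖(it p k).eval v‖) : R ≤ ‖(it p n).eval v‖ := by
  obtain ⟨j, rfl⟩ := Nat.exists_eq_add_of_le hkn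
  rw [add_comm, eval_it_add]
  exact h.iterate_ge hv j

lemma EscR.lt_of_lt {p : Polynomial ℂ} {R : ℝ} (h : EscR p R) {v : ℂ} {k n : ℕ} (hkn : k ≤ n)
    (hv : ‖(it p n).eval v‖ < R) : ‖(it p k).eval v‖ < R := by
  by_contra! hc
  exact absurd (h.mono_ge hkn hc) (not_le.2 hv)

lemma EscR.log_iterate {p : Polynomial ℂ} {R : ℝ} (h : EscR p R) {v : ℂ} (hv : R ≤ ‖v‖) (n : ℕ) :
    (3 / 2) ^ n * Real.log ‖v‖ ≤ Real.log ‖(it p n).eval v‖ := by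
  induction n with
  | zero => simp [eval_it_zero]
  | succ n ih =>
    rw [eval_it_succ]
    have := (h.2 _ (h.iterate_ge hv n)).2.1
    rw [pow_succ]; linarith

lemma EscR.deriv_iterate {p : Polynomial ℂ} {R : ℝ} (h : EscR p R) {v : ℂ} (hv : R ≤ ‖v‖)
    (n : ℕ) : (3 / 2) ^ n * ‖(it p n).eval v‖ ≤ ‖v‖ * ‖(it p n).derivative.eval v‖ := by
  induction n with
  | zero => simp [it]
  | succ n ih =>
    rw [add_comm n 1, derivative_it_add, norm_mul, eval_it_add, eval_it_one]
    have h1 : (it p 1) = p := by simp [it]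
    rw [h1]
    set u := (it p n).eval v
    have hu : R ≤ ‖u‖ := h.iterate_ge hv n
    have h2 := (h.2 u hu).2.2
    have hupos : 0 < ‖u‖ := by linarith [h.1]
    have h3 : (3 / 2 * ‖p.eval u‖) * ((3 / 2) ^ n * ‖u‖) ≤
        (‖u‖ * ‖p.derivative.eval u‖) * (‖v‖ * ‖(it p n).derivative.eval v‖) := by
      gcongr
    rw [add_comm 1 n, pow_succ]
    have h4 : ‖u‖ * ((3 / 2) ^ n * (3 / 2) * ‖p.eval u‖) ≤
        ‖u‖ * (‖v‖ * (‖p.derivative.eval u‖ * ‖(it p n).derivative.eval v‖)) := by linarith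
    exact le_of_mul_le_mul_left h4 hupos

/-- The filled Julia set. -/
def filled (p : Polynomial ℂ) (R : ℝ) : Set ℂ := {z | ∀ n, ‖(it p n).eval z‖ < R}

lemma EscR.tendsto_of_notMem {p : Polynomial ℂ} {R : ℝ} (h : EscR p R) {v : ℂ}
    (hv : v ∉ filled p R) : Tendsto (fun n => ‖(it p n).eval v‖) atTop atTop := by
  simp only [filled, Set.mem_ofPred_eq, not_forall, not_lt] at hv
  obtain ⟨k, hk⟩ := hv
  rw [← tendsto_add_atTop_iff_nat k]
  refine tendsto_atTop_mono (f := fun n : ℕ => (2 : ℝ) ^ n) (fun n => ?_)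
    (tendsto_pow_atTop_atTop_of_one_lt (by norm_num))
  rw [eval_it_add]
  refine le_trans ?_ (h.iterate hk n)
  exact le_mul_of_one_le_right (by positivity) (by linarith [h.1])

lemma continuous_it (p : Polynomial ℂ) (n : ℕ) : Continuous fun w => (it p n).eval w :=
  (it p n).continuous

lemma EscR.filled_eq {p : Polynomial ℂ} {R : ℝ} (h : EscR p R) :
    filled p R = {z | ∀ n, ‖(it p n).eval z‖ ≤ R} := by
  ext z
  refine ⟨fun hz n => (hz n).le, fun hz n => lt_of_le_of_ne (hz n) fun he => ?_⟩
  have h1 := (h.2 _ he.ge).1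
  rw [← eval_it_succ] at h1
  have h2 := hz (n + 1)
  linarith [h.1]

lemma EscR.isClosed_filled {p : Polynomial ℂ} {R : ℝ} (h : EscR p R) : IsClosed (filled p R) := by
  rw [h.filled_eq, Set.ofPred_forall]
  exact isClosed_iInter fun n => isClosed_le (continuous_it p n).norm continuous_const

lemma filled_subset_ball (p : Polynomial ℂ) (R : ℝ) : filled p R ⊆ ball 0 R := fun z hz => by
  have := hz 0
  rw [eval_it_zero] at this
  simpa using this

lemma EscR.isCompact_filled {p : Polynomial ℂ} {R : ℝ} (h : EscR p R) : IsCompact (filled p R) :=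
  isCompact_of_isClosed_isBounded h.isClosed_filled (isBounded_ball.subset (filled_subset_ball p R))

lemma EscR.mem_filled_iff {p : Polynomial ℂ} {R : ℝ} (h : EscR p R) (n : ℕ) {z : ℂ} :
    (it p n).eval z ∈ filled p R ↔ z ∈ filled p R := by
  constructor
  · intro hz k
    have := hz k
    rw [← eval_it_add] at this
    exact h.lt_of_lt (Nat.le_add_right _ _) this
  · intro hz k
    rw [← eval_it_add]
    exact hz _

lemma EscR.frontier_preimage {p : Polynomial ℂ} {R : ℝ} (h : EscR p R) (hp : 1 ≤ p.natDegree)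
    (n : ℕ) {z : ℂ} (hz : (it p n).eval z ∈ frontier (filled p R)) : z ∈ frontier (filled p R) := by
  have hcl := h.isClosed_filled
  rw [hcl.frontier_eq] at hz ⊢
  refine ⟨(h.mem_filled_iff n).1 hz.1, fun hi => hz.2 ?_⟩
  have hopen : IsOpenMap fun w => (it p n).eval w :=
    ((it p n).isOpenQuotientMap_eval (by have := one_le_natDegree_it hp n; omega)).isOpenMap
  refine interior_maximal ?_ (hopen _ isOpen_interior) ⟨z, hi, rfl⟩
  rintro _ ⟨w, hw, rfl⟩
  exact (h.mem_filled_iff n).2 (interior_subset hw)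

lemma chordalDist_none_ge {u : ℂ} {S : ℝ} (hS : 0 ≤ S) (hu : ‖u‖ ≤ S) :
    1 / (1 + S) ≤ chordalDist (some u) none := by
  rw [chordalDist]
  have h1 : Real.sqrt (1 + ‖u‖ ^ 2) ≤ 1 + S := by
    rw [Real.sqrt_le_left (by linarith)]
    nlinarith [norm_nonneg u]
  have h2 : 0 < Real.sqrt (1 + ‖u‖ ^ 2) := Real.sqrt_pos.2 (by positivity)
  gcongr
  norm_num

lemma chordalDist_some_ge {u a : ℂ} {S : ℝ} (hS : 0 ≤ S) (ha : ‖a‖ ≤ S) (hu : 2 * S + 1 ≤ ‖u‖) :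
    1 / (1 + S) ≤ chordalDist (some u) (some a) := by
  rw [chordalDist]
  have h1 : Real.sqrt (1 + ‖a‖ ^ 2) ≤ 1 + S := by
    rw [Real.sqrt_le_left (by linarith)]
    nlinarith [norm_nonneg a]
  have h1' : Real.sqrt (1 + ‖u‖ ^ 2) ≤ 1 + ‖u‖ := by
    rw [Real.sqrt_le_left (by positivity)]
    nlinarith [norm_nonneg u]
  have h2 : 0 < Real.sqrt (1 + ‖u‖ ^ 2) := Real.sqrt_pos.2 (by positivity)
  have h2' : 0 < Real.sqrt (1 + ‖a‖ ^ 2) := Real.sqrt_pos.2 (by positivity)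
  have h3 : 1 + ‖u‖ ≤ 2 * ‖u - a‖ := by
    have := norm_sub_norm_le u a
    linarith
  rw [div_le_div_iff₀ (by positivity) (by positivity), one_mul]
  calc Real.sqrt (1 + ‖u‖ ^ 2) * Real.sqrt (1 + ‖a‖ ^ 2) ≤ (1 + ‖u‖) * (1 + S) := by gcongr
    _ ≤ _ := by gcongr

lemma chordalDist_comm (x y : Option ℂ) : chordalDist x y = chordalDist y x := by
  cases x <;> cases y <;> simp only [chordalDist]
  rw [norm_sub_rev, mul_comm (Real.sqrt _)]

/-- A spherical limit of a sequence tending to infinity is the point at infinity. -/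
lemma eq_none_of_chordalDist {F : ℕ → ℂ} (hF : Tendsto (fun n => ‖F n‖) atTop atTop)
    {x : Option ℂ} (hx : ∀ ε : ℝ, 0 < ε → ∀ᶠ n in atTop, chordalDist (some (F n)) x < ε) :
    x = none := by
  cases x with
  | none => rfl
  | some a =>
    exfalso
    have h1 := hx (1 / (1 + ‖a‖)) (by positivity)
    obtain ⟨n, hn1, hn2⟩ := (h1.and (hF.eventually_ge_atTop (2 * ‖a‖ + 1))).exists
    exact absurd (chordalDist_some_ge (norm_nonneg a) le_rfl hn2) (not_le.2 hn1)

lemma EscR.frontier_subset_julia {p : Polynomial ℂ} {R : ℝ} (h : EscR p R) :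
    frontier (filled p R) ⊆ juliaSet (fun w => p.eval w) := by
  intro z hz
  rw [juliaSet, mem_compl_iff]
  rintro ⟨U, hU, hn⟩
  have hR := h.1
  obtain ⟨ψ, hψ, g, hg⟩ := hn id strictMono_id
  obtain ⟨ρ, hρ, hρU⟩ := nhds_basis_closedBall.mem_iff.1 hU
  obtain ⟨n, hn⟩ := (hg _ hρU (isCompact_closedBall z ρ) (1 / (1 + (R + 1)))
    (by positivity)).exists
  have hzK : z ∈ filled p R := h.isClosed_filled.frontier_subset hz
  have hcont := (continuous_it p (ψ n)).continuousAt (x := z)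
  have hnear : ∀ᶠ w in 𝓝 z, ‖(it p (ψ n)).eval w‖ < R + 1 :=
    hcont.norm.eventually_lt continuousAt_const (by linarith [hzK (ψ n)])
  have hzc : z ∈ closure (filled p R)ᶜ := by
    rw [frontier_eq_closure_inter_closure] at hz; exact hz.2
  obtain ⟨w, ⟨hw1, hw2⟩, hw3⟩ := mem_closure_iff_nhds.1 hzc _
    (hnear.and (closedBall_mem_nhds z hρ))
  have hgw : g w = none := by
    refine eq_none_of_chordalDist (F := fun k => (fun w => p.eval w)^[ψ k] w) ?_ fun ε hε => ?_
    · have := (h.tendsto_of_notMem hw3).comp hψ.tendsto_atTop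
      simpa only [Function.comp_def, eval_it] using this
    · have := hg {w} (by simpa using hρU hw2) isCompact_singleton ε hε
      simpa using this
  have h1 := hn w hw2
  rw [hgw] at h1
  refine absurd (chordalDist_none_ge (by linarith) ?_) (not_le.2 h1)
  simpa only [eval_it, id] using hw1.le

/-- Preimage components of small discs shrink uniformly. -/
lemma EscR.shrink {p : Polynomial ℂ} (hp : 1 ≤ p.natDegree) {R : ℝ} (h : EscR p R)
    {r : ℝ} (hr : 0 < r) {N : ℕ} {E : Set ℂ} (hE : E ⊆ frontier (filled p R))
    (hN : ∀ z ∈ E, ∀ n, FibreBound (it p n) z (2 * r) N)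
    {s : ℝ} (hs : 0 < s) :
    ∃ n₀, ∀ n ≥ n₀, ∀ z ∈ E, ∀ x, diam (pcomp (it p n) z r x) < s := by
  by_contra! hcon
  obtain ⟨φ, hφ, hφ'⟩ : ∃ φ : ℕ → ℕ, (∀ n, n ≤ φ n) ∧ ∀ n, ∃ z ∈ E, ∃ x,
      s ≤ diam (pcomp (it p (φ n)) z r x) := by
    choose φ h1 h2 using hcon
    exact ⟨φ, h1, h2⟩
  choose z hz x hx using hφ'
  have hD := one_le_distC N
  set δ := s / (2 * distC N) with hδ
  have hδ0 : 0 < δ := by positivity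
  have hex : ∀ n, ∃ a ∈ frontier (filled p R), ∀ w ∈ ball a δ,
      ‖(it p (φ n)).eval w‖ < R + 2 * r := by
    intro n
    have hdeg := one_le_natDegree_it hp (φ n)
    have hxm : ‖(it p (φ n)).eval (x n) - z n‖ < r := by
      by_contra hc
      have : pcomp (it p (φ n)) (z n) r (x n) = ∅ := by
        by_contra hne
        obtain ⟨w, hw⟩ := nonempty_iff_ne_empty.2 hne
        exact hc (pcomp_nonempty_imp hw)
      have h2 := hx n
      rw [this, diam_empty] at h2
      linarith
    obtain ⟨a, haV, ha⟩ := image_pcomp hdeg hxm (mem_ball_self hr)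
    have ha' : (it p (φ n)).eval a = z n := ha
    refine ⟨a, h.frontier_preimage hp (φ n) (ha' ▸ hE (hz n)), fun w hw => ?_⟩
    have hsub := ball_subset_pcomp hr (hN _ (hz n) (φ n)) haV
    have hwm : w ∈ pcomp (it p (φ n)) (z n) (2 * r) (x n) := hsub (by
      refine ball_subset_ball ?_ hw
      rw [hδ]
      gcongr
      exact hx n)
    have h3 := norm_lt_of_mem_pcomp hwm
    have h4 := filled_subset_ball p R (h.isClosed_filled.frontier_subset (hE (hz n)))
    rw [mem_ball_zero_iff] at h4
    have h5 := norm_add_le ((it p (φ n)).eval w - z n) (z n)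
    rw [sub_add_cancel] at h5
    linarith
  choose a ha hab using hex
  have hcomp : IsCompact (frontier (filled p R)) :=
    h.isCompact_filled.of_isClosed_subset isClosed_frontier h.isClosed_filled.frontier_subset
  obtain ⟨b, hb, ψ, hψ, hlim⟩ := hcomp.tendsto_subseq ha
  have hbc : b ∈ closure (filled p R)ᶜ := by
    rw [frontier_eq_closure_inter_closure] at hb; exact hb.2
  obtain ⟨w, hw1, hw2⟩ := mem_closure_iff_nhds.1 hbc _ (ball_mem_nhds b (half_pos hδ0))
  have hesc := ((h.tendsto_of_notMem hw2).comp
    ((tendsto_atTop_mono hφ tendsto_id).comp hψ.tendsto_atTop)).eventually_ge_atTop (R + 2 * r)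
  have hnear := hlim.eventually (ball_mem_nhds b (half_pos hδ0))
  obtain ⟨n, hn1, hn2⟩ := (hesc.and hnear).exists
  have hwa : w ∈ ball (a (ψ n)) δ := by
    rw [mem_ball] at hw1 ⊢
    have := dist_triangle_right w (a (ψ n)) b
    simp only [Function.comp] at hn2
    linarith
  exact absurd (hab _ w hwa) (not_lt.2 hn1)

lemma EscR.frontier_nonempty {p : Polynomial ℂ} {R : ℝ} (h : EscR p R) {z₀ : ℂ}
    (hz₀ : z₀ ∈ filled p R) : (frontier (filled p R)).Nonempty := by
  rw [nonempty_iff_ne_empty, Ne, frontier_eq_empty_iff, not_or]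
  refine ⟨(nonempty_of_mem hz₀).ne_empty, fun hu => ?_⟩
  have h1 : ((R : ℝ) : ℂ) ∈ filled p R := by rw [hu]; trivial
  have h2 := filled_subset_ball p R h1
  rw [mem_ball_zero_iff, Complex.norm_real, Real.norm_eq_abs, abs_of_nonneg (by linarith [h.1])]
    at h2
  exact lt_irrefl _ h2

/-- Contraction of a self-map of a bounded open set whose image stays away from the boundary. -/
lemma norm_derivative_iterate_le {g : Polynomial ℂ} {Q : Set ℂ} {R σ ρ : ℝ} (hR : 0 < R)
    (hσ : 0 < σ) (hρ : 0 < ρ) (hQ : Q ⊆ ball 0 R) (hg : ∀ w ∈ Q, ball (g.eval w) σ ⊆ Q)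
    {a : ℂ} (ha : closedBall a ρ ⊆ Q) (j : ℕ) :
    ‖(it g j).derivative.eval a‖ * (1 + σ / (2 * R)) ^ j ≤ R / ρ := by
  set τ := σ / (2 * R) with hτ
  have hτ0 : 0 < τ := by positivity
  have haQ : a ∈ Q := ha (mem_closedBall_self hρ.le)
  have key : ∀ j, ∃ H : ℂ → ℂ, Differentiable ℂ H ∧ MapsTo H Q Q ∧ H a = (it g j).eval a ∧
      HasDerivAt H (((1 + τ : ℝ) : ℂ) ^ j * (it g j).derivative.eval a) a := by
    intro j
    induction j with
    | zero =>
      refine ⟨id, differentiable_id, fun w hw => hw, by simp [eval_it_zero], ?_⟩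
      simpa [it] using hasDerivAt_id a
    | succ j ih =>
      obtain ⟨H, hH, hHQ, hHa, hHd⟩ := ih
      have hgd : ∀ w, HasDerivAt (fun w => g.eval w) (g.derivative.eval w) w :=
        fun w => g.hasDerivAt w
      have hdiff : Differentiable ℂ fun w => g.eval (H w) :=
        g.differentiable.comp hH
      refine ⟨fun w => g.eval (H w) + (τ : ℂ) * (g.eval (H w) - g.eval (H a)),
        hdiff.add ((hdiff.sub_const _).const_mul _), fun w hw => ?_, ?_, ?_⟩
      · refine hg _ (hHQ hw) ?_
        rw [mem_ball, dist_eq_norm, add_sub_cancel_left, norm_mul, Complex.norm_real,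
          Real.norm_eq_abs, abs_of_pos hτ0]
        have h1 := hQ (hg _ (hHQ hw) (mem_ball_self hσ))
        have h2 := hQ (hg _ (hHQ haQ) (mem_ball_self hσ))
        rw [mem_ball_zero_iff] at h1 h2
        have h3 := norm_sub_le (g.eval (H w)) (g.eval (H a))
        calc τ * ‖g.eval (H w) - g.eval (H a)‖ < τ * (2 * R) := by gcongr; linarith
          _ = σ := by rw [hτ]; field_simp
      · rw [eval_it_succ, ← hHa]; simp
      · have h1 := (hgd (H a)).comp a hHd
        have h2 := h1.add ((h1.sub_const (g.eval (H a))).const_mul (τ : ℂ))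
        refine h2.congr_deriv ?_
        have h3 : it g 1 = g := by simp [it]
        rw [add_comm j 1, derivative_it_add, h3, hHa]
        push_cast
        ring
  obtain ⟨H, hH, hHQ, -, hHd⟩ := key j
  have h1 := Complex.norm_deriv_le_of_forall_mem_sphere_norm_le hρ
    (hH.diffContOnCl (s := ball a ρ)) (C := R) fun z hz =>
      (mem_ball_zero_iff.1 (hQ (hHQ (ha (sphere_subset_closedBall hz))))).le
  rw [hHd.deriv, norm_mul, norm_pow, Complex.norm_real, Real.norm_eq_abs,
    abs_of_pos (by positivity)] at h1
  linarith

lemma eval_it_it (p : Polynomial ℂ) (n m : ℕ) (z : ℂ) :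
    (it (it p n) m).eval z = (it p (n * m)).eval z := by
  have : (fun w => (it p n).eval w) = (fun w => p.eval w)^[n] := funext fun w => eval_it p n w
  rw [eval_it, this, eval_it, Function.iterate_mul]

/-- Without attracting cycles, the filled Julia set of a semihyperbolic polynomial has empty
interior. -/
lemma EscR.filled_subset_frontier {p : Polynomial ℂ} (hd : 2 ≤ p.natDegree) {R : ℝ} (h : EscR p R)
    {ε : ℝ} (hε : 0 < ε) {N : ℕ}
    (hN : ∀ z ∈ juliaSet (fun w => p.eval w), ∀ n, FibreBound (it p n) z ε N)
    (hattr : ¬ ∃ z : ℂ, ∃ k : ℕ, 1 ≤ k ∧ (fun w => p.eval w)^[k] z = z ∧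
      ‖deriv ((fun w => p.eval w)^[k]) z‖ < 1) :
    filled p R ⊆ frontier (filled p R) := by
  have hp : 1 ≤ p.natDegree := by omega
  intro w₀ hw₀
  by_contra hw₀f
  set K := filled p R with hK
  set F := frontier K with hF
  have hFne : F.Nonempty := h.frontier_nonempty hw₀
  have hR := h.1
  set r := ε / 2 with hr
  have hr0 : 0 < r := by positivity
  have hN' : ∀ z ∈ F, ∀ n, FibreBound (it p n) z (2 * r) N := fun z hz n => by
    have := hN z (h.frontier_subset_julia hz) n
    rwa [show 2 * r = ε by rw [hr]; ring]
  have hpush : ∀ s : ℝ, 0 < s → ∃ n₀, ∀ n ≥ n₀, ∀ w ∈ K, s ≤ infDist w F →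
      r ≤ infDist ((it p n).eval w) F := by
    intro s hs
    obtain ⟨n₀, hn₀⟩ := h.shrink hp hr0 subset_rfl hN' hs
    refine ⟨n₀, fun n hn w hw hws => ?_⟩
    by_contra! hlt
    obtain ⟨z, hz, hzd⟩ := (infDist_lt_iff hFne).1 hlt
    rw [dist_eq_norm] at hzd
    have hdeg := one_le_natDegree_it hp n
    obtain ⟨a, haV, ha⟩ := image_pcomp hdeg hzd (mem_ball_self hr0)
    have ha' : (it p n).eval a = z := ha
    have haF : a ∈ F := h.frontier_preimage hp n (ha' ▸ hz)
    have h1 := dist_le_diam_of_mem (isBounded_pcomp hdeg z r w) (self_mem_pcomp hzd) haV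
    have h2 := infDist_le_dist_of_mem (x := w) haF
    linarith [hn₀ n hn z hz w]
  set Ω := {w | w ∈ K ∧ r ≤ infDist w F} with hΩ
  set Q := interior K ∩ {w | r / 2 < infDist w F} with hQ
  have hΩQ : ∀ w ∈ Ω, ∀ v, dist v w < r / 2 → v ∈ Q := by
    intro w hw v hv
    have hdisj : ∀ u ∈ ball w r, u ∉ F := fun u hu huF => by
      have h1 := infDist_le_dist_of_mem (x := w) huF
      rw [mem_ball, dist_comm] at hu
      linarith [hw.2]
    have hwi : w ∈ interior K := by
      by_contra hni
      exact hdisj w (mem_ball_self hr0) (by rw [hF, h.isClosed_filled.frontier_eq]; exact ⟨hw.1, hni⟩)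
    have hsub : ball w r ⊆ interior K := by
      refine (convex_ball w r).isPreconnected.subset_left_of_subset_union isOpen_interior
        h.isClosed_filled.isOpen_compl ?_ ?_ ⟨w, mem_ball_self hr0, hwi⟩
      · exact disjoint_compl_right.mono_left interior_subset
      · intro u hu
        by_contra hc
        rw [mem_union, not_or, mem_compl_iff, not_not] at hc
        exact hdisj u hu (by rw [hF, h.isClosed_filled.frontier_eq]; exact ⟨hc.2, hc.1⟩)
    refine ⟨hsub (by rw [mem_ball]; linarith), ?_⟩
    have h1 := infDist_le_infDist_add_dist (s := F) (x := w) (y := v)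
    rw [dist_comm] at h1
    have h2 := hw.2
    change r / 2 < infDist v F
    linarith
  have hmemK : ∀ n {z}, z ∈ K → (it p n).eval z ∈ K := fun n z hz => (h.mem_filled_iff n).2 hz
  obtain ⟨n₁, hn₁⟩ := hpush (r / 2) (by positivity)
  set n₂ := max n₁ 1 with hn₂
  set G := it p n₂ with hG
  have hGQ : ∀ w ∈ Q, ball (G.eval w) (r / 2) ⊆ Q := fun w hw v hv =>
    hΩQ _ ⟨hmemK n₂ (interior_subset hw.1),
      hn₁ n₂ (le_max_left _ _) w (interior_subset hw.1) (le_of_lt hw.2)⟩ v hv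
  have hQR : Q ⊆ ball 0 R := fun w hw => filled_subset_ball p R (interior_subset hw.1)
  have hpos : 0 < infDist w₀ F := (isClosed_frontier.notMem_iff_infDist_pos hFne).1 hw₀f
  obtain ⟨n₃, hn₃⟩ := hpush _ hpos
  set b : ℕ → ℂ := fun i => (it p (n₂ * i + n₃)).eval w₀ with hb
  have hbΩ : ∀ i, b i ∈ Ω := fun i => ⟨hmemK _ hw₀, hn₃ _ (Nat.le_add_left _ _) w₀ hw₀ le_rfl⟩
  obtain ⟨b', -, ψ, hψ, hlim⟩ := h.isCompact_filled.tendsto_subseq fun i => (hbΩ i).1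
  obtain ⟨k₀, hk₀⟩ := Metric.cauchySeq_iff.1 hlim.cauchySeq (r / 16) (by positivity)
  set τ := r / 2 / (2 * R) with hτ
  have hτ0 : 0 < τ := by positivity
  obtain ⟨m₀, hm₀⟩ := (((tendsto_pow_atTop_atTop_of_one_lt (r := 1 + τ) (by linarith)
    ).eventually_ge_atTop (4 * (R / (r / 4)))).exists_forall_of_atTop)
  set i := ψ k₀ with hi
  obtain ⟨m, hm⟩ : ∃ m, ψ (m₀ + 1 + k₀) = i + m :=
    Nat.exists_eq_add_of_le (hψ.monotone (by omega))
  have hmm : m₀ + 1 ≤ m := by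
    have := hψ.add_le_nat (m₀ + 1) k₀
    omega
  have hclose : dist ((it G m).eval (b i)) (b i) < r / 16 := by
    have h1 := hk₀ (m₀ + 1 + k₀) (by omega) k₀ le_rfl
    have h2 : (it G m).eval (b i) = b (i + m) := by
      simp only [hb, hG]
      rw [eval_it_it, ← eval_it_add]
      congr 2
      ring
    simp only [Function.comp] at h1
    rw [h2, ← hm]
    exact h1
  set B := closedBall (b i) (r / 8) with hB
  have hder : ∀ a ∈ B, ‖(it G m).derivative.eval a‖ ≤ 1 / 4 := by
    intro a ha
    have h1 := norm_derivative_iterate_le (by linarith : 0 < R) (half_pos hr0)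
      (by positivity : 0 < r / 4) hQR hGQ (a := a) (fun v hv => hΩQ _ (hbΩ i) v (by
        rw [hB, mem_closedBall] at ha
        rw [mem_closedBall] at hv
        linarith [dist_triangle v a (b i)])) m
    have h2 := hm₀ m (by omega)
    rw [← hτ] at h1
    have h3 : 0 < (1 + τ) ^ m := by positivity
    have h4 : 0 ≤ ‖(it G m).derivative.eval a‖ := norm_nonneg _
    nlinarith
  have hlip : ∀ x ∈ B, ∀ y ∈ B, dist ((it G m).eval x) ((it G m).eval y) ≤ 1 / 4 * dist x y := by
    intro x hx y hy
    rw [dist_eq_norm, dist_eq_norm]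
    exact (convex_closedBall _ _).norm_image_sub_le_of_norm_hasDerivWithin_le
      (fun v hv => (hasDerivAt_it G m v).hasDerivWithinAt) (fun v hv => hder v hv) hy hx
  have hbB : b i ∈ B := mem_closedBall_self (by positivity)
  have hmaps : MapsTo (fun w => (it G m).eval w) B B := by
    intro x hx
    have h1 := hlip x hx _ hbB
    rw [hB, mem_closedBall] at hx ⊢
    have h2 := dist_triangle ((it G m).eval x) ((it G m).eval (b i)) (b i)
    linarith
  have hcontr : ContractingWith (1 / 4) (hmaps.restrict _ B B) := by
    refine ⟨by norm_num, LipschitzWith.of_dist_le_mul fun x y => ?_⟩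
    simpa [Subtype.dist_eq] using hlip x x.2 y y.2
  obtain ⟨y, hyB, hfix, -⟩ := ContractingWith.exists_fixedPoint' isClosed_closedBall.isComplete
    hmaps hcontr hbB (edist_ne_top _ _)
  have hfun : (fun w => p.eval w)^[n₂ * m] = fun w => (it G m).eval w := by
    funext w
    rw [hG, eval_it_it, eval_it]
  refine hattr ⟨y, n₂ * m, ?_, ?_, ?_⟩
  · exact Nat.mul_pos (by omega) (by omega)
  · rw [hfun]; exact hfix
  · rw [hfun, (hasDerivAt_it G m y).deriv]
    exact (hder y hyB).trans_lt (by norm_num)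

lemma pow_le_norm_multiset_prod {δ : ℝ} (hδ : 0 < δ) (w : ℂ) (m : Multiset ℂ)
    (h : ∀ s ∈ m, δ ≤ ‖w - s‖) : δ ^ m.card ≤ ‖(m.map (w - ·)).prod‖ := by
  induction m using Multiset.induction with
  | empty => simp
  | cons a m ih =>
    rw [Multiset.map_cons, Multiset.prod_cons, Multiset.card_cons, norm_mul, pow_succ']
    have h1 := ih fun s hs => h s (Multiset.mem_cons_of_mem hs)
    have h2 := h a (Multiset.mem_cons_self a m)
    gcongr

/-- A connected set covered by finitely many discs has controlled diameter. -/
lemma norm_sub_le_of_cover {S : Set ℂ} (hS : IsPreconnected S) {T : Finset ℂ} {δ : ℝ}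
    (hδ : 0 < δ) (hcov : ∀ w ∈ S, ∃ s ∈ T, ‖w - s‖ < δ) {x y : ℂ} (hx : x ∈ S) (hy : y ∈ S) :
    ‖y - x‖ ≤ 2 * δ * T.card := by
  have h1 : IsPreconnected ((fun w => ‖w - x‖) '' S) :=
    hS.image _ (by fun_prop)
  have h2 : Icc 0 ‖y - x‖ ⊆ (fun w => ‖w - x‖) '' S :=
    h1.ordConnected.out ⟨x, hx, by simp⟩ ⟨y, hy, rfl⟩
  have h3 : Icc 0 ‖y - x‖ ⊆ ⋃ s ∈ T, Icc (‖s - x‖ - δ) (‖s - x‖ + δ) := by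
    intro t ht
    obtain ⟨w, hw, rfl⟩ := h2 ht
    obtain ⟨s, hs, hws⟩ := hcov w hw
    refine mem_iUnion₂.2 ⟨s, hs, ?_⟩
    have h4 := abs_norm_sub_norm_le (w - x) (s - x)
    rw [sub_sub_sub_cancel_right] at h4
    have h5 := abs_le.1 (h4.trans hws.le)
    exact ⟨by linarith [h5.1], by linarith [h5.2]⟩
  have h4 := (measure_mono h3).trans (measure_biUnion_finset_le (μ := (volume : Measure ℝ)) T _)
  simp only [Real.volume_Icc, sub_zero] at h4
  have h5 : ∀ s ∈ T, ENNReal.ofReal (‖s - x‖ + δ - (‖s - x‖ - δ)) = ENNReal.ofReal (2 * δ) :=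
    fun s _ => by congr 1; ring
  rw [Finset.sum_congr rfl h5, Finset.sum_const, nsmul_eq_mul, ← ENNReal.ofReal_natCast,
    ← ENNReal.ofReal_mul (by positivity), ENNReal.ofReal_le_ofReal_iff (by positivity)] at h4
  linarith

lemma exists_small_components {q : Polynomial ℂ} (hq : 1 ≤ q.natDegree) {s : ℝ} (hs : 0 < s) :
    ∃ ε' : ℝ, 0 < ε' ∧ ∀ v : ℂ, ∀ S : Set ℂ, IsPreconnected S →
      (∀ w ∈ S, ‖q.eval w - v‖ < ε') → ∀ x ∈ S, ∀ y ∈ S, ‖y - x‖ < s := by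
  classical
  set D := q.natDegree with hD
  have hlead : q.leadingCoeff ≠ 0 := by
    rw [Polynomial.leadingCoeff_ne_zero]; rintro rfl; simp at hD; omega
  set δ := s / (4 * D) with hδ
  have hD0 : (0 : ℝ) < D := by exact_mod_cast hq
  have hδ0 : 0 < δ := by positivity
  refine ⟨‖q.leadingCoeff‖ * δ ^ D, by positivity, fun v S hS hSv x hx y hy => ?_⟩
  set Q := q - Polynomial.C v with hQ
  have hQd : Q.natDegree = D := Polynomial.natDegree_sub_C
  have hQl : Q.leadingCoeff = q.leadingCoeff := by
    rw [Polynomial.leadingCoeff, hQd, hQ, Polynomial.coeff_sub, Polynomial.coeff_C,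
      if_neg (by omega), sub_zero]
    rfl
  have hsp : Q.Splits := IsAlgClosed.splits Q
  have hcard : Q.roots.card = D := by rw [← hsp.natDegree_eq_card_roots, hQd]
  have hle : (Q.roots.toFinset.card : ℝ) ≤ D := by
    rw [← hcard]; exact_mod_cast Multiset.toFinset_card_le _
  have := norm_sub_le_of_cover hS (T := Q.roots.toFinset) hδ0 (fun w hw => by
    by_contra! hc
    have h1 := pow_le_norm_multiset_prod hδ0 w Q.roots fun s hs => hc s (by simpa using hs)
    have h2 := hSv w hw
    have h3 : q.eval w - v = Q.eval w := by simp [hQ]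
    rw [h3, hsp.eval_eq_prod_roots, norm_mul, hQl] at h2
    rw [hcard] at h1
    have := mul_le_mul_of_nonneg_left h1 (norm_nonneg q.leadingCoeff)
    linarith) hx hy
  calc ‖y - x‖ ≤ 2 * δ * D := this.trans (by gcongr)
    _ = s / 2 := by rw [hδ]; field_simp; norm_num
    _ < s := by linarith

lemma EscR.mono {p : Polynomial ℂ} {R R' : ℝ} (h : EscR p R) (hRR : R ≤ R') : EscR p R' :=
  ⟨h.1.trans hRR, fun v hv => h.2 v (hRR.trans hv)⟩

lemma EscR.filled_mono {p : Polynomial ℂ} {R R' : ℝ} (h : EscR p R) (hRR : R ≤ R') :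
    filled p R' = filled p R := by
  ext z
  refine ⟨fun hz => ?_, fun hz n => (hz n).trans_le hRR⟩
  by_contra hc
  obtain ⟨n, hn⟩ := ((h.tendsto_of_notMem hc).eventually_ge_atTop R').exists
  exact absurd (hz n) (not_lt.2 hn)

lemma EscR.iterate_le {p : Polynomial ℂ} {R : ℝ} (h : EscR p R) {v : ℂ} {k n : ℕ} (hkn : k ≤ n)
    (hv : ‖(it p n).eval v‖ ≤ R) : ‖(it p k).eval v‖ ≤ R := by
  rcases hkn.eq_or_lt with rfl | hlt
  · exact hv
  obtain ⟨j, rfl⟩ := Nat.exists_eq_add_of_lt hlt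
  by_contra! hc
  have h1 := h.iterate hc.le (j + 1)
  rw [← eval_it_add, show j + 1 + k = k + j + 1 by ring, pow_succ] at h1
  have h2 : (1 : ℝ) ≤ 2 ^ j := one_le_pow₀ (by norm_num)
  have h3 : 0 < R := by linarith [h.1]
  nlinarith

lemma EscR.isCompact_sublevel {p : Polynomial ℂ} {R : ℝ} (h : EscR p R) (n : ℕ) :
    IsCompact {z | ‖(it p n).eval z‖ ≤ R} := by
  refine (isCompact_closedBall (0 : ℂ) R).of_isClosed_subset
    (isClosed_le (continuous_it p n).norm continuous_const) fun z hz => ?_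
  have := h.iterate_le (Nat.zero_le n) hz
  rw [eval_it_zero] at this
  simpa using this

/-- Neighbourhoods of the filled Julia set absorb high preimages of bounded sets. -/
lemma EscR.exists_sublevel_subset {p : Polynomial ℂ} {R : ℝ} (h : EscR p R) {W : Set ℂ}
    (hW : IsOpen W) (hKW : filled p R ⊆ W) : ∃ n, {z | ‖(it p n).eval z‖ ≤ R} ⊆ W := by
  refine exists_subset_nhds_of_isCompact ?_ (fun n => h.isCompact_sublevel n) fun x hx => ?_
  · exact directed_of_isDirected_le fun a b hab z hz => h.iterate_le hab hz
  · refine hW.mem_nhds (hKW ?_)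
    rw [h.filled_eq]
    exact fun n => mem_iInter.1 hx n

lemma encard_biUnion_le {T : Finset ℂ} {A : ℂ → Set ℂ} {N : ℕ} (h : ∀ t ∈ T, (A t).encard ≤ N) :
    (⋃ t ∈ T, A t).encard ≤ (T.card * N : ℕ) := by
  classical
  induction T using Finset.induction with
  | empty => simp
  | insert a T ha ih =>
    rw [Finset.set_biUnion_insert, Finset.card_insert_of_notMem ha]
    refine (encard_union_le _ _).trans ?_
    have h1 := h a (Finset.mem_insert_self _ _)
    have h2 := ih fun t ht => h t (Finset.mem_insert_of_mem ht)
    calc _ ≤ (N : ℕ∞) + (T.card * N : ℕ) := add_le_add h1 h2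
      _ = _ := by push_cast; ring

/-- Uniform degree bounds for preimages of small discs centered in a bounded set. -/
lemma EscR.exists_uniform_fibreBound {p : Polynomial ℂ} (hp : 1 ≤ p.natDegree) {R : ℝ}
    (h : EscR p R) {ε : ℝ} (hε : 0 < ε) {N : ℕ}
    (hN : ∀ z ∈ filled p R, ∀ n, FibreBound (it p n) z ε N) (R' : ℝ) :
    ∃ ε' : ℝ, 0 < ε' ∧ ε' ≤ 1 ∧ ∃ N' : ℕ, ∀ v : ℂ, ‖v‖ ≤ R' → ∀ k,
      FibreBound (it p k) v ε' N' := by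
  classical
  set R₁ := max R (R' + 1) with hR₁
  have h₁ : EscR p R₁ := h.mono (le_max_left _ _)
  have hK : filled p R₁ = filled p R := h.filled_mono (le_max_left _ _)
  obtain ⟨n₁, hn₁⟩ := h₁.exists_sublevel_subset (W := thickening (ε / 2) (filled p R))
    isOpen_thickening (hK ▸ self_subset_thickening (by positivity) _)
  obtain ⟨ε', hε', hsmall⟩ := exists_small_components (one_le_natDegree_it hp n₁) (half_pos hε)
  refine ⟨min ε' 1, by positivity, min_le_right _ _, p.natDegree ^ n₁ * max N 1,
    fun v hv k x u => ?_⟩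
  rcases Nat.lt_or_ge k n₁ with hk | hk
  · refine (fibreBound_natDegree (one_le_natDegree_it hp k) v _ x u).trans ?_
    rw [natDegree_it]
    have h1 : p.natDegree ^ k ≤ p.natDegree ^ n₁ * max N 1 :=
      (Nat.pow_le_pow_right hp hk.le).trans (Nat.le_mul_of_pos_right _ (by positivity))
    exact_mod_cast h1
  obtain ⟨j, rfl⟩ := Nat.exists_eq_add_of_le hk
  set V := pcomp (it p (n₁ + j)) v (min ε' 1) x with hV
  rcases (V ∩ (fun w => (it p (n₁ + j)).eval w) ⁻¹' {u}).eq_empty_or_nonempty with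
    he | ⟨y, hyV, -⟩
  · rw [he]; simp
  have hVn : ∀ w ∈ V, ‖(it p n₁).eval ((it p j).eval w) - v‖ < min ε' 1 := fun w hw => by
    rw [← eval_it_add]
    exact norm_lt_of_mem_pcomp hw
  have hS : IsPreconnected ((fun w => (it p j).eval w) '' V) :=
    (isPreconnected_pcomp _ _ _ _).image _ (continuous_it p j).continuousOn
  have hyW : (it p j).eval y ∈ thickening (ε / 2) (filled p R) := by
    apply hn₁
    have h1 := (hVn y hyV).trans_le (min_le_right _ _)
    have h2 := norm_add_le ((it p n₁).eval ((it p j).eval y) - v) v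
    rw [sub_add_cancel] at h2
    change _ ≤ R₁
    linarith [le_max_right R (R' + 1)]
  obtain ⟨z, hz, hyz⟩ := mem_thickening_iff.1 hyW
  have hVz : ∀ w ∈ V, ‖(it p j).eval w - z‖ < ε := fun w hw => by
    have h1 := hsmall v _ hS (by
      rintro _ ⟨w, hw, rfl⟩
      exact (hVn w hw).trans_le (min_le_left _ _)) _ ⟨y, hyV, rfl⟩ _ ⟨w, hw, rfl⟩
    rw [dist_eq_norm] at hyz
    have h2 := norm_add_le ((it p j).eval w - (it p j).eval y) ((it p j).eval y - z)
    rw [sub_add_sub_cancel] at h2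
    simp only at h1
    linarith
  have hVsub : V ⊆ pcomp (it p j) z ε y :=
    subset_pcomp (isPreconnected_pcomp _ _ _ _) hVz hyV (self_mem_pcomp (hVz y hyV))
  set Q := it p n₁ - Polynomial.C u with hQ
  have hQd : Q.natDegree = p.natDegree ^ n₁ := by rw [hQ, Polynomial.natDegree_sub_C, natDegree_it]
  have hQ0 : Q ≠ 0 := fun h0 => by
    rw [h0, Polynomial.natDegree_zero] at hQd
    exact (Nat.pow_pos (n := n₁) hp).ne hQd
  have hsub : V ∩ (fun w => (it p (n₁ + j)).eval w) ⁻¹' {u} ⊆ ⋃ t ∈ Q.roots.toFinset,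
      pcomp (it p j) z ε y ∩ (fun w => (it p j).eval w) ⁻¹' {t} := by
    rintro w ⟨hwV, hwu⟩
    refine mem_iUnion₂.2 ⟨(it p j).eval w, ?_, hVsub hwV, rfl⟩
    have : (it p n₁).eval ((it p j).eval w) = u := by rw [← eval_it_add]; exact hwu
    simp only [Multiset.mem_toFinset, Polynomial.mem_roots hQ0, Polynomial.IsRoot.def]
    simp [hQ, this]
  refine (encard_le_encard hsub).trans
    ((encard_biUnion_le fun t _ => hN z hz j y t).trans ?_)
  have h1 : Q.roots.toFinset.card ≤ p.natDegree ^ n₁ := by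
    rw [← hQd]
    exact (Multiset.toFinset_card_le _).trans (Polynomial.card_roots' _)
  have h2 : Q.roots.toFinset.card * N ≤ p.natDegree ^ n₁ * max N 1 :=
    Nat.mul_le_mul h1 (le_max_left _ _)
  exact_mod_cast h2

/-- A sequence of sets of bounded distortion decays geometrically. -/
lemma exp_decay_of_recursion {u : ℕ → ℝ} (hu : Antitone u) (hu0 : ∀ l, 0 ≤ u l) {M : ℕ}
    (hM : 1 ≤ M) {C : ℝ} (hC : 0 < C) (h : ∀ l, u (l + M) ≤ C * (u l - u (l + M))) :
    ∃ C' c : ℝ, 0 < C' ∧ 0 < c ∧ ∀ l : ℕ, u l ≤ C' * Real.exp (-(c * l)) := by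
  set θ := C / (1 + C) with hθ
  have hθ0 : 0 < θ := by positivity
  have hθ1 : θ < 1 := by rw [hθ, div_lt_one (by positivity)]; linarith
  have h1 : ∀ l, u (l + M) ≤ θ * u l := fun l => by
    have := h l
    rw [hθ, div_mul_eq_mul_div, le_div_iff₀ (by positivity)]
    linarith
  have h2 : ∀ j i, u (j * M + i) ≤ θ ^ j * u 0 := by
    intro j i
    induction j with
    | zero => simpa using hu (Nat.zero_le i)
    | succ j ih =>
      have := h1 (j * M + i)
      rw [show (j + 1) * M + i = j * M + i + M by ring, pow_succ]
      calc _ ≤ θ * u (j * M + i) := this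
        _ ≤ θ * (θ ^ j * u 0) := by gcongr
        _ = _ := by ring
  set L := -Real.log θ with hL
  have hL0 : 0 < L := by rw [hL]; linarith [Real.log_neg hθ0 hθ1]
  have hM0 : (0 : ℝ) < M := by exact_mod_cast hM
  refine ⟨Real.exp L * (u 0 + 1), L / M, by have := hu0 0; positivity, by positivity,
    fun l => ?_⟩
  have h3 := h2 (l / M) (l % M)
  rw [mul_comm (l / M), Nat.div_add_mod] at h3
  have h4 : θ ^ (l / M) = Real.exp (-(L * (l / M : ℕ))) := by
    rw [hL, ← Real.exp_log hθ0, ← Real.exp_nat_mul, Real.exp_log hθ0]; congr 1; ring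
  have h5 : (l : ℝ) / M ≤ (l / M : ℕ) + 1 := by
    rw [div_le_iff₀ hM0]
    have := Nat.lt_div_mul_add (a := l) hM
    have h6 : l ≤ (l / M + 1) * M := by rw [add_mul]; omega
    exact_mod_cast h6
  rw [h4] at h3
  refine h3.trans ?_
  have h7 : Real.exp (-(L * (l / M : ℕ))) ≤ Real.exp L * Real.exp (-(L / M * l)) := by
    rw [← Real.exp_add]
    apply Real.exp_le_exp.2
    have : L / M * l = L * (l / M) := by ring
    rw [this]
    nlinarith
  calc _ ≤ Real.exp L * Real.exp (-(L / M * l)) * (u 0 + 1) := by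
        have := hu0 0
        gcongr
        linarith
    _ = _ := by ring

lemma measurableSet_sublevel (q : Polynomial ℂ) (R : ℝ) : MeasurableSet {w | ‖q.eval w‖ < R} :=
  (isOpen_lt q.continuous.norm continuous_const).measurableSet

/-- Exponential decay of the area of the set of points that have not escaped. -/
lemma EscR.volume_sublevel_le {p : Polynomial ℂ} (hp : 1 ≤ p.natDegree) {R : ℝ} (h : EscR p R)
    {ε : ℝ} (hε : 0 < ε) {N : ℕ} (hN : ∀ z ∈ filled p R, ∀ n, FibreBound (it p n) z ε N)
    (hK : filled p R ⊆ frontier (filled p R)) :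
    ∃ C c : ℝ, 0 < C ∧ 0 < c ∧ ∀ l : ℕ,
      volume {w | ‖(it p l).eval w‖ < R} ≤ ENNReal.ofReal (C * Real.exp (-(c * l))) := by
  classical
  have hR := h.1
  set r := ε / 2 with hr
  have hr0 : 0 < r := by positivity
  have hN' : ∀ z ∈ filled p R, ∀ n, FibreBound (it p n) z (2 * r) N := fun z hz n => by
    have := hN z hz n
    rwa [show 2 * r = ε by rw [hr]; ring]
  set U : ℕ → Set ℂ := fun l => {w | ‖(it p l).eval w‖ < R} with hU
  have hUanti : Antitone U := fun a b hab w hw => h.lt_of_lt hab hw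
  have hUm : ∀ l, MeasurableSet (U l) := fun l => measurableSet_sublevel _ _
  have hU0 : volume (U 0) ≠ ∞ := by
    refine ne_top_of_le_ne_top (measure_ball_lt_top (x := (0 : ℂ)) (r := R)).ne
      (measure_mono fun w hw => ?_)
    have : ‖(it p 0).eval w‖ < R := hw
    rw [eval_it_zero] at this
    simpa using this
  have hUfin : ∀ l, volume (U l) ≠ ∞ := fun l =>
    ne_top_of_le_ne_top hU0 (measure_mono (hUanti (Nat.zero_le l)))
  have hloc : ∀ z ∈ filled p R, ∃ m : ℕ, ∃ C : ℝ, 0 < C ∧ ∀ l,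
      volume {w | ‖(it p l).eval w - z‖ < r} ≤ ENNReal.ofReal C * volume (U l \ U (l + m)) := by
    intro z hz
    have hzc : z ∈ closure (filled p R)ᶜ := by
      have := hK hz
      rw [frontier_eq_closure_inter_closure] at this; exact this.2
    have hO : ball z r ∩ ball 0 R ∈ 𝓝 z :=
      (isOpen_ball.inter isOpen_ball).mem_nhds ⟨mem_ball_self hr0, filled_subset_ball p R hz⟩
    obtain ⟨z', hz'O, hz'K⟩ := mem_closure_iff_nhds.1 hzc _ hO
    obtain ⟨m, hm⟩ := ((h.tendsto_of_notMem hz'K).eventually_gt_atTop R).exists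
    have hopen : IsOpen ((ball z r ∩ ball 0 R) ∩ {w | R < ‖(it p m).eval w‖}) :=
      (isOpen_ball.inter isOpen_ball).inter
        (isOpen_lt continuous_const (continuous_it p m).norm)
    obtain ⟨η, hη, hηs⟩ := Metric.isOpen_iff.1 hopen z' ⟨hz'O, hm⟩
    have hD := one_le_distC N
    refine ⟨m, (8 * distC N * r / η) ^ 2, by positivity, fun l => ?_⟩
    refine (volume_preimage_ball_le (one_le_natDegree_it hp l) hr0 (hN' z hz l) hη
      fun w hw => (hηs hw).1.1).trans ?_
    gcongr
    intro w hw
    have := hηs hw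
    refine ⟨mem_ball_zero_iff.1 this.1.2, fun hc => ?_⟩
    have h1 : R < ‖(it p m).eval ((it p l).eval w)‖ := this.2
    have h2 : ‖(it p (l + m)).eval w‖ < R := hc
    rw [add_comm, eval_it_add] at h2
    linarith
  choose! m C hC hloc using hloc
  obtain ⟨T, hTK, hT⟩ := h.isCompact_filled.elim_nhds_subcover (fun z => ball z r)
    fun z _ => ball_mem_nhds z hr0
  obtain ⟨n₁, hn₁⟩ := h.exists_sublevel_subset (W := ⋃ z ∈ T, ball z r)
    (isOpen_biUnion fun _ _ => isOpen_ball) hT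
  set M := max (n₁ + 1) (T.sup m) with hM
  set C₀ := ∑ z ∈ T, C z with hC₀
  have hC₀0 : 0 ≤ C₀ := Finset.sum_nonneg fun z hz => (hC z (hTK z hz)).le
  have hrec : ∀ l, volume (U (l + M)) ≤ ENNReal.ofReal C₀ * volume (U l \ U (l + M)) := by
    intro l
    have hsub : U (l + M) ⊆ ⋃ z ∈ T, {w | ‖(it p l).eval w - z‖ < r} := by
      intro w hw
      have h1 : ‖(it p (n₁ + l)).eval w‖ < R := h.lt_of_lt (by omega) hw
      rw [eval_it_add] at h1
      simpa [dist_eq_norm] using hn₁ h1.le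
    calc volume (U (l + M)) ≤ ∑ z ∈ T, volume {w | ‖(it p l).eval w - z‖ < r} :=
          (measure_mono hsub).trans (measure_biUnion_finset_le _ _)
      _ ≤ ∑ z ∈ T, ENNReal.ofReal (C z) * volume (U l \ U (l + M)) := by
          refine Finset.sum_le_sum fun z hz => (hloc z (hTK z hz) l).trans ?_
          gcongr
          apply hUanti
          have : m z ≤ T.sup m := Finset.le_sup hz
          omega
      _ = _ := by
          rw [← Finset.sum_mul, hC₀,
            ENNReal.ofReal_sum_of_nonneg fun z hz => (hC z (hTK z hz)).le]
  set u : ℕ → ℝ := fun l => (volume (U l)).toReal with hu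
  obtain ⟨C', c, hC', hc, hdec⟩ := exp_decay_of_recursion (u := u) (M := M) (C := C₀ + 1)
    (fun a b hab => ENNReal.toReal_mono (hUfin a) (measure_mono (hUanti hab)))
    (fun l => ENNReal.toReal_nonneg) (by omega) (by linarith) (fun l => by
      have h1 := hrec l
      rw [measure_sdiff (hUanti (Nat.le_add_right l M)) (hUm _).nullMeasurableSet (hUfin _)] at h1
      have hle := measure_mono (μ := volume) (hUanti (Nat.le_add_right l M))
      have h2 := ENNReal.toReal_mono (ENNReal.mul_ne_top ENNReal.ofReal_ne_top
        (ENNReal.sub_ne_top (hUfin l))) h1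
      rw [ENNReal.toReal_mul, ENNReal.toReal_ofReal hC₀0,
        ENNReal.toReal_sub_of_le hle (hUfin l)] at h2
      have h3 := ENNReal.toReal_mono (hUfin l) hle
      simp only [hu]
      nlinarith)
  refine ⟨C', c, hC', hc, fun l => ?_⟩
  rw [← ENNReal.ofReal_toReal (hUfin l)]
  exact ENNReal.ofReal_le_ofReal (hdec l)

/-- Area of the set where the derivative of an iterate is small. -/
lemma EscR.volume_small_derivative_le {p : Polynomial ℂ} (hp : 1 ≤ p.natDegree) {R : ℝ}
    (h : EscR p R) {ε : ℝ} (hε : 0 < ε) {N : ℕ}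
    (hN : ∀ z ∈ filled p R, ∀ n, FibreBound (it p n) z ε N) (R' : ℝ) :
    ∃ C s : ℝ, 0 < C ∧ 0 < s ∧ ∀ k : ℕ, ∀ t : ℝ, 0 < t →
      volume {w | ‖(it p k).eval w‖ ≤ R' ∧ ‖(it p k).derivative.eval w‖ ≤ t} ≤
        ENNReal.ofReal (C * p.natDegree ^ k * t ^ s) := by
  obtain ⟨ε', hε', hε'1, N', hN'⟩ := h.exists_uniform_fibreBound hp hε hN R'
  set r := ε' / 2 with hr
  have hr0 : 0 < r := by positivity
  set R₁ := max R (R' + 1) with hR₁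
  have h₁ : EscR p R₁ := h.mono (le_max_left _ _)
  have hR₁0 : 0 < R₁ := by linarith [h₁.1]
  obtain ⟨C, s, hC, hs, hmain⟩ := volume_small_deriv_total N' (2 * R₁)
  obtain ⟨T, hTK, hT⟩ := (isCompact_closedBall (0 : ℂ) R').elim_nhds_subcover
    (fun z => ball z (r / 2)) fun z _ => ball_mem_nhds z (by positivity)
  refine ⟨(T.card + 1) * (C * (r⁻¹) ^ s), s, by positivity, hs, fun k t ht => ?_⟩
  have hsub : {w | ‖(it p k).eval w‖ ≤ R' ∧ ‖(it p k).derivative.eval w‖ ≤ t} ⊆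
      ⋃ z ∈ T, {w | ‖(it p k).eval w - z‖ < r / 2 ∧ ‖(it p k).derivative.eval w‖ ≤ t} := by
    rintro w ⟨hw1, hw2⟩
    have := hT (show (it p k).eval w ∈ closedBall (0 : ℂ) R' by simpa using hw1)
    obtain ⟨z, hz, hzw⟩ := mem_iUnion₂.1 this
    refine mem_iUnion₂.2 ⟨z, hz, ?_, hw2⟩
    rwa [mem_ball, dist_eq_norm] at hzw
  have hz : ∀ z ∈ T, volume {w | ‖(it p k).eval w - z‖ < r / 2 ∧
      ‖(it p k).derivative.eval w‖ ≤ t} ≤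
      ENNReal.ofReal (C * p.natDegree ^ k * (t / r) ^ s) := by
    intro z hz
    have hzR : ‖z‖ ≤ R' := by simpa using hTK z hz
    have hfb := hN' z hzR k
    rw [show ε' = 2 * r by rw [hr]; ring] at hfb
    have := hmain (it p k) (one_le_natDegree_it hp k) z r hr0 hfb (fun x => by
      refine diam_le_of_subset_closedBall (x := 0) hR₁0.le fun w hw => ?_
      have h2 := norm_lt_of_mem_pcomp hw
      have h3 : ‖(it p k).eval w‖ ≤ R₁ := by
        have h4 := norm_add_le ((it p k).eval w - z) z
        rw [sub_add_cancel] at h4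
        have : r ≤ 1 := by rw [hr]; linarith
        linarith [le_max_right R (R' + 1)]
      have h5 := h₁.iterate_le (Nat.zero_le k) h3
      rw [eval_it_zero] at h5
      simpa using h5) t ht
    rw [natDegree_it] at this
    exact_mod_cast this
  calc _ ≤ ∑ z ∈ T, volume {w | ‖(it p k).eval w - z‖ < r / 2 ∧
          ‖(it p k).derivative.eval w‖ ≤ t} :=
        (measure_mono hsub).trans (measure_biUnion_finset_le _ _)
    _ ≤ ∑ z ∈ T, ENNReal.ofReal (C * p.natDegree ^ k * (t / r) ^ s) := Finset.sum_le_sum hz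
    _ = ENNReal.ofReal (T.card * (C * p.natDegree ^ k * (t / r) ^ s)) := by
        rw [Finset.sum_const, nsmul_eq_mul, ← ENNReal.ofReal_natCast,
          ← ENNReal.ofReal_mul (by positivity)]
    _ ≤ _ := by
        apply ENNReal.ofReal_le_ofReal
        rw [div_eq_mul_inv, Real.mul_rpow ht.le (by positivity)]
        have : 0 ≤ C * p.natDegree ^ k * (t ^ s * r⁻¹ ^ s) := by positivity
        calc _ ≤ (T.card + 1) * (C * p.natDegree ^ k * (t ^ s * r⁻¹ ^ s)) := by
              gcongr; linarith
          _ = _ := by ring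

/-- Round annulus of the exhaustion with ratio `ρ`. -/
def ann (ρ r : ℝ) (m : ℕ) : Set ℂ := {z | ρ ^ m * r ≤ ‖z‖ ∧ ‖z‖ < ρ ^ (m + 1) * r}

/-- Exterior of a disc. -/
def ext (ρ r : ℝ) (m : ℕ) : Set ℂ := {z | ρ ^ m * r ≤ ‖z‖}

lemma measurableSet_ann (ρ r : ℝ) (m : ℕ) : MeasurableSet (ann ρ r m) :=
  (measurableSet_le measurable_const measurable_norm).inter
    (measurableSet_lt measurable_norm measurable_const)

lemma measurableSet_ext (ρ r : ℝ) (m : ℕ) : MeasurableSet (ext ρ r m) :=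
  measurableSet_le measurable_const measurable_norm

lemma exists_mem_ann {ρ r : ℝ} (hρ : 1 < ρ) (hr : 0 < r) {m : ℕ} {z : ℂ} (hz : z ∈ ext ρ r m) :
    ∃ i, z ∈ ann ρ r (m + i) := by
  have h1 : ρ ^ m * r ≤ ‖z‖ := hz
  have h2 : 1 ≤ ‖z‖ / (ρ ^ m * r) := by rwa [one_le_div (by positivity)]
  obtain ⟨i, hi1, hi2⟩ := exists_nat_pow_near h2 hρ
  refine ⟨i, ?_, ?_⟩
  · rw [le_div_iff₀ (by positivity)] at hi1
    rw [pow_add]; linarith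
  · rw [div_lt_iff₀ (by positivity)] at hi2
    rw [show m + i + 1 = (i + 1) + m by ring, pow_add]; linarith

lemma logArea_mono {A B : Set ℂ} (h : A ⊆ B) : logArea A ≤ logArea B := lintegral_mono_set h

lemma logArea_iUnion_le (A : ℕ → Set ℂ) : logArea (⋃ i, A i) ≤ ∑' i, logArea (A i) :=
  lintegral_iUnion_le _ _

lemma measurable_logDensity : Measurable fun z : ℂ => ENNReal.ofReal ((‖z‖ ^ 2)⁻¹) := by
  fun_prop

lemma logArea_preimage_le {f : ℂ → ℂ} (hf : Differentiable ℂ f) {s T : Set ℂ}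
    (hs : MeasurableSet s) (hT : MapsTo f s T) {N : ℕ}
    (hN : ∀ u, (s ∩ f ⁻¹' {u}).encard ≤ N) (hder : ∀ z ∈ s, ‖f z‖ ≤ ‖z‖ * ‖deriv f z‖)
    (hf0 : ∀ z ∈ s, f z ≠ 0) : logArea s ≤ N * logArea T := by
  refine le_trans ?_ (lintegral_valence hf hs hT hN measurable_logDensity)
  refine setLIntegral_mono' hs fun z hz => ?_
  rw [← ENNReal.ofReal_mul (by positivity)]
  apply ENNReal.ofReal_le_ofReal
  have h1 := hder z hz
  have h2 : 0 < ‖f z‖ := norm_pos_iff.2 (hf0 z hz)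
  have h3 : 0 < ‖z‖ := by
    by_contra hc
    have : ‖z‖ = 0 := le_antisymm (not_lt.1 hc) (norm_nonneg _)
    rw [this, zero_mul] at h1
    linarith
  rw [← div_eq_mul_inv, ← one_div, div_le_div_iff₀ (by positivity) (by positivity), one_mul,
    mul_comm, ← mul_pow]
  gcongr

lemma tsum_geometric_tail {C x : ℝ} (hC : 0 ≤ C) (hx0 : 0 ≤ x) (hx1 : x < 1) (m : ℕ) :
    ∑' i, ENNReal.ofReal (C * x ^ (m + i)) = ENNReal.ofReal (C * x ^ m / (1 - x)) := by
  have h1 : ∀ i, C * x ^ (m + i) = C * x ^ m * x ^ i := fun i => by ring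
  simp_rw [h1]
  rw [← ENNReal.ofReal_tsum_of_nonneg (fun i => by positivity)
    ((summable_geometric_of_lt_one hx0 hx1).mul_left _), tsum_mul_left,
    tsum_geometric_of_lt_one hx0 hx1, div_eq_mul_inv]

/-- If a map is expanding off a bad set of small logarithmic area, then the set of points whose
orbit meets the bad set has finite logarithmic area. -/
lemma logArea_orbit_meets_bad {f : ℂ → ℂ} (hf : Differentiable ℂ f) {ρ r : ℝ} (hρ : 1 < ρ)
    (hr : 0 < r) {θ C : ℝ} (hθ0 : 0 < θ) (hθ1 : θ < 1) (hC : 0 ≤ C) {D A m₁ : ℕ} {Bd : Set ℂ}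
    (hBd : MeasurableSet Bd)
    (hbad : ∀ m ≥ m₁, logArea (Bd ∩ ann ρ r m) ≤ ENNReal.ofReal (C * θ ^ m))
    (hgrow : ∀ m ≥ m₁, ∀ z ∈ ann ρ r m, z ∉ Bd → ρ ^ (A * m) * r ≤ ‖f z‖)
    (hder : ∀ m ≥ m₁, ∀ z ∈ ann ρ r m, z ∉ Bd → ‖f z‖ ≤ ‖z‖ * ‖deriv f z‖)
    (hfib : ∀ m ≥ m₁, ∀ u, (ann ρ r m ∩ f ⁻¹' {u}).encard ≤ (D ^ m : ℕ))
    (hA : 1 ≤ A) (hDA : D * θ ^ A ≤ θ ^ 2) (hm₁ : 2 * θ ^ m₁ ≤ 1 - θ ^ 2) :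
    logArea {z | z ∈ ext ρ r m₁ ∧ ∃ n, f^[n] z ∈ Bd ∪ (ext ρ r m₁)ᶜ} < ∞ := by
  set X := ext ρ r m₁ with hX
  have hXm : MeasurableSet X := measurableSet_ext _ _ _
  let B : ℕ → Set ℂ := fun j => Nat.rec (Bd ∩ X) (fun _ S => (X \ Bd) ∩ f ⁻¹' S) j
  have hB0 : B 0 = Bd ∩ X := rfl
  have hBs : ∀ j, B (j + 1) = (X \ Bd) ∩ f ⁻¹' B j := fun j => rfl
  have hBm : ∀ j, MeasurableSet (B j) := by
    intro j
    induction j with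
    | zero => exact hBd.inter hXm
    | succ j ih => exact (hXm.diff hBd).inter (hf.continuous.measurable ih)
  have hθ2 : 0 < 1 - θ ^ 2 := by nlinarith
  set C₁ := C / (1 - θ) with hC₁
  have hC₁0 : 0 ≤ C₁ := div_nonneg hC (by linarith)
  have hannX : ∀ {m}, m₁ ≤ m → ext ρ r m ⊆ X := fun {m} hm z hz => by
    have h1 : ρ ^ m * r ≤ ‖z‖ := hz
    have : ρ ^ m₁ ≤ ρ ^ m := pow_le_pow_right₀ hρ.le hm
    change ρ ^ m₁ * r ≤ ‖z‖
    nlinarith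
  have hfX : ∀ z ∈ X, z ∉ Bd → f z ∈ X := by
    intro z hz hzB
    obtain ⟨i, hi⟩ := exists_mem_ann hρ hr hz
    exact hannX (show m₁ ≤ A * (m₁ + i) by nlinarith) (hgrow _ (by omega) z hi hzB)
  have hcov : ∀ (S : Set ℂ) m, logArea (S ∩ ext ρ r m) ≤ ∑' i, logArea (S ∩ ann ρ r (m + i)) := by
    intro S m
    refine (logArea_mono ?_).trans (logArea_iUnion_le _)
    rintro z ⟨hzS, hz⟩
    obtain ⟨i, hi⟩ := exists_mem_ann hρ hr hz
    exact mem_iUnion.2 ⟨i, hzS, hi⟩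
  have hmain : ∀ j m, m₁ ≤ m →
      logArea (B j ∩ ext ρ r m) ≤ ENNReal.ofReal ((1 / 2) ^ j * C₁ * θ ^ m) := by
    intro j
    induction j with
    | zero =>
      intro m hm
      refine (hcov _ m).trans ?_
      calc _ ≤ ∑' i, ENNReal.ofReal (C * θ ^ (m + i)) :=
            ENNReal.tsum_le_tsum fun i => (logArea_mono (by
              rw [hB0]; exact inter_subset_inter_left _ inter_subset_left)).trans
              (hbad _ (by omega))
        _ = _ := by
          rw [tsum_geometric_tail hC hθ0.le hθ1]
          congr 1
          rw [hC₁]; ring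
    | succ j ih =>
      intro m hm
      refine (hcov _ m).trans ?_
      set E := (1 / 2 : ℝ) ^ j * C₁ with hE
      have hE0 : 0 ≤ E := by positivity
      have hstep : ∀ i, logArea (B (j + 1) ∩ ann ρ r (m + i)) ≤
          ENNReal.ofReal (E * (θ ^ 2) ^ (m + i)) := by
        intro i
        set k := m + i with hk
        have hkm : m₁ ≤ k := by omega
        have hnb : ∀ z ∈ B (j + 1) ∩ ann ρ r k, z ∉ Bd := fun z hz => hz.1.1.2
        have h1 := logArea_preimage_le hf (s := B (j + 1) ∩ ann ρ r k)
          (T := B j ∩ ext ρ r (A * k)) ((hBm (j+1)).inter (measurableSet_ann _ _ _))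
          (fun z hz => ⟨hz.1.2, hgrow k hkm z hz.2 (hnb z hz)⟩)
          (fun u => (encard_le_encard (inter_subset_inter_left _ inter_subset_right)).trans
            (hfib k hkm u))
          (fun z hz => hder k hkm z hz.2 (hnb z hz))
          (fun z hz h0 => by
            have := hgrow k hkm z hz.2 (hnb z hz)
            rw [h0, norm_zero] at this
            have : 0 < ρ ^ (A * k) * r := by positivity
            linarith)
        refine h1.trans ?_
        calc _ ≤ ((D ^ k : ℕ) : ℝ≥0∞) * ENNReal.ofReal (E * θ ^ (A * k)) := by
              gcongr
              exact ih _ (by nlinarith)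
          _ = ENNReal.ofReal (E * (D * θ ^ A) ^ k) := by
              rw [← ENNReal.ofReal_natCast, ← ENNReal.ofReal_mul (by positivity)]
              congr 1
              rw [mul_pow, ← pow_mul]
              push_cast
              ring
          _ ≤ _ := by
              apply ENNReal.ofReal_le_ofReal
              gcongr
      calc _ ≤ ∑' i, ENNReal.ofReal (E * (θ ^ 2) ^ (m + i)) := ENNReal.tsum_le_tsum hstep
        _ = ENNReal.ofReal (E * (θ ^ 2) ^ m / (1 - θ ^ 2)) :=
            tsum_geometric_tail hE0 (by positivity) (by linarith) m
        _ ≤ _ := by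
            apply ENNReal.ofReal_le_ofReal
            rw [div_le_iff₀ hθ2]
            have h1 : θ ^ m ≤ θ ^ m₁ := pow_le_pow_of_le_one hθ0.le hθ1.le hm
            have h2 : (1 / 2 : ℝ) ^ (j + 1) * C₁ = E / 2 := by rw [hE]; ring
            rw [h2, ← pow_mul, mul_comm 2 m, pow_mul]
            have h3 : 0 < θ ^ m := by positivity
            have h4 : θ ^ m ≤ (1 - θ ^ 2) / 2 := by linarith
            calc E * (θ ^ m) ^ 2 = E * θ ^ m * θ ^ m := by ring
              _ ≤ E * θ ^ m * ((1 - θ ^ 2) / 2) := by gcongr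
              _ = _ := by ring
  have hsub : {z | z ∈ X ∧ ∃ n, f^[n] z ∈ Bd ∪ Xᶜ} ⊆ ⋃ j, B j ∩ ext ρ r m₁ := by
    rintro z ⟨hzX, n, hn⟩
    have : ∀ n z, z ∈ X → f^[n] z ∈ Bd ∪ Xᶜ → ∃ j, z ∈ B j := by
      intro n
      induction n with
      | zero =>
        rintro z hz (h | h)
        · exact ⟨0, h, hz⟩
        · exact absurd hz h
      | succ n ih =>
        intro z hz h
        by_cases hzB : z ∈ Bd
        · exact ⟨0, hzB, hz⟩
        · rw [Function.iterate_succ_apply] at h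
          obtain ⟨j, hj⟩ := ih (f z) (hfX z hz hzB) h
          exact ⟨j + 1, ⟨hz, hzB⟩, hj⟩
    obtain ⟨j, hj⟩ := this n z hzX hn
    exact mem_iUnion.2 ⟨j, hj, hzX⟩
  refine ((logArea_mono hsub).trans (logArea_iUnion_le _)).trans_lt ?_
  calc _ ≤ ∑' j, ENNReal.ofReal (C₁ * θ ^ m₁ * (1 / 2) ^ (0 + j)) :=
        ENNReal.tsum_le_tsum fun j => (hmain j m₁ le_rfl).trans (le_of_eq (by congr 1; ring))
    _ = ENNReal.ofReal _ := tsum_geometric_tail (by positivity) (by norm_num) (by norm_num) 0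
    _ < ∞ := ENNReal.ofReal_lt_top

lemma poincare_iterate {p : Polynomial ℂ} {lam : ℂ} {f : ℂ → ℂ}
    (hfe : ∀ z : ℂ, f (lam * z) = p.eval (f z)) (m : ℕ) (a : ℂ) :
    f (lam ^ m * a) = (it p m).eval (f a) := by
  induction m with
  | zero => simp [eval_it_zero]
  | succ m ih => rw [eval_it_succ, ← ih, ← hfe, pow_succ']; ring_nf

lemma poincare_deriv {p : Polynomial ℂ} {lam : ℂ} {f : ℂ → ℂ} (hf : Differentiable ℂ f)
    (hfe : ∀ z : ℂ, f (lam * z) = p.eval (f z)) (m : ℕ) (a : ℂ) :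
    lam ^ m * deriv f (lam ^ m * a) = (it p m).derivative.eval (f a) * deriv f a := by
  have h1 : HasDerivAt (fun a => f (lam ^ m * a)) (deriv f (lam ^ m * a) * lam ^ m) a := by
    have h := (hf (lam ^ m * a)).hasDerivAt.comp a ((hasDerivAt_id a).const_mul (lam ^ m))
    simpa [Function.comp_def] using h
  have h2 : HasDerivAt (fun a => (it p m).eval (f a))
      ((it p m).derivative.eval (f a) * deriv f a) a :=
    ((it p m).hasDerivAt (f a)).comp a (hf a).hasDerivAt
  have h3 : (fun a => f (lam ^ m * a)) = fun a => (it p m).eval (f a) :=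
    funext (poincare_iterate hfe m)
  rw [h3] at h1
  rw [mul_comm]; exact h1.unique h2

lemma TranscendentalEntire.not_affine {f : ℂ → ℂ} (hf : TranscendentalEntire f) (a b : ℂ) :
    ∃ z, f z ≠ a * z + b := by
  by_contra! h
  exact hf.2 ⟨Polynomial.C a * Polynomial.X + Polynomial.C b, fun z => by simp [h]⟩

lemma poincare_deriv_zero_ne {p : Polynomial ℂ} {z₀ lam : ℂ} (hfix : p.eval z₀ = z₀)
    (hlam : deriv (fun w => p.eval w) z₀ = lam) (hlam1 : 1 < ‖lam‖)
    {f : ℂ → ℂ} (hf : TranscendentalEntire f) (hf0 : f 0 = z₀)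
    (hfe : ∀ z : ℂ, f (lam * z) = p.eval (f z)) : deriv f 0 ≠ 0 := by
  have han : AnalyticOnNhd ℂ f univ := fun z _ => hf.1.analyticAt z
  have han0 : AnalyticAt ℂ (fun z => f z - z₀) 0 := (hf.1.analyticAt 0).sub analyticAt_const
  have hnc : ¬ ∀ᶠ z in 𝓝 0, f z - z₀ = 0 := by
    intro h
    have h1 : f = fun _ => z₀ := by
      refine AnalyticOnNhd.eq_of_eventuallyEq han (fun z _ => analyticAt_const) (z₀ := 0) ?_
      filter_upwards [h] with z hz
      exact sub_eq_zero.1 hz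
    obtain ⟨z, hz⟩ := hf.not_affine 0 z₀
    exact hz (by rw [h1]; simp)
  obtain ⟨n, g, hg, hg0, hfg⟩ := han0.exists_eventuallyEq_pow_smul_nonzero_iff.2 hnc
  simp only [sub_zero, smul_eq_mul] at hfg
  obtain ⟨P₁, hP₁⟩ : Polynomial.X - Polynomial.C z₀ ∣ p - Polynomial.C z₀ := by
    rw [Polynomial.dvd_iff_isRoot]; simp [hfix]
  have hP : ∀ w, p.eval w - z₀ = (w - z₀) * P₁.eval w := fun w => by
    have := congrArg (Polynomial.eval w) hP₁
    simpa using this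
  have hP0 : P₁.eval z₀ = lam := by
    have h1 : p.derivative = P₁ + (Polynomial.X - Polynomial.C z₀) * P₁.derivative := by
      have := congrArg Polynomial.derivative hP₁
      simpa [Polynomial.derivative_mul] using this
    rw [Polynomial.deriv, h1] at hlam
    simpa using hlam
  have hl0 : lam ≠ 0 := by rintro rfl; simp at hlam1; linarith
  have hlt : Tendsto (fun z => lam * z) (𝓝 0) (𝓝 0) := by
    have : Continuous fun z => lam * z := by fun_prop
    simpa using this.tendsto 0
  have e1 : ∀ᶠ z in 𝓝[≠] (0 : ℂ), lam ^ n * g (lam * z) = g z * P₁.eval (f z) := by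
    have h2 : ∀ᶠ z in 𝓝 (0 : ℂ), f z - z₀ = z ^ n * g z ∧
        f (lam * z) - z₀ = (lam * z) ^ n * g (lam * z) := hfg.and (hlt.eventually hfg)
    filter_upwards [h2.filter_mono nhdsWithin_le_nhds, self_mem_nhdsWithin] with z hz hz0
    have hz0' : z ^ n ≠ 0 := pow_ne_zero _ hz0
    have h3 := hP (f z)
    rw [← hfe, hz.2, hz.1, mul_pow] at h3
    apply mul_left_cancel₀ hz0'
    linear_combination h3
  have t1 : Tendsto (fun z => lam ^ n * g (lam * z)) (𝓝[≠] 0) (𝓝 (lam ^ n * g 0)) := by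
    have : Tendsto (fun z => g (lam * z)) (𝓝 0) (𝓝 (g 0)) := hg.continuousAt.tendsto.comp hlt
    exact (this.const_mul _).mono_left nhdsWithin_le_nhds
  have t2 : Tendsto (fun z => g z * P₁.eval (f z)) (𝓝[≠] 0) (𝓝 (g 0 * lam)) := by
    have h4 : Tendsto (fun z => P₁.eval (f z)) (𝓝 0) (𝓝 lam) := by
      have : Continuous fun z => P₁.eval (f z) := P₁.continuous.comp hf.1.continuous
      have h5 := this.tendsto 0
      rwa [hf0, hP0] at h5
    exact (hg.continuousAt.tendsto.mul h4).mono_left nhdsWithin_le_nhds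
  have h6 := tendsto_nhds_unique (t1.congr' e1) t2
  have h7 : lam ^ n = lam := by
    apply mul_right_cancel₀ hg0; rw [h6, mul_comm]
  have hn : n = 1 := by
    have h8 : ‖lam‖ ^ n = ‖lam‖ ^ 1 := by rw [← norm_pow, h7, pow_one]
    exact pow_right_injective₀ (by linarith) hlam1.ne' h8
  subst hn
  have h9 : HasDerivAt (fun z => z ^ 1 * g z) (g 0) 0 := by
    have := (hasDerivAt_id (0 : ℂ)).mul hg.differentiableAt.hasDerivAt
    simp only [id, one_mul, zero_mul, add_zero] at this
    refine this.congr_of_eventuallyEq (Eventually.of_forall fun z => ?_)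
    simp
  have h10 : HasDerivAt f (g 0) 0 := by
    have := (h9.congr_of_eventuallyEq hfg).add_const z₀
    simpa using this
  rwa [h10.deriv]

/-- A disc on which the Poincaré function is univalent with derivative bounded below. -/
lemma exists_univalent_disc {f : ℂ → ℂ} (hf : Differentiable ℂ f) (h0 : deriv f 0 ≠ 0) :
    ∃ r, 0 < r ∧ InjOn f (ball 0 r) ∧ ∃ c, 0 < c ∧ ∀ z ∈ ball (0 : ℂ) r, c ≤ ‖deriv f z‖ := by
  obtain ⟨U, hU, h0U, hinj⟩ := exists_isOpen_injOn hf h0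
  have hd : Continuous (deriv f) := hf.contDiff.continuous_deriv (n := 1) le_rfl
  have h1 : ∀ᶠ z in 𝓝 (0 : ℂ), ‖deriv f 0‖ / 2 < ‖deriv f z‖ := by
    refine hd.norm.continuousAt.eventually_const_lt ?_
    have := norm_pos_iff.2 h0
    linarith
  obtain ⟨r, hr, h2⟩ := Metric.eventually_nhds_iff_ball.1 (h1.and (hU.mem_nhds h0U))
  exact ⟨r, hr, hinj.mono fun z hz => (h2 z hz).2, ‖deriv f 0‖ / 2,
    by have := norm_pos_iff.2 h0; linarith, fun z hz => (h2 z hz).1.le⟩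

/-- Points whose orbit leaves the disc of radius `R` within `l` steps, with derivative at least
`t` at a moment when it lies in a bounded annulus. -/
def goodSet (p : Polynomial ℂ) (R R' : ℝ) (l : ℕ) (t : ℝ) : Set ℂ :=
  {w | ∃ k, k ≤ l ∧ R ≤ ‖(it p k).eval w‖ ∧ ‖(it p k).eval w‖ ≤ R' ∧
    t ≤ ‖(it p k).derivative.eval w‖}

lemma measurableSet_goodSet (p : Polynomial ℂ) (R R' : ℝ) (l : ℕ) (t : ℝ) :
    MeasurableSet (goodSet p R R' l t) := by
  have h : goodSet p R R' l t = ⋃ k, {w | k ≤ l ∧ R ≤ ‖(it p k).eval w‖ ∧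
      ‖(it p k).eval w‖ ≤ R' ∧ t ≤ ‖(it p k).derivative.eval w‖} := by
    ext w; simp [goodSet]
  rw [h]
  refine MeasurableSet.iUnion fun k => ?_
  have c1 : Continuous fun w => ‖(it p k).eval w‖ := (it p k).continuous.norm
  have c2 : Continuous fun w => ‖(it p k).derivative.eval w‖ := (it p k).derivative.continuous.norm
  exact (MeasurableSet.const _).inter ((measurableSet_le measurable_const c1.measurable).inter
    ((measurableSet_le c1.measurable measurable_const).inter
      (measurableSet_le measurable_const c2.measurable)))

lemma notMem_goodSet {p : Polynomial ℂ} {R R' : ℝ} {l : ℕ} {t : ℝ}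
    (hR' : ∀ v, ‖v‖ ≤ R → ‖p.eval v‖ ≤ R') {w : ℂ} (hw : ‖w‖ < R)
    (h : w ∉ goodSet p R R' l t) :
    ‖(it p l).eval w‖ < R ∨ ∃ k ∈ Finset.range (l + 1), ‖(it p k).eval w‖ ≤ R' ∧
      ‖(it p k).derivative.eval w‖ ≤ t := by
  by_contra! hc
  classical
  have hex : ∃ k, R ≤ ‖(it p k).eval w‖ := ⟨l, hc.1⟩
  have h1 := Nat.find_spec hex
  have h2 : Nat.find hex ≤ l := Nat.find_min' hex hc.1
  have h3 : ‖(it p (Nat.find hex)).eval w‖ ≤ R' := by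
    rcases hk : Nat.find hex with _ | k
    · rw [hk, eval_it_zero] at h1; linarith
    · have := Nat.find_min hex (m := k) (by omega)
      rw [eval_it_succ]
      exact hR' _ (not_le.1 this).le
  exact h ⟨_, h2, h1, h3, (hc.2 _ (Finset.mem_range.2 (by omega)) h3).le⟩

lemma EscR.volume_not_good_le {p : Polynomial ℂ} {R : ℝ} (hp : 1 ≤ p.natDegree) (h : EscR p R)
    {ε : ℝ} {N : ℕ} (hε : 0 < ε) (hN : ∀ z ∈ filled p R, ∀ n, FibreBound (it p n) z ε N)
    (hK : filled p R ⊆ frontier (filled p R)) {R' : ℝ}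
    (hR' : ∀ v, ‖v‖ ≤ R → ‖p.eval v‖ ≤ R') :
    ∃ q : ℕ, 2 ≤ q ∧ ∃ C θ, 0 < C ∧ 0 < θ ∧ θ < 1 ∧ ∀ m : ℕ,
      volume (ball 0 R \ goodSet p R R' (m / q) ((9 / 10) ^ m)) ≤ ENNReal.ofReal (C * θ ^ m) := by
  obtain ⟨C₁, c, hC₁, hc, h1⟩ := h.volume_sublevel_le hp hε hN hK
  obtain ⟨C₂, s, hC₂, hs, h2⟩ := h.volume_small_derivative_le hp hε hN R'
  set η := Real.log (10 / 9) with hη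
  have hη0 : 0 < η := Real.log_pos (by norm_num)
  set x := η * s / 4 with hx
  have hx0 : 0 < x := by positivity
  set d := p.natDegree with hdd
  have hd0 : (0 : ℝ) < d := by exact_mod_cast hp
  have hld : 0 ≤ Real.log d := Real.log_nonneg (by exact_mod_cast hp)
  obtain ⟨q₀, hq₀⟩ := exists_nat_ge (Real.log d / x)
  set q := q₀ + 2 with hq
  have hq1 : (0 : ℝ) < q := by positivity
  have hqx : Real.log d ≤ q * x := by
    rw [div_le_iff₀ hx0] at hq₀
    have : (q : ℝ) = q₀ + 2 := by simp [hq]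
    rw [this]; nlinarith
  set y := min (c / q) (2 * x) with hy
  have hy0 : 0 < y := lt_min (by positivity) (by positivity)
  set K := C₂ * (1 + 1 / x) with hK'
  have hK0 : 0 < K := by positivity
  refine ⟨q, by omega, C₁ * Real.exp c + K, Real.exp (-y), by positivity, by positivity,
    by rw [Real.exp_lt_one_iff]; linarith, fun m => ?_⟩
  set l := m / q with hl
  set t : ℝ := (9 / 10) ^ m with ht
  have ht0 : 0 < t := by positivity
  have hlm : (l : ℝ) ≤ m := by exact_mod_cast Nat.div_le_self _ _
  have hlq : (l : ℝ) * q ≤ m := by exact_mod_cast Nat.div_mul_le_self _ _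
  have hlq' : (m : ℝ) ≤ (l + 1) * q := by
    have := Nat.lt_div_mul_add (a := m) (b := q) (by omega)
    have h' : m ≤ (l + 1) * q := by rw [add_mul, one_mul]; exact this.le
    exact_mod_cast h'
  have hsub : ball 0 R \ goodSet p R R' l t ⊆ {w | ‖(it p l).eval w‖ < R} ∪
      ⋃ k ∈ Finset.range (l + 1), {w | ‖(it p k).eval w‖ ≤ R' ∧
        ‖(it p k).derivative.eval w‖ ≤ t} := by
    rintro w ⟨hw, hw'⟩
    rcases notMem_goodSet hR' (by simpa using hw) hw' with h' | ⟨k, hk, h'⟩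
    · exact Or.inl h'
    · exact Or.inr (mem_biUnion hk h')
  have e1 : C₁ * Real.exp (-(c * l)) ≤ C₁ * Real.exp c * Real.exp (-y) ^ m := by
    rw [mul_assoc, ← Real.exp_nat_mul, ← Real.exp_add]
    gcongr
    have : y * q ≤ c := by
      have := min_le_left (c / q) (2 * x)
      rw [← le_div_iff₀ hq1]; exact this
    nlinarith
  have e2 : (l + 1 : ℝ) * (C₂ * d ^ l * t ^ s) ≤ K * Real.exp (-y) ^ m := by
    have a1 : (d : ℝ) ^ l ≤ Real.exp (x * m) := by
      rw [← Real.exp_log hd0, ← Real.exp_nat_mul]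
      refine Real.exp_le_exp.2 ?_
      have : (l : ℝ) * Real.log d ≤ l * (q * x) := by gcongr
      nlinarith
    have a2 : t ^ s = Real.exp (-(4 * x * m)) := by
      have : t = Real.exp (-(η * m)) := by
        rw [ht, hη, show -(Real.log (10 / 9) * m) = m * -Real.log (10 / 9 : ℝ) by ring,
          ← Real.log_inv, Real.exp_nat_mul, Real.exp_log (by norm_num)]
        norm_num
      rw [this, ← Real.exp_mul, hx]; ring_nf
    have a3 : (l + 1 : ℝ) ≤ (1 + 1 / x) * Real.exp (x * m) := by
      have b1 := Real.add_one_le_exp (x * m)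
      have b2 : (1 : ℝ) ≤ Real.exp (x * m) := Real.one_le_exp (by positivity)
      have b3 : (m : ℝ) ≤ 1 / x * Real.exp (x * m) := by
        rw [one_div, ← div_eq_inv_mul, le_div_iff₀ hx0]; linarith
      linarith
    have a4 : Real.exp (x * m) * Real.exp (x * m) * Real.exp (-(4 * x * m)) ≤
        Real.exp (-y) ^ m := by
      rw [← Real.exp_add, ← Real.exp_add, ← Real.exp_nat_mul]
      gcongr
      have := min_le_right (c / q) (2 * x)
      have hm : (0 : ℝ) ≤ m := by positivity
      nlinarith
    calc (l + 1 : ℝ) * (C₂ * d ^ l * t ^ s)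
        ≤ ((1 + 1 / x) * Real.exp (x * m)) * (C₂ * Real.exp (x * m) *
          Real.exp (-(4 * x * m))) := by rw [a2]; gcongr
      _ = K * (Real.exp (x * m) * Real.exp (x * m) * Real.exp (-(4 * x * m))) := by
          rw [hK']; ring
      _ ≤ _ := by gcongr
  calc volume (ball 0 R \ goodSet p R R' l t)
      ≤ volume {w | ‖(it p l).eval w‖ < R} + ∑ k ∈ Finset.range (l + 1),
        volume {w | ‖(it p k).eval w‖ ≤ R' ∧ ‖(it p k).derivative.eval w‖ ≤ t} :=
        (measure_mono hsub).trans ((measure_union_le _ _).trans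
          (add_le_add le_rfl (measure_biUnion_finset_le _ _)))
    _ ≤ ENNReal.ofReal (C₁ * Real.exp (-(c * l))) + ∑ k ∈ Finset.range (l + 1),
        ENNReal.ofReal (C₂ * d ^ l * t ^ s) := by
        refine add_le_add (h1 l) (Finset.sum_le_sum fun k hk => (h2 k t ht0).trans ?_)
        apply ENNReal.ofReal_le_ofReal
        have : (d : ℝ) ^ k ≤ d ^ l := pow_le_pow_right₀ (by exact_mod_cast hp)
          (by have := Finset.mem_range.1 hk; omega)
        gcongr
    _ = ENNReal.ofReal (C₁ * Real.exp (-(c * l)) + (l + 1) * (C₂ * d ^ l * t ^ s)) := by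
        rw [Finset.sum_const, Finset.card_range, nsmul_eq_mul, ENNReal.ofReal_add (by positivity)
          (by positivity), ENNReal.ofReal_mul (p := (l + 1 : ℝ)) (by positivity)]
        congr 2
        rw [← Nat.cast_succ, ENNReal.ofReal_natCast]
    _ ≤ _ := by
        apply ENNReal.ofReal_le_ofReal
        rw [add_mul]; linarith

lemma ann_unique {ρ r : ℝ} (hρ : 1 < ρ) (hr : 0 < r) {m n : ℕ} {z : ℂ} (hm : z ∈ ann ρ r m)
    (hn : z ∈ ann ρ r n) : m = n := by
  have key : ∀ {m n : ℕ}, z ∈ ann ρ r m → z ∈ ann ρ r n → m ≤ n := by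
    intro m n hm hn
    by_contra hc
    have h1 : ρ ^ (n + 1) ≤ ρ ^ m := pow_le_pow_right₀ hρ.le (by omega)
    have h2 : ρ ^ (n + 1) * r ≤ ρ ^ m * r := by gcongr
    linarith [hm.1, hn.2]
  exact le_antisymm (key hm hn) (key hn hm)

lemma logArea_image_mul {c : ℂ} (hc : c ≠ 0) {S : Set ℂ} (hS : MeasurableSet S) :
    logArea ((fun z => c * z) '' S) = logArea S := by
  unfold logArea
  have hd : Differentiable ℂ fun z : ℂ => c * z := by fun_prop
  have hderiv : ∀ z, deriv (fun z : ℂ => c * z) z = c := fun z => by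
    simp
  rw [lintegral_image_holo hd hS (fun a _ b _ h => mul_left_cancel₀ hc h)]
  congr 1 with z
  rw [hderiv, ← ENNReal.ofReal_mul (by positivity)]
  congr 1
  have : ‖c‖ ≠ 0 := norm_ne_zero_iff.2 hc
  rw [norm_mul, mul_pow, mul_inv, ← mul_assoc, mul_inv_cancel₀ (pow_ne_zero _ this), one_mul]

lemma logArea_le_volume {r : ℝ} (hr : 0 < r) {S : Set ℂ} (hS : MeasurableSet S)
    (h : ∀ z ∈ S, r ≤ ‖z‖) : logArea S ≤ ENNReal.ofReal ((r ^ 2)⁻¹) * volume S := by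
  unfold logArea
  rw [← setLIntegral_const]
  refine setLIntegral_mono' hS fun z hz => ENNReal.ofReal_le_ofReal ?_
  have := h z hz
  gcongr

lemma volume_le_of_injOn {f : ℂ → ℂ} (hf : Differentiable ℂ f) {S T : Set ℂ}
    (hS : MeasurableSet S) (hinj : InjOn f S) {c : ℝ} (hc : 0 < c)
    (hder : ∀ z ∈ S, c ≤ ‖deriv f z‖) (hT : MapsTo f S T) :
    volume S ≤ ENNReal.ofReal ((c ^ 2)⁻¹) * volume T := by
  have h1 : ENNReal.ofReal (c ^ 2) * volume S ≤ volume T := by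
    calc ENNReal.ofReal (c ^ 2) * volume S
        ≤ ∫⁻ x in S, ENNReal.ofReal (‖deriv f x‖ ^ 2) * 1 := by
          rw [← setLIntegral_const]
          refine setLIntegral_mono' hS fun z hz => ?_
          rw [mul_one]
          apply ENNReal.ofReal_le_ofReal
          have := hder z hz
          gcongr
      _ = volume (f '' S) := by rw [← lintegral_image_holo hf hS hinj (fun _ => 1)]; simp
      _ ≤ volume T := measure_mono hT.image_subset
  calc volume S = ENNReal.ofReal ((c ^ 2)⁻¹) * (ENNReal.ofReal (c ^ 2) * volume S) := by
        rw [← mul_assoc, ← ENNReal.ofReal_mul (by positivity), inv_mul_cancel₀ (by positivity)]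
        simp
    _ ≤ _ := by gcongr

/-- Points whose rescaled image is not in the good set. -/
def badSet (p : Polynomial ℂ) (f : ℂ → ℂ) (lam : ℂ) (r R R' : ℝ) (q : ℕ) : Set ℂ :=
  ⋃ m, ann ‖lam‖ r m ∩
    (fun z => f ((lam ^ m)⁻¹ * z)) ⁻¹' (goodSet p R R' (m / q) ((9 / 10) ^ m))ᶜ

lemma measurableSet_badSet (p : Polynomial ℂ) {f : ℂ → ℂ} (hf : Continuous f) (lam : ℂ)
    (r R R' : ℝ) (q : ℕ) : MeasurableSet (badSet p f lam r R R' q) := by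
  refine MeasurableSet.iUnion fun m => (measurableSet_ann _ _ _).inter ?_
  have : Continuous fun z => f ((lam ^ m)⁻¹ * z) := by fun_prop
  exact this.measurable (measurableSet_goodSet _ _ _ _ _).compl

lemma inv_mul_mem_ann {lam : ℂ} (hl : lam ≠ 0) {r : ℝ} {m : ℕ} {z : ℂ} (hz : z ∈ ann ‖lam‖ r m) :
    (lam ^ m)⁻¹ * z ∈ ann ‖lam‖ r 0 := by
  have h0 : 0 < ‖lam‖ := norm_pos_iff.2 hl
  have h1 : ‖(lam ^ m)⁻¹ * z‖ = ‖z‖ / ‖lam‖ ^ m := by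
    rw [norm_mul, norm_inv, norm_pow]; field_simp
  refine ⟨?_, ?_⟩
  · rw [h1, le_div_iff₀ (by positivity)]; linarith [hz.1]
  · rw [h1, div_lt_iff₀ (by positivity)]
    have := hz.2
    rw [pow_succ] at this
    rw [zero_add, pow_one]
    linarith

lemma logArea_badSet_le {p : Polynomial ℂ} {f : ℂ → ℂ} (hf : Differentiable ℂ f) {lam : ℂ}
    (hl : 1 < ‖lam‖) {r R R' : ℝ} (hr : 0 < r) {q : ℕ} (hinj : InjOn f (ann ‖lam‖ r 0)) {c : ℝ}
    (hc : 0 < c) (hder : ∀ z ∈ ann ‖lam‖ r 0, c ≤ ‖deriv f z‖)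
    (hR : ∀ z ∈ ann ‖lam‖ r 0, ‖f z‖ < R) {C θ : ℝ} (m : ℕ)
    (hvol : volume (ball 0 R \ goodSet p R R' (m / q) ((9 / 10) ^ m)) ≤
      ENNReal.ofReal (C * θ ^ m)) :
    logArea (badSet p f lam r R R' q ∩ ann ‖lam‖ r m) ≤
      ENNReal.ofReal ((r ^ 2)⁻¹ * (c ^ 2)⁻¹ * C * θ ^ m) := by
  have hl0 : lam ≠ 0 := by rintro rfl; simp at hl; linarith
  set S := ann ‖lam‖ r 0 ∩ f ⁻¹' (goodSet p R R' (m / q) ((9 / 10) ^ m))ᶜ with hS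
  have hSm : MeasurableSet S := (measurableSet_ann _ _ _).inter
    (hf.continuous.measurable (measurableSet_goodSet _ _ _ _ _).compl)
  have hsub : badSet p f lam r R R' q ∩ ann ‖lam‖ r m ⊆ (fun z => lam ^ m * z) '' S := by
    rintro z ⟨hz, hzm⟩
    obtain ⟨n, hn, hn'⟩ := mem_iUnion.1 hz
    obtain rfl := ann_unique hl hr hn hzm
    exact ⟨(lam ^ n)⁻¹ * z, ⟨inv_mul_mem_ann hl0 hn, hn'⟩,
      mul_inv_cancel_left₀ (pow_ne_zero _ hl0) z⟩
  calc logArea (badSet p f lam r R R' q ∩ ann ‖lam‖ r m)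
      ≤ logArea S := (logArea_mono hsub).trans (logArea_image_mul (pow_ne_zero _ hl0) hSm).le
    _ ≤ ENNReal.ofReal ((r ^ 2)⁻¹) * volume S :=
        logArea_le_volume hr hSm fun z hz => by simpa using hz.1.1
    _ ≤ ENNReal.ofReal ((r ^ 2)⁻¹) * (ENNReal.ofReal ((c ^ 2)⁻¹) *
        ENNReal.ofReal (C * θ ^ m)) := by
        gcongr
        refine (volume_le_of_injOn hf hSm (hinj.mono inter_subset_left) hc
          (fun z hz => hder z hz.1) (T := ball 0 R \ goodSet p R R' (m / q) ((9 / 10) ^ m))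
          fun z hz => ⟨by simpa using hR z hz.1, hz.2⟩).trans ?_
        gcongr
    _ = _ := by
        rw [← ENNReal.ofReal_mul (by positivity), ← ENNReal.ofReal_mul (by positivity)]
        ring_nf

lemma exists_of_notMem_badSet {p : Polynomial ℂ} {f : ℂ → ℂ} {lam : ℂ} {r R R' : ℝ} {q m : ℕ}
    {z : ℂ} (hz : z ∈ ann ‖lam‖ r m) (hzb : z ∉ badSet p f lam r R R' q) :
    f ((lam ^ m)⁻¹ * z) ∈ goodSet p R R' (m / q) ((9 / 10) ^ m) := by
  by_contra h
  exact hzb (mem_iUnion.2 ⟨m, hz, h⟩)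

lemma six_fifths_pow_le {m n : ℕ} (h : m ≤ 2 * n) : (6 / 5 : ℝ) ^ m ≤ (3 / 2) ^ n := by
  calc (6 / 5 : ℝ) ^ m ≤ (6 / 5) ^ (2 * n) := pow_le_pow_right₀ (by norm_num) h
    _ = (36 / 25) ^ n := by rw [pow_mul]; norm_num
    _ ≤ _ := pow_le_pow_left₀ (by norm_num) (by norm_num) n

lemma growth_of_notMem_badSet {p : Polynomial ℂ} {f : ℂ → ℂ} {lam : ℂ} (hl : 1 < ‖lam‖)
    (hfe : ∀ z : ℂ, f (lam * z) = p.eval (f z)) {r R R' : ℝ} (h : EscR p R) {q m : ℕ}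
    (hq : 2 ≤ q) {z : ℂ} (hz : z ∈ ann ‖lam‖ r m) (hzb : z ∉ badSet p f lam r R R' q) :
    Real.log 2 * (6 / 5) ^ m ≤ Real.log ‖f z‖ := by
  have hl0 : lam ≠ 0 := by rintro rfl; simp at hl; linarith
  obtain ⟨k, hk, hkR, -, -⟩ := exists_of_notMem_badSet hz hzb
  set a := (lam ^ m)⁻¹ * z with ha
  have hza : z = lam ^ m * a := (mul_inv_cancel_left₀ (pow_ne_zero _ hl0) z).symm
  have hk2 : 2 * k ≤ m := by
    have h1 := Nat.div_mul_le_self m q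
    nlinarith
  have h1 : f z = (it p (m - k)).eval ((it p k).eval (f a)) := by
    rw [← eval_it_add, Nat.sub_add_cancel (by omega), hza, poincare_iterate hfe]
  rw [h1]
  refine le_trans ?_ (h.log_iterate hkR (m - k))
  rw [mul_comm]
  exact mul_le_mul (six_fifths_pow_le (by omega))
    (Real.log_le_log (by norm_num) (by linarith [h.1])) (Real.log_nonneg (by norm_num))
    (by positivity)

lemma deriv_of_notMem_badSet {p : Polynomial ℂ} {f : ℂ → ℂ} (hf : Differentiable ℂ f) {lam : ℂ}
    (hl : 1 < ‖lam‖)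
    (hfe : ∀ z : ℂ, f (lam * z) = p.eval (f z)) {r R R' : ℝ} (h : EscR p R) {c : ℝ}
    (hc : 0 < c) (hder : ∀ z ∈ ann ‖lam‖ r 0, c ≤ ‖deriv f z‖) {q m : ℕ}
    (hq : 2 ≤ q) (hm : 2 * R' ≤ r * c * (27 / 25) ^ m)
    {z : ℂ} (hz : z ∈ ann ‖lam‖ r m) (hzb : z ∉ badSet p f lam r R R' q) :
    2 * ‖f z‖ ≤ ‖z‖ * ‖deriv f z‖ := by
  have hl0 : lam ≠ 0 := by rintro rfl; simp at hl; linarith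
  obtain ⟨k, hk, hkR, hkR', hkt⟩ := exists_of_notMem_badSet hz hzb
  set a := (lam ^ m)⁻¹ * z with ha
  have hza : z = lam ^ m * a := (mul_inv_cancel_left₀ (pow_ne_zero _ hl0) z).symm
  have haA : a ∈ ann ‖lam‖ r 0 := inv_mul_mem_ann hl0 hz
  have har : r ≤ ‖a‖ := by simpa using haA.1
  have hk2 : 2 * k ≤ m := by
    have h1 := Nat.div_mul_le_self m q
    nlinarith
  set v := (it p k).eval (f a) with hv
  have hv0 : 0 < ‖v‖ := by linarith [h.1]
  have h1 : f z = (it p (m - k)).eval v := by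
    rw [← eval_it_add, Nat.sub_add_cancel (by omega), hza, poincare_iterate hfe]
  have h2 : (it p m).derivative.eval (f a) =
      (it p (m - k)).derivative.eval v * (it p k).derivative.eval (f a) := by
    rw [← derivative_it_add, Nat.sub_add_cancel (by omega)]
  have h3 : ‖z‖ * ‖deriv f z‖ = ‖a‖ * (‖(it p (m - k)).derivative.eval v‖ *
      ‖(it p k).derivative.eval (f a)‖ * ‖deriv f a‖) := by
    have := congrArg norm (poincare_deriv hf hfe m a)
    rw [h2, ← hza, norm_mul, norm_mul, norm_mul] at this
    rw [← this]
    rw [(congrArg norm hza).trans (norm_mul _ _)]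
    ring
  have h4 := h.deriv_iterate hkR (m - k)
  rw [← h1] at h4
  have h5 : (6 / 5 : ℝ) ^ m * ‖f z‖ ≤ ‖v‖ * ‖(it p (m - k)).derivative.eval v‖ :=
    (mul_le_mul_of_nonneg_right (six_fifths_pow_le (by omega)) (norm_nonneg _)).trans h4
  have h6 : (27 / 25 : ℝ) ^ m = (6 / 5) ^ m * (9 / 10) ^ m := by
    rw [← mul_pow]; norm_num
  have h7 : ‖v‖ * (2 * ‖f z‖) ≤ ‖v‖ * (‖z‖ * ‖deriv f z‖) := by
    have hda := hder a haA
    calc ‖v‖ * (2 * ‖f z‖) ≤ R' * (2 * ‖f z‖) := by gcongr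
      _ = (2 * R') * ‖f z‖ := by ring
      _ ≤ (r * c * (27 / 25) ^ m) * ‖f z‖ := by gcongr
      _ = r * c * (9 / 10) ^ m * ((6 / 5) ^ m * ‖f z‖) := by rw [h6]; ring
      _ ≤ ‖a‖ * ‖deriv f a‖ * ‖(it p k).derivative.eval (f a)‖ *
          (‖v‖ * ‖(it p (m - k)).derivative.eval v‖) := by gcongr
      _ = _ := by rw [h3]; ring
  exact le_of_mul_le_mul_left h7 hv0

lemma fibre_ann_le {p : Polynomial ℂ} (hp : 1 ≤ p.natDegree) {f : ℂ → ℂ} {lam : ℂ}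
    (hl : 1 < ‖lam‖) (hfe : ∀ z : ℂ, f (lam * z) = p.eval (f z)) {r : ℝ}
    (hinj : InjOn f (ann ‖lam‖ r 0)) (m : ℕ) (u : ℂ) :
    (ann ‖lam‖ r m ∩ f ⁻¹' {u}).encard ≤ (p.natDegree ^ m : ℕ) := by
  classical
  have hl0 : lam ≠ 0 := by rintro rfl; simp at hl; linarith
  have hnd : 1 ≤ (it p m).natDegree := one_le_natDegree_it hp m
  have hne : it p m - Polynomial.C u ≠ 0 := fun h => by
    have := congrArg Polynomial.natDegree h
    rw [Polynomial.natDegree_sub_C, Polynomial.natDegree_zero] at this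
    omega
  have hcard : ((it p m - Polynomial.C u).roots.toFinset : Set ℂ).encard ≤
      (p.natDegree ^ m : ℕ) := by
    rw [encard_coe_eq_coe_finsetCard]
    have h1 := Multiset.toFinset_card_le (it p m - Polynomial.C u).roots
    have h2 := Polynomial.card_roots' (it p m - Polynomial.C u)
    rw [Polynomial.natDegree_sub_C, natDegree_it] at h2
    exact_mod_cast h1.trans h2
  refine le_trans ?_ hcard
  have hmaps : MapsTo (fun z => f ((lam ^ m)⁻¹ * z)) (ann ‖lam‖ r m ∩ f ⁻¹' {u})
      ((it p m - Polynomial.C u).roots.toFinset : Set ℂ) := by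
    rintro z ⟨hz, hzu⟩
    have : (it p m).eval (f ((lam ^ m)⁻¹ * z)) = u := by
      rw [← poincare_iterate hfe, mul_inv_cancel_left₀ (pow_ne_zero _ hl0)]; exact hzu
    simp [hne, this]
  refine encard_le_encard_of_injOn hmaps ?_
  intro z hz z' hz' h
  have := hinj (inv_mul_mem_ann hl0 hz.1) (inv_mul_mem_ann hl0 hz'.1) h
  exact mul_left_cancel₀ (inv_ne_zero (pow_ne_zero _ hl0)) this

lemma maxMod_le {f : ℂ → ℂ} {x B : ℝ} (hx : 0 ≤ x) (h : ∀ z, ‖z‖ = x → ‖f z‖ ≤ B) :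
    maxMod f x ≤ B := by
  refine csSup_le ⟨_, (x : ℂ), by simp [abs_of_nonneg hx], rfl⟩ ?_
  rintro _ ⟨z, hz, rfl⟩
  exact h z hz

lemma le_maxMod {f : ℂ → ℂ} (hf : Continuous f) (z : ℂ) : ‖f z‖ ≤ maxMod f ‖z‖ := by
  refine le_csSup ?_ ⟨z, rfl, rfl⟩
  have : {w : ℂ | ‖w‖ = ‖z‖} = sphere 0 ‖z‖ := by ext w; simp
  rw [this]
  exact ((isCompact_sphere (0 : ℂ) ‖z‖).image hf.norm).bddAbove

lemma TranscendentalEntire.exists_lt_maxMod {f : ℂ → ℂ} (hf : TranscendentalEntire f) :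
    ∃ R, 0 < R ∧ ∀ x, R ≤ x → x < maxMod f x := by
  by_contra! hc
  have hg : Differentiable ℂ (dslope f 0) := by
    rw [← differentiableOn_univ]
    exact (Complex.differentiableOn_dslope univ_mem).2 hf.1.differentiableOn
  have hb : ∀ z, ‖dslope f 0 z‖ ≤ 1 + ‖f 0‖ := by
    intro z
    obtain ⟨x, hx, hM⟩ := hc (‖z‖ + 1) (by positivity)
    have hx1 : 1 ≤ x := by linarith [norm_nonneg z]
    refine Complex.norm_le_of_forall_mem_frontier_norm_le (U := ball 0 x) isBounded_ball
      hg.diffContOnCl (fun w hw => ?_) (subset_closure (by simp; linarith))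
    rw [frontier_ball _ (by linarith)] at hw
    have hwx : ‖w‖ = x := by simpa using hw
    have hw0 : w ≠ 0 := by rw [← norm_pos_iff, hwx]; linarith
    rw [dslope_of_ne _ hw0, slope_def_field, norm_div, sub_zero, hwx,
      div_le_iff₀ (by linarith)]
    have h1 := (le_maxMod hf.1.continuous w).trans (hwx ▸ hM)
    have h2 := norm_sub_le (f w) (f 0)
    nlinarith [norm_nonneg (f 0)]
  have hconst : ∀ z, dslope f 0 z = dslope f 0 0 := fun z =>
    hg.apply_eq_apply_of_bounded (isBounded_iff_forall_norm_le.2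
      ⟨1 + ‖f 0‖, by rintro _ ⟨w, rfl⟩; exact hb w⟩) z 0
  obtain ⟨z, hz⟩ := hf.not_affine (dslope f 0 0) (f 0)
  apply hz
  have := sub_smul_dslope f 0 z
  rw [hconst z, sub_zero, smul_eq_mul] at this
  rw [mul_comm, this]; ring

lemma le_norm_of_le_log {x y : ℝ} (hx : 0 ≤ x) (hy : 0 < y) (h : y ≤ Real.log x) :
    Real.exp y ≤ x := by
  have hx0 : 0 < x := by
    rcases hx.eq_or_lt with rfl | h'
    · simp at h; linarith
    · exact h'
  exact (Real.le_log_iff_exp_le hx0).1 h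

/-- An upper bound for the growth of a Poincaré function. -/
lemma poincare_growth {p : Polynomial ℂ} {f : ℂ → ℂ} (hf : Continuous f) {lam : ℂ}
    (hl : 1 < ‖lam‖) (hfe : ∀ z : ℂ, f (lam * z) = p.eval (f z)) (r : ℝ) :
    ∃ B : ℝ, 2 ≤ B ∧ ∃ D : ℕ, 1 ≤ D ∧ ∀ n z, ‖z‖ ≤ ‖lam‖ ^ n * r → ‖f z‖ ≤ B ^ D ^ n := by
  have hl0 : lam ≠ 0 := by rintro rfl; simp at hl; linarith
  obtain ⟨B₁, hB₁⟩ := isBounded_iff_forall_norm_le.1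
    ((isCompact_closedBall (0 : ℂ) r).image hf).isBounded
  set S : ℝ := ∑ i ∈ Finset.range (p.natDegree + 1), ‖p.coeff i‖ with hS
  have hS0 : 0 ≤ S := Finset.sum_nonneg fun _ _ => norm_nonneg _
  set B := max 2 (max B₁ S) with hB
  have hB2 : 2 ≤ B := le_max_left _ _
  have hBS : S ≤ B := (le_max_right _ _).trans (le_max_right _ _)
  have hp : ∀ w x, B ≤ x → ‖w‖ ≤ x → ‖p.eval w‖ ≤ x ^ (p.natDegree + 1) := by
    intro w x hx hw
    rw [Polynomial.eval_eq_sum_range, pow_succ']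
    calc ‖∑ i ∈ Finset.range (p.natDegree + 1), p.coeff i * w ^ i‖
        ≤ ∑ i ∈ Finset.range (p.natDegree + 1), ‖p.coeff i‖ * x ^ p.natDegree := by
          refine (norm_sum_le _ _).trans (Finset.sum_le_sum fun i hi => ?_)
          rw [norm_mul, norm_pow]
          gcongr
          calc ‖w‖ ^ i ≤ x ^ i := by gcongr
            _ ≤ x ^ p.natDegree := pow_le_pow_right₀ (by linarith)
                (by have := Finset.mem_range.1 hi; omega)
      _ = S * x ^ p.natDegree := by rw [Finset.sum_mul]
      _ ≤ _ := by
        have : S ≤ x := by linarith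
        have : 0 ≤ x := by linarith
        gcongr
  refine ⟨B, hB2, p.natDegree + 1, by omega, fun n => ?_⟩
  induction n with
  | zero =>
    intro z hz
    have : ‖f z‖ ≤ B₁ := hB₁ _ ⟨z, by simpa using hz, rfl⟩
    rw [pow_zero, pow_one]
    exact this.trans ((le_max_left _ _).trans (le_max_right _ _))
  | succ n ih =>
    intro z hz
    have h1 : ‖lam⁻¹ * z‖ ≤ ‖lam‖ ^ n * r := by
      rw [norm_mul, norm_inv, inv_mul_le_iff₀ (by linarith)]
      rw [pow_succ'] at hz; linarith
    have h2 := ih _ h1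
    have h3 : f z = p.eval (f (lam⁻¹ * z)) := by rw [← hfe, mul_inv_cancel_left₀ hl0]
    rw [h3, pow_succ, pow_mul]
    refine hp _ _ ?_ h2
    exact le_self_pow₀ (by linarith) (by positivity)

/-- Points whose orbit grows rapidly are fast escaping. -/
lemma mem_fastEscapingSet {f : ℂ → ℂ} (hf : TranscendentalEntire f) {ρ r B : ℝ} (hρ : 1 < ρ)
    (hr : 0 < r) (hB : 2 ≤ B) {D : ℕ} (hD : 1 ≤ D)
    (hup : ∀ n z, ‖z‖ ≤ ρ ^ n * r → ‖f z‖ ≤ B ^ D ^ n) {m₁ : ℕ} {z : ℂ}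
    (hlow : ∀ k m, m₁ ≤ m → f^[k] z ∈ ann ρ r m →
      Real.log 2 * (6 / 5) ^ m ≤ Real.log ‖f^[k + 1] z‖)
    (hesc : Tendsto (fun n => ‖f^[n] z‖) atTop atTop) : z ∈ fastEscapingSet f := by
  obtain ⟨R₀, hR₀, hM⟩ := hf.exists_lt_maxMod
  have hD0 : (0 : ℝ) < D := by exact_mod_cast hD
  obtain ⟨q, hq⟩ := pow_unbounded_of_one_lt (2 * D : ℝ) (by norm_num : (1 : ℝ) < 6 / 5)
  have hlog2 : 0 < Real.log 2 := Real.log_pos (by norm_num)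
  have hlogB : 0 < Real.log B := Real.log_pos (by linarith)
  obtain ⟨n₁, hn₁⟩ := pow_unbounded_of_one_lt (r / r ^ (q + 1)) hρ
  obtain ⟨n₂, hn₂⟩ := pow_unbounded_of_one_lt ((q + 1) * D * Real.log B / Real.log 2)
    (by norm_num : (1 : ℝ) < 2)
  have hq0 : 1 ≤ q := by
    rcases Nat.eq_zero_or_pos q with rfl | h
    · have : (1 : ℝ) ≤ D := by exact_mod_cast hD
      rw [pow_zero] at hq; linarith
    · exact h
  set n₀ := n₁ + n₂ + m₁ with hn₀
  set R := max (max 1 R₀) (ρ ^ n₀ * r) with hR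
  have hR1 : 1 ≤ R := (le_max_left _ _).trans (le_max_left _ _)
  have hRR : R₀ ≤ R := (le_max_right _ _).trans (le_max_left _ _)
  have step : ∀ x k, R ≤ x → x ^ (q + 1) ≤ ‖f^[k] z‖ → (maxMod f x) ^ (q + 1) ≤ ‖f^[k + 1] z‖ := by
    intro x k hx hk
    have hx0 : 0 < x := by linarith
    have hM0 : 0 < maxMod f x := hx0.trans (hM x (hRR.trans hx))
    have hx1 : 1 ≤ x / (ρ ^ n₀ * r) := by
      rw [one_le_div (by positivity)]; exact (le_max_right _ _).trans hx
    obtain ⟨i, hi1, hi2⟩ := exists_nat_pow_near hx1 hρ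
    set n := n₀ + i with hn
    rw [le_div_iff₀ (by positivity)] at hi1
    rw [div_lt_iff₀ (by positivity)] at hi2
    have hn1 : ρ ^ n * r ≤ x := by rw [hn, pow_add]; linarith
    have hn2 : x ≤ ρ ^ (n + 1) * r := by
      rw [hn, show n₀ + i + 1 = (i + 1) + n₀ by ring, pow_add]; linarith
    have hMx : maxMod f x ≤ B ^ D ^ (n + 1) :=
      maxMod_le hx0.le fun w hw => hup _ _ (hw ▸ hn2)
    have hz : ρ ^ (n * q) * r ≤ ‖f^[k] z‖ := by
      refine le_trans ?_ hk
      have h1 : r ≤ ρ ^ n * r ^ (q + 1) := by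
        rw [div_lt_iff₀ (by positivity)] at hn₁
        refine hn₁.le.trans ?_
        have : ρ ^ n₁ ≤ ρ ^ n := pow_le_pow_right₀ hρ.le (by omega)
        gcongr
      calc ρ ^ (n * q) * r ≤ ρ ^ (n * q) * (ρ ^ n * r ^ (q + 1)) := by gcongr
        _ = (ρ ^ n * r) ^ (q + 1) := by rw [mul_pow, ← pow_mul, mul_add, mul_one, pow_add]; ring
        _ ≤ _ := by gcongr
    obtain ⟨j, hj⟩ := exists_mem_ann hρ hr (m := n * q) (z := f^[k] z) hz
    have hnq : m₁ ≤ n * q + j := by nlinarith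
    have h2 := hlow k _ hnq hj
    have h3 : (2 * D : ℝ) ^ n ≤ (6 / 5) ^ (n * q + j) := by
      calc (2 * D : ℝ) ^ n ≤ ((6 / 5) ^ q) ^ n := by gcongr
        _ = (6 / 5) ^ (n * q) := by rw [← pow_mul, mul_comm]
        _ ≤ _ := pow_le_pow_right₀ (by norm_num) (by omega)
    have h4 : Real.log B * D ^ (n + 1) * (q + 1) ≤ Real.log ‖f^[k + 1] z‖ := by
      have h5 : (q + 1) * D * Real.log B ≤ 2 ^ n * Real.log 2 := by
        rw [div_lt_iff₀ hlog2] at hn₂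
        refine hn₂.le.trans ?_
        have : (2 : ℝ) ^ n₂ ≤ 2 ^ n := pow_le_pow_right₀ (by norm_num) (by omega)
        gcongr
      calc Real.log B * D ^ (n + 1) * (q + 1) = ((q + 1) * D * Real.log B) * D ^ n := by ring
        _ ≤ (2 ^ n * Real.log 2) * D ^ n := by gcongr
        _ = Real.log 2 * (2 * D) ^ n := by rw [mul_pow]; ring
        _ ≤ Real.log 2 * (6 / 5) ^ (n * q + j) := by gcongr
        _ ≤ _ := h2
    have h6 := le_norm_of_le_log (norm_nonneg _) (by positivity) h4
    refine le_trans ?_ h6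
    calc (maxMod f x) ^ (q + 1) ≤ (B ^ D ^ (n + 1)) ^ (q + 1) := by gcongr
      _ = _ := by
        rw [← pow_mul, ← Real.exp_log (show (0 : ℝ) < B by linarith), ← Real.exp_nat_mul,
          Real.log_exp]
        push_cast
        ring_nf
  obtain ⟨L, hL⟩ := (hesc.eventually_ge_atTop (R ^ (q + 1))).exists
  have main : ∀ j, R ≤ (maxMod f)^[j] R ∧ ((maxMod f)^[j] R) ^ (q + 1) ≤ ‖f^[L + j] z‖ := by
    intro j
    induction j with
    | zero => exact ⟨le_rfl, hL⟩
    | succ j ih =>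
      rw [Function.iterate_succ_apply']
      exact ⟨ih.1.trans (hM _ (hRR.trans ih.1)).le, step _ _ ih.1 ih.2⟩
  refine ⟨R, by linarith, fun x hx => hM x (hRR.trans hx), L, fun n hn => ?_⟩
  obtain ⟨h1, h2⟩ := main (n - L)
  rw [show L + (n - L) = n by omega] at h2
  exact (le_self_pow₀ (hR1.trans h1) (by omega)).trans h2

/-- If the derivative at most doubles on a disc, the image contains a disc of definite size. -/
lemma ball_subset_image_of_deriv_le {h : ℂ → ℂ} {w₀ : ℂ} {t : ℝ} (ht : 0 < t)
    (hh : DifferentiableOn ℂ h (ball w₀ t)) (h0 : deriv h w₀ ≠ 0)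
    (hle : ∀ w ∈ ball w₀ t, ‖deriv h w‖ ≤ 2 * ‖deriv h w₀‖) :
    ball (h w₀) (‖deriv h w₀‖ * t / 24) ⊆ h '' ball w₀ t := by
  set A := ‖deriv h w₀‖ with hA
  have hA0 : 0 < A := norm_pos_iff.2 h0
  have hd' : DifferentiableOn ℂ (deriv h) (ball w₀ t) := hh.deriv isOpen_ball
  have hmaps : MapsTo (deriv h) (ball w₀ t) (closedBall (deriv h w₀) (3 * A)) := fun w hw => by
    rw [mem_closedBall, dist_eq_norm]
    have := norm_sub_le (deriv h w) (deriv h w₀)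
    have := hle w hw
    linarith
  have hsch : ∀ w ∈ ball w₀ t, ‖deriv h w - deriv h w₀‖ ≤ 3 * A / t * ‖w - w₀‖ := fun w hw => by
    simpa [dist_eq_norm] using Complex.dist_le_div_mul_dist_of_mapsTo_ball hd' hmaps hw
  have hsub : closedBall w₀ (t / 6) ⊆ ball w₀ t := closedBall_subset_ball (by linarith)
  have hdiff : ∀ w ∈ closedBall w₀ (t / 6), DifferentiableAt ℂ h w := fun w hw =>
    hh.differentiableAt (isOpen_ball.mem_nhds (hsub hw))
  have hmv : ∀ w ∈ closedBall w₀ (t / 6),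
      ‖h w - h w₀ - deriv h w₀ * (w - w₀)‖ ≤ A / 2 * ‖w - w₀‖ := by
    intro w hw
    have key := (convex_closedBall w₀ (t / 6)).norm_image_sub_le_of_norm_hasDerivWithin_le
      (f := fun w => h w - deriv h w₀ * w) (f' := fun w => deriv h w - deriv h w₀) (C := A / 2)
      (fun x hx => ?_) (fun x hx => ?_) (mem_closedBall_self (by linarith)) hw
    · refine le_trans (le_of_eq ?_) key
      congr 1; ring
    · have h1 := (hdiff x hx).hasDerivAt.sub ((hasDerivAt_id x).const_mul (deriv h w₀))
      rw [mul_one] at h1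
      exact h1.hasDerivWithinAt
    · refine (hsch x (hsub hx)).trans ?_
      have h2 : ‖x - w₀‖ ≤ t / 6 := by simpa [dist_eq_norm] using hx
      calc 3 * A / t * ‖x - w₀‖ ≤ 3 * A / t * (t / 6) := by gcongr
        _ = A / 2 := by field_simp; norm_num
  have hcl : DiffContOnCl ℂ h (ball w₀ (t / 6)) := by
    refine DifferentiableOn.diffContOnCl ?_
    rw [closure_ball _ (by positivity)]
    exact hh.mono hsub
  have hsph : ∀ w ∈ sphere w₀ (t / 6), A * t / 12 ≤ ‖h w - h w₀‖ := by
    intro w hw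
    have h1 := hmv w (sphere_subset_closedBall hw)
    have h2 : ‖w - w₀‖ = t / 6 := by simpa [dist_eq_norm] using hw
    have h3 : ‖deriv h w₀ * (w - w₀)‖ - ‖h w - h w₀‖ ≤ ‖h w - h w₀ - deriv h w₀ * (w - w₀)‖ := by
      rw [norm_sub_rev (h w - h w₀)]; exact norm_sub_norm_le _ _
    rw [norm_mul, h2, ← hA] at h3
    rw [h2] at h1
    linarith
  have hfreq : ∃ᶠ w in 𝓝 w₀, h w ≠ h w₀ := by
    have := (hdiff w₀ (mem_closedBall_self (by linarith))).hasDerivAt.eventually_ne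
      (c := h w₀) h0
    exact this.frequently.filter_mono nhdsWithin_le_nhds
  have key := hcl.ball_subset_image_closedBall (by positivity) hsph hfreq
  rw [show A * t / 12 / 2 = A * t / 24 by ring] at key
  exact key.trans (image_mono hsub)

/-- A weak form of the theorem of Bloch. -/
lemma bloch {h : ℂ → ℂ} {z : ℂ} {r' r : ℝ} (hr : 0 < r) (hrr : r < r')
    (hh : DifferentiableOn ℂ h (ball z r')) {T : ℝ}
    (hT : ∀ c, ∃ v ∈ ball c T, v ∉ h '' ball z r) : r * ‖deriv h z‖ ≤ 48 * T := by
  have hT0 : 0 < T := by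
    obtain ⟨v, hv, -⟩ := hT 0
    exact pos_of_mem_ball hv
  by_contra! hc
  have hsub : closedBall z r ⊆ ball z r' := closedBall_subset_ball hrr
  have hcont : ContinuousOn (fun w => (r - dist w z) * ‖deriv h w‖) (closedBall z r) :=
    (by fun_prop : Continuous fun w => r - dist w z).continuousOn.mul
      ((hh.deriv isOpen_ball).continuousOn.mono hsub).norm
  obtain ⟨w₀, hw₀, hmax⟩ := (isCompact_closedBall z r).exists_isMaxOn
    ⟨z, mem_closedBall_self hr.le⟩ hcont
  have hM := hmax (mem_closedBall_self hr.le)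
  simp only [mem_ofPred_eq, dist_self, sub_zero] at hM
  have hpos : 0 < (r - dist w₀ z) * ‖deriv h w₀‖ := by linarith
  have hd0 : dist w₀ z < r := by
    by_contra hcc
    have := mul_nonpos_of_nonpos_of_nonneg (by linarith : r - dist w₀ z ≤ 0)
      (norm_nonneg (deriv h w₀))
    linarith
  set t := (r - dist w₀ z) / 2 with ht
  have ht0 : 0 < t := by rw [ht]; linarith
  have htsub : ball w₀ t ⊆ ball z r := ball_subset_ball' (by rw [ht]; linarith)
  have h0 : deriv h w₀ ≠ 0 := by
    intro h'; rw [h', norm_zero, mul_zero] at hpos; exact lt_irrefl _ hpos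
  have hle : ∀ w ∈ ball w₀ t, ‖deriv h w‖ ≤ 2 * ‖deriv h w₀‖ := by
    intro w hw
    have h1 : (r - dist w z) * ‖deriv h w‖ ≤ (r - dist w₀ z) * ‖deriv h w₀‖ :=
      hmax (ball_subset_closedBall (htsub hw))
    have h2 : t ≤ r - dist w z := by
      have := dist_triangle w w₀ z
      have := mem_ball.1 hw
      rw [ht] at *; linarith
    have h3 : t * ‖deriv h w‖ ≤ t * (2 * ‖deriv h w₀‖) := by
      calc t * ‖deriv h w‖ ≤ (r - dist w z) * ‖deriv h w‖ := by gcongr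
        _ ≤ _ := h1
        _ = _ := by rw [ht]; ring
    exact le_of_mul_le_mul_left h3 ht0
  have key := ball_subset_image_of_deriv_le ht0
    (hh.mono (htsub.trans (ball_subset_closedBall.trans hsub))) h0 hle
  obtain ⟨v, hv, hv'⟩ := hT (h w₀)
  refine hv' (image_mono htsub (key ?_))
  refine ball_subset_ball ?_ hv
  rw [ht]; nlinarith

/-- A uniform version of escape at points of normality. -/
lemma SphLocUnifConvOn.exists_ball_lt {F : ℕ → ℂ → ℂ} {g : ℂ → Option ℂ} {U : Set ℂ}
    (h : SphLocUnifConvOn F g U) {z : ℂ} (hU : U ∈ 𝓝 z) (hF : ∀ n, Continuous (F n))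
    (hz : Tendsto (fun n => ‖F n z‖) atTop atTop) {S : ℝ} (hS : 0 ≤ S) :
    ∃ r, 0 < r ∧ ∀ᶠ n in atTop, ∀ w ∈ ball z r, S < ‖F n w‖ := by
  obtain ⟨r₁, hr₁, hsub⟩ := nhds_basis_closedBall.mem_iff.1 hU
  set S₁ := 2 * S + 1 with hS₁
  have hS₁0 : 0 ≤ S₁ := by positivity
  have hev := h (closedBall z r₁) hsub (isCompact_closedBall _ _) (1 / (1 + S₁)) (by positivity)
  obtain ⟨n₀, hn₀, hbig⟩ := (hev.and (hz.eventually_gt_atTop (2 * S₁ + 1))).exists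
  obtain ⟨r₂, hr₂, hr₂'⟩ := Metric.eventually_nhds_iff_ball.1
    ((hF n₀).norm.continuousAt.eventually_const_lt hbig)
  refine ⟨min r₁ r₂, lt_min hr₁ hr₂, ?_⟩
  filter_upwards [hev] with n hn w hw
  have hwK : w ∈ closedBall z r₁ :=
    ball_subset_closedBall (ball_subset_ball (min_le_left _ _) hw)
  have h1 := hn₀ w hwK
  have h2 := hn w hwK
  have h3 := hr₂' w (ball_subset_ball (min_le_right _ _) hw)
  have hSS : 1 / (1 + S₁) ≤ 1 / (1 + S) := by
    apply one_div_le_one_div_of_le <;> linarith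
  by_contra! hc
  rcases hg : g w with _ | b
  · rw [hg] at h2
    linarith [chordalDist_none_ge hS hc]
  · rw [hg] at h1 h2
    rcases le_or_gt ‖b‖ S₁ with hb | hb
    · linarith [chordalDist_some_ge hS₁0 hb h3.le]
    · rw [chordalDist_comm] at h2
      linarith [chordalDist_some_ge hS hc hb.le]

/-- Logarithms of a bi-infinite geometric progression are coarsely dense. -/
lemma exists_exp_eq_zpow_mul {lam b : ℂ} (hl : 1 < ‖lam‖) (hb : b ≠ 0) (c : ℂ) :
    ∃ v ∈ ball c (‖Complex.log lam‖ + 2 * Real.pi + 1), ∃ m : ℤ, Complex.exp v = lam ^ m * b := by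
  have hl0 : lam ≠ 0 := by rintro rfl; simp at hl; linarith
  have hL : 0 < (Complex.log lam).re := by rw [Complex.log_re]; exact Real.log_pos hl
  set L := Complex.log lam with hLdef
  set s := Complex.log b with hs
  set x := (c - s).re / L.re with hx
  set m := ⌊x⌋ with hm
  set y := (c - s - x * L).im / (2 * Real.pi) with hy
  set j := ⌊y⌋ with hj
  refine ⟨s + m * L + j * (2 * Real.pi * Complex.I), ?_, m, ?_⟩
  · have hpi := Real.pi_pos
    have e1 : c - s - x * L = ((2 * Real.pi * y : ℝ) : ℂ) * Complex.I := by
      apply Complex.ext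
      · have : (c - s - x * L).re = 0 := by
          simp only [Complex.sub_re, Complex.mul_re, Complex.ofReal_re, Complex.ofReal_im, zero_mul,
            sub_zero]
          rw [hx, Complex.sub_re]; field_simp; ring
        rw [this]; simp
      · have : (c - s - x * L).im = 2 * Real.pi * y := by rw [hy]; field_simp
        rw [this]; simp
    have e2 : s + m * L + j * (2 * Real.pi * Complex.I) - c =
        -(((Int.fract x : ℝ) : ℂ) * L) - ((2 * Real.pi * Int.fract y : ℝ) : ℂ) * Complex.I := by
      have : c = s + x * L + ((2 * Real.pi * y : ℝ) : ℂ) * Complex.I := by rw [← e1]; ring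
      rw [this, Int.fract, Int.fract]
      push_cast
      ring
    rw [mem_ball, dist_eq_norm, e2]
    calc ‖-(((Int.fract x : ℝ) : ℂ) * L) - ((2 * Real.pi * Int.fract y : ℝ) : ℂ) * Complex.I‖
        ≤ ‖((Int.fract x : ℝ) : ℂ) * L‖ + ‖((2 * Real.pi * Int.fract y : ℝ) : ℂ) * Complex.I‖ := by
          refine (norm_sub_le _ _).trans ?_
          rw [norm_neg]
      _ = Int.fract x * ‖L‖ + 2 * Real.pi * Int.fract y := by
          rw [norm_mul, norm_mul, Complex.norm_I, Complex.norm_real, Complex.norm_real,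
            Real.norm_of_nonneg (Int.fract_nonneg x), Real.norm_of_nonneg, mul_one]
          have := Int.fract_nonneg y
          positivity
      _ < _ := by
          have h1 := (Int.fract_lt_one x).le
          have h2 := (Int.fract_lt_one y).le
          have h3 : Int.fract x * ‖L‖ ≤ 1 * ‖L‖ := by gcongr
          have h4 : 2 * Real.pi * Int.fract y ≤ 2 * Real.pi * 1 := by gcongr
          linarith
  · rw [Complex.exp_add, Complex.exp_add, Complex.exp_int_mul_two_pi_mul_I, mul_one,
      Complex.exp_int_mul, hLdef, Complex.exp_log hl0, hs, Complex.exp_log hb, mul_comm]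

/-- A derivative bound for functions omitting zero and a geometric progression. -/
lemma norm_deriv_le_of_omits {F : ℂ → ℂ} {lam a₀ : ℂ} (hl : 1 < ‖lam‖) (ha : a₀ ≠ 0)
    {z : ℂ} {r r' : ℝ} (hr : 0 < r) (hrr : r < r') (hF : DifferentiableOn ℂ F (ball z r'))
    (h0 : ∀ w ∈ ball z r', F w ≠ 0) (hom : ∀ w ∈ ball z r', ∀ m : ℤ, F w ≠ lam ^ m * a₀) :
    r * (‖deriv F z‖ / ‖F z‖) ≤ 48 * (‖Complex.log lam‖ + 2 * Real.pi + 1) := by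
  have hz : z ∈ ball z r' := mem_ball_self (hr.trans hrr)
  obtain ⟨h, hh⟩ := ((hF.deriv isOpen_ball).div hF h0).isExactOn_ball
  have hdh : ∀ w ∈ ball z r', HasDerivAt h (deriv F w / F w) w := hh
  have hdF : ∀ w ∈ ball z r', HasDerivAt F (deriv F w) w := fun w hw =>
    (hF.differentiableAt (isOpen_ball.mem_nhds hw)).hasDerivAt
  set k := F z * Complex.exp (-h z) with hk
  have hk0 : k ≠ 0 := mul_ne_zero (h0 z hz) (Complex.exp_ne_zero _)
  have hconst : ∀ w ∈ ball z r', F w * Complex.exp (-h w) = k := by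
    intro w hw
    have hd : ∀ w ∈ ball z r', HasDerivAt (fun w => F w * Complex.exp (-h w)) 0 w := by
      intro w hw
      have h1 := (hdF w hw).mul (hdh w hw).neg.cexp
      refine h1.congr_deriv ?_
      have := h0 w hw
      field_simp
      ring
    have := isOpen_ball.is_const_of_deriv_eq_zero (convex_ball z r').isPreconnected
      (fun w hw => (hd w hw).differentiableAt.differentiableWithinAt)
      (fun w hw => (hd w hw).deriv) hw hz
    exact this
  have hFh : ∀ w ∈ ball z r', Complex.exp (h w) = F w / k := by
    intro w hw
    rw [← hconst w hw, Complex.exp_neg]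
    have := h0 w hw
    field_simp
  have key := bloch (h := h) hr hrr
    (fun w hw => (hdh w hw).differentiableAt.differentiableWithinAt)
    (T := ‖Complex.log lam‖ + 2 * Real.pi + 1) (fun c => by
      obtain ⟨v, hv, m, hm⟩ := exists_exp_eq_zpow_mul hl (div_ne_zero ha hk0) c
      refine ⟨v, hv, ?_⟩
      rintro ⟨w, hw, rfl⟩
      have hw' := ball_subset_ball hrr.le hw
      rw [hFh w hw', ← mul_div_assoc] at hm
      exact hom w hw' m ((div_left_inj' hk0).1 hm))
  rwa [(hdh z hz).deriv, norm_div] at key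

/-- Points of normality cannot escape with fast growing derivative. -/
lemma mem_juliaSet_of_expanding {f : ℂ → ℂ} (hf : Differentiable ℂ f) {lam a₀ : ℂ}
    (hl : 1 < ‖lam‖) (ha : a₀ ≠ 0) {S : ℝ} (hS : 0 ≤ S) (hK : ∀ m : ℤ, ‖f (lam ^ m * a₀)‖ ≤ S)
    {z : ℂ} (hz : Tendsto (fun n => ‖f^[n] z‖) atTop atTop)
    (hder : ∀ n, 2 * ‖f^[n + 1] z‖ ≤ ‖f^[n] z‖ * ‖deriv f (f^[n] z)‖)
    (hz0 : ∀ n, f^[n] z ≠ 0) : z ∈ juliaSet f := by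
  rintro ⟨U, hU, hn⟩
  have hcont : ∀ n, Continuous (f^[n]) := fun n => hf.continuous.iterate n
  obtain ⟨ψ, hψ, g, hg⟩ := hn id strictMono_id
  obtain ⟨ψ', hψ', g', hg'⟩ := hn (fun n => ψ n + 1) fun a b hab => by
    have := hψ hab
    simpa using this
  obtain ⟨r₁, hr₁, h1⟩ := hg.exists_ball_lt hU (fun n => hcont _)
    (hz.comp hψ.tendsto_atTop) hS
  obtain ⟨r₂, hr₂, h2⟩ := hg'.exists_ball_lt hU (fun n => hcont _)
    (hz.comp (tendsto_atTop_mono (fun n => Nat.le_succ_of_le (hψ.le_apply))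
      hψ'.tendsto_atTop : Tendsto (fun n => ψ (ψ' n) + 1) atTop atTop)) hS
  set r' := min r₁ r₂ with hr'
  have hr'0 : 0 < r' := lt_min hr₁ hr₂
  set r := r' / 2 with hr
  have hr0 : 0 < r := by positivity
  have hexp : ∀ n, 2 ^ n * ‖f^[n] z‖ ≤ ‖z‖ * ‖deriv (f^[n]) z‖ := by
    intro n
    induction n with
    | zero => simp
    | succ n ih =>
      have hd : deriv (f^[n + 1]) z = deriv f (f^[n] z) * deriv (f^[n]) z := by
        rw [Function.iterate_succ']
        exact deriv_comp z (hf _) ((hf.iterate n) z)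
      rw [hd, norm_mul]
      have h0 : 0 < ‖f^[n] z‖ := norm_pos_iff.2 (hz0 n)
      have h3 : ‖f^[n] z‖ * (2 ^ (n + 1) * ‖f^[n + 1] z‖) ≤
          ‖f^[n] z‖ * (‖z‖ * (‖deriv f (f^[n] z)‖ * ‖deriv (f^[n]) z‖)) := by
        calc ‖f^[n] z‖ * (2 ^ (n + 1) * ‖f^[n + 1] z‖)
            = (2 ^ n * ‖f^[n] z‖) * (2 * ‖f^[n + 1] z‖) := by ring
          _ ≤ (‖z‖ * ‖deriv (f^[n]) z‖) * (‖f^[n] z‖ * ‖deriv f (f^[n] z)‖) := by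
            have := hder n
            gcongr
          _ = _ := by ring
      exact le_of_mul_le_mul_left h3 h0
  set T := 48 * (‖Complex.log lam‖ + 2 * Real.pi + 1) with hT
  have hzpos : 0 < ‖z‖ := norm_pos_iff.2 (hz0 0)
  have hlim : Tendsto (fun n => (2 : ℝ) ^ ψ (ψ' n)) atTop atTop :=
    (tendsto_pow_atTop_atTop_of_one_lt (by norm_num)).comp
      (hψ.tendsto_atTop.comp hψ'.tendsto_atTop)
  obtain ⟨n, h1n, h2n, h3n⟩ := ((hψ'.tendsto_atTop.eventually h1).and
    (h2.and (hlim.eventually_gt_atTop (T * ‖z‖ / r)))).exists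
  set N := ψ (ψ' n) with hN
  have key := norm_deriv_le_of_omits (F := f^[N]) hl ha hr0 (show r < r' by rw [hr]; linarith)
    (hf.iterate N).differentiableOn
    (fun w hw h0 => by
      have := h1n w (ball_subset_ball (min_le_left _ _) hw)
      simp only [id] at this
      rw [h0, norm_zero] at this
      linarith)
    (fun w hw m h0 => by
      have := h2n w (ball_subset_ball (min_le_right _ _) hw)
      rw [Function.iterate_succ_apply', h0] at this
      linarith [hK m])
  have h4 := hexp N
  have h5 : 0 < ‖f^[N] z‖ := norm_pos_iff.2 (hz0 N)
  rw [div_lt_iff₀ hr0] at h3n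
  have h6 : 2 ^ N ≤ ‖z‖ * (‖deriv (f^[N]) z‖ / ‖f^[N] z‖) := by
    rw [← mul_div_assoc, le_div_iff₀ h5]; exact h4
  have h7 : (2 : ℝ) ^ N * r ≤ ‖z‖ * T := by
    calc (2 : ℝ) ^ N * r ≤ ‖z‖ * (‖deriv (f^[N]) z‖ / ‖f^[N] z‖) * r := by gcongr
      _ = ‖z‖ * (r * (‖deriv (f^[N]) z‖ / ‖f^[N] z‖)) := by ring
      _ ≤ _ := by gcongr
  linarith

/-- A repelling fixed point of a polynomial of degree at least two has a further preimage. -/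
lemma exists_preimage_ne {p : Polynomial ℂ} (hd : 2 ≤ p.natDegree) {z₀ lam : ℂ}
    (hfix : p.eval z₀ = z₀) (hlam : deriv (fun w => p.eval w) z₀ = lam) (hl0 : lam ≠ 0) :
    ∃ y, y ≠ z₀ ∧ p.eval y = z₀ := by
  obtain ⟨P₁, hP₁⟩ : Polynomial.X - Polynomial.C z₀ ∣ p - Polynomial.C z₀ := by
    rw [Polynomial.dvd_iff_isRoot]; simp [hfix]
  have hP : ∀ w, p.eval w - z₀ = (w - z₀) * P₁.eval w := fun w => by
    have := congrArg (Polynomial.eval w) hP₁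
    simpa using this
  have hP0 : P₁.eval z₀ = lam := by
    have h1 : p.derivative = P₁ + (Polynomial.X - Polynomial.C z₀) * P₁.derivative := by
      have := congrArg Polynomial.derivative hP₁
      simpa [Polynomial.derivative_mul] using this
    rw [Polynomial.deriv, h1] at hlam
    simpa using hlam
  have hP10 : P₁ ≠ 0 := by rintro rfl; simp at hP0; exact hl0 hP0.symm
  have hdeg : P₁.natDegree + 1 = p.natDegree := by
    have := congrArg Polynomial.natDegree hP₁
    rw [Polynomial.natDegree_sub_C, Polynomial.natDegree_mul (Polynomial.X_sub_C_ne_zero z₀) hP10,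
      Polynomial.natDegree_X_sub_C] at this
    omega
  obtain ⟨y, hy⟩ := IsAlgClosed.exists_root P₁ (by
    intro h; rw [Polynomial.degree_eq_natDegree hP10] at h
    have : P₁.natDegree = 0 := by exact_mod_cast h
    omega)
  refine ⟨y, ?_, ?_⟩
  · rintro rfl
    exact hl0 (hP0.symm.trans hy)
  · have := hP y
    rw [hy.eq_zero, mul_zero, sub_eq_zero] at this
    exact this

lemma EscR.mem_filled_of_fixed {p : Polynomial ℂ} {R : ℝ} (h : EscR p R) {z₀ : ℂ}
    (hfix : p.eval z₀ = z₀) : z₀ ∈ filled p R := by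
  intro n
  have h1 : (it p n).eval z₀ = z₀ := by
    rw [eval_it]; exact Function.iterate_fixed hfix n
  rw [h1]
  by_contra! hc
  have h2 := (h.2 z₀ hc).1
  rw [hfix] at h2
  have := h.1
  linarith

/-- A repelling fixed point is not isolated in the filled Julia set. -/
lemma EscR.exists_near_fixed {p : Polynomial ℂ} (hd : 2 ≤ p.natDegree) {R : ℝ} (h : EscR p R)
    {z₀ lam : ℂ} (hfix : p.eval z₀ = z₀) (hlam : deriv (fun w => p.eval w) z₀ = lam)
    (hl0 : lam ≠ 0) {s : ℝ} (hs : 0 < s) : ∃ x ∈ filled p R, x ≠ z₀ ∧ ‖x - z₀‖ < s := by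
  have hp : 1 ≤ p.natDegree := by omega
  by_contra! hc
  obtain ⟨y, hy0, hy⟩ := exists_preimage_ne hd hfix hlam hl0
  have hz₀ := h.mem_filled_of_fixed hfix
  have hyK : y ∈ filled p R := by
    rw [← h.mem_filled_iff 1, eval_it_one, hy]; exact hz₀
  have hfixn : ∀ n, (it p n).eval z₀ = z₀ := fun n => by
    rw [eval_it]; exact Function.iterate_fixed hfix n
  set U := ball z₀ (s / 2)
  set U' := (closedBall z₀ (s / 2))ᶜ
  have hcov : filled p R ⊆ U ∪ U' := by
    intro x hx
    by_cases hxz : x = z₀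
    · left; rw [hxz]; exact mem_ball_self (by linarith)
    · right
      have := hc x hx hxz
      simp only [U', mem_compl_iff, mem_closedBall, dist_eq_norm]
      linarith
  obtain ⟨n, hn⟩ := h.exists_sublevel_subset
    (isOpen_ball.union isClosed_closedBall.isOpen_compl) hcov
  have hzR : ‖(it p n).eval z₀ - 0‖ < R := by rw [sub_zero]; exact hz₀ n
  obtain ⟨x, hxV, hxy⟩ := image_pcomp (one_le_natDegree_it hp n) hzR (filled_subset_ball p R hyK)
  have hxy : (it p n).eval x = y := hxy
  have hxK : x ∈ filled p R := by rw [← h.mem_filled_iff n, hxy]; exact hyK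
  have hxz : x ≠ z₀ := by rintro rfl; exact hy0 (by rw [← hxy, hfixn])
  have hxs := hc x hxK hxz
  have hsub : pcomp (it p n) 0 R z₀ ⊆ U ∪ U' := fun w hw => hn (by
    have := norm_lt_of_mem_pcomp hw
    rw [sub_zero] at this
    exact this.le)
  obtain ⟨w, -, hw1, hw2⟩ := isPreconnected_pcomp (it p n) 0 R z₀ U U' isOpen_ball
    isClosed_closedBall.isOpen_compl hsub ⟨z₀, self_mem_pcomp hzR, mem_ball_self (by linarith)⟩
    ⟨x, hxV, by
      simp only [U', mem_compl_iff, mem_closedBall, dist_eq_norm]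
      linarith⟩
  exact hw2 (ball_subset_closedBall hw1)

/-- The Poincaré function is bounded on the orbit of some nonzero point under the multiplier. -/
lemma EscR.exists_bounded_orbit {p : Polynomial ℂ} (hd : 2 ≤ p.natDegree) {R : ℝ} (h : EscR p R)
    {z₀ lam : ℂ} (hfix : p.eval z₀ = z₀) (hlam : deriv (fun w => p.eval w) z₀ = lam)
    (hl0 : lam ≠ 0) {f : ℂ → ℂ} (hf : Differentiable ℂ f) (hf0 : f 0 = z₀)
    (hder : deriv f 0 ≠ 0) (hfe : ∀ z : ℂ, f (lam * z) = p.eval (f z)) :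
    ∃ a₀, a₀ ≠ 0 ∧ ∀ m : ℤ, ‖f (lam ^ m * a₀)‖ ≤ R := by
  have hmap : map f (𝓝 0) = 𝓝 (f 0) :=
    (hf.contDiff.contDiffAt (n := 1)).hasStrictDerivAt one_ne_zero |>.map_nhds_eq hder
  have hr : range f ∈ 𝓝 z₀ := by
    rw [← hf0, ← hmap]; exact range_mem_map
  obtain ⟨s, hs, hsr⟩ := Metric.mem_nhds_iff.1 hr
  obtain ⟨x, hxK, hxz, hxs⟩ := h.exists_near_fixed hd hfix hlam hl0 hs
  obtain ⟨a, ha⟩ := hsr (show x ∈ ball z₀ s by rwa [mem_ball, dist_eq_norm])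
  refine ⟨a, ?_, fun m => ?_⟩
  · rintro rfl; exact hxz (by rw [← ha, hf0])
  have hK : f (lam ^ m * a) ∈ filled p R := by
    obtain ⟨n, rfl | rfl⟩ := m.eq_nat_or_neg
    · rw [zpow_natCast, poincare_iterate hfe, h.mem_filled_iff, ha]; exact hxK
    · rw [← h.mem_filled_iff n, ← poincare_iterate hfe, zpow_neg, zpow_natCast, ← mul_assoc,
        mul_inv_cancel₀ (pow_ne_zero _ hl0), one_mul, ha]
      exact hxK
  have := hK 0
  rw [eval_it_zero] at this
  exact this.le

lemma logArea_union_le (A B : Set ℂ) : logArea (A ∪ B) ≤ logArea A + logArea B :=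
  lintegral_union_le _ _ _

lemma logArea_eq_zero {A : Set ℂ} (h : volume A = 0) : logArea A = 0 :=
  setLIntegral_measure_zero _ _ h

lemma logArea_pos_of_ball {a : ℂ} {s : ℝ} (hs : 0 < s) : 0 < logArea (ball a s) := by
  set M := ‖a‖ + s with hM
  have hM0 : 0 < M := by have := norm_nonneg a; linarith
  have h1 : ENNReal.ofReal ((M ^ 2)⁻¹) * volume (ball a s \ {0}) ≤ logArea (ball a s) := by
    refine le_trans ?_ (logArea_mono (sdiff_subset (t := {0})))
    unfold logArea
    rw [← setLIntegral_const]
    refine setLIntegral_mono' (measurableSet_ball.diff (measurableSet_singleton 0)) fun z hz =>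
      ENNReal.ofReal_le_ofReal ?_
    have hz0 : 0 < ‖z‖ := norm_pos_iff.2 hz.2
    have h2 : ‖z‖ ≤ M := by
      have h3 := hz.1
      rw [mem_ball, dist_eq_norm] at h3
      have := norm_le_norm_add_norm_sub a z
      rw [norm_sub_rev] at this
      linarith
    gcongr
  refine lt_of_lt_of_le ?_ h1
  rw [measure_sdiff_null (by simp)]
  exact ENNReal.mul_pos (by positivity) (measure_ball_pos _ _ hs).ne'

lemma logArea_Delta : logArea Delta = ∞ := by
  by_contra hfin
  have hm : MeasurableSet Delta := measurableSet_le measurable_const measurable_norm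
  have himg : (fun z : ℂ => 2 * z) '' Delta ⊆ Delta := by
    rintro _ ⟨z, hz, rfl⟩
    have : 1 ≤ ‖z‖ := hz
    change 1 ≤ ‖2 * z‖
    rw [norm_mul, Complex.norm_two]; linarith
  have hdisj : Disjoint ((fun z : ℂ => 2 * z) '' Delta) (ball (3 / 2) (1 / 2)) := by
    rw [Set.disjoint_left]
    rintro _ ⟨z, hz, rfl⟩ hb
    have h1 : 1 ≤ ‖z‖ := hz
    rw [mem_ball, dist_eq_norm] at hb
    have h2 := norm_le_norm_add_norm_sub (3 / 2 : ℂ) (2 * z)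
    rw [norm_sub_rev, norm_mul, Complex.norm_two] at h2
    have h3 : ‖(3 / 2 : ℂ)‖ = 3 / 2 := by norm_num
    linarith
  have hball : ball (3 / 2 : ℂ) (1 / 2) ⊆ Delta := by
    intro z hb
    rw [mem_ball, dist_eq_norm] at hb
    have h2 := norm_le_norm_add_norm_sub z (3 / 2 : ℂ)
    have h3 : ‖(3 / 2 : ℂ)‖ = 3 / 2 := by norm_num
    change 1 ≤ ‖z‖
    linarith
  have h1 : logArea ((fun z : ℂ => 2 * z) '' Delta) + logArea (ball (3 / 2) (1 / 2)) ≤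
      logArea Delta := by
    refine le_trans (le_of_eq ?_) (logArea_mono (union_subset himg hball))
    exact (lintegral_union measurableSet_ball hdisj).symm
  rw [logArea_image_mul two_ne_zero hm] at h1
  have h2 : logArea Delta + logArea (ball (3 / 2) (1 / 2)) ≤ logArea Delta + 0 := by
    rwa [add_zero]
  exact (logArea_pos_of_ball (by norm_num : (0 : ℝ) < 1 / 2)).not_ge
    ((ENNReal.add_le_add_iff_left hfin).1 h2)

lemma ext_anti {ρ r : ℝ} (hρ : 1 < ρ) (hr : 0 < r) {m n : ℕ} (h : m ≤ n) :
    ext ρ r n ⊆ ext ρ r m := fun z hz => by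
  have h1 : ρ ^ n * r ≤ ‖z‖ := hz
  change ρ ^ m * r ≤ ‖z‖
  refine le_trans ?_ h1
  have := hρ.le
  gcongr

lemma tendsto_norm_iterate {f : ℂ → ℂ} {ρ r : ℝ} (hρ : 1 < ρ) (hr : 0 < r) {A m₁ : ℕ}
    (hA : 2 ≤ A) (hm₁ : 1 ≤ m₁) {Bd : Set ℂ}
    (hgrow : ∀ m ≥ m₁, ∀ z ∈ ann ρ r m, z ∉ Bd → ρ ^ (A * m) * r ≤ ‖f z‖) {z : ℂ}
    (hz : z ∈ ext ρ r m₁) (hB : ∀ n, f^[n] z ∉ Bd) :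
    Tendsto (fun n => ‖f^[n] z‖) atTop atTop := by
  have h1 : ∀ n, f^[n] z ∈ ext ρ r (m₁ + n) := by
    intro n
    induction n with
    | zero => exact hz
    | succ n ih =>
      obtain ⟨i, hi⟩ := exists_mem_ann hρ hr ih
      have h2 := hgrow _ (by omega) _ hi (hB n)
      rw [← Function.iterate_succ_apply' f] at h2
      refine ext_anti hρ hr ?_ (show f^[n + 1] z ∈ ext ρ r (A * (m₁ + n + i)) from h2)
      nlinarith
  have h2 : Tendsto (fun n => ρ ^ n * r) atTop atTop :=
    (tendsto_pow_atTop_atTop_of_one_lt hρ).atTop_mul_const hr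
  exact tendsto_atTop_mono (fun n => ext_anti hρ hr (Nat.le_add_left n m₁) (h1 n)) h2

lemma eventually_pow_mul_le_exp {ρ r : ℝ} (hρ : 1 < ρ) (hr : 0 < r) (A : ℕ) :
    ∀ᶠ m : ℕ in atTop, ρ ^ (A * m) * r ≤ Real.exp (Real.log 2 * (6 / 5) ^ m) := by
  have h1 := tendsto_pow_const_div_const_pow_of_one_lt 1 (by norm_num : (1 : ℝ) < 6 / 5)
  set c := A * Real.log ρ + |Real.log r| with hc
  have hlρ := Real.log_pos hρ
  have hc0 : 0 ≤ c := by positivity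
  have h2 : Tendsto (fun m : ℕ => c * ((m : ℝ) ^ 1 / (6 / 5 : ℝ) ^ m)) atTop (𝓝 0) := by
    simpa using h1.const_mul c
  filter_upwards [h2.eventually_lt_const (Real.log_pos one_lt_two), eventually_ge_atTop 1]
    with m hm hm1
  have hm1 : (1 : ℝ) ≤ m := by exact_mod_cast hm1
  rw [pow_one, mul_div_assoc', div_lt_iff₀ (by positivity)] at hm
  have h3 : ρ ^ (A * m) * r = Real.exp ((A * m : ℕ) * Real.log ρ + Real.log r) := by
    rw [Real.exp_add, Real.exp_log hr, Real.exp_nat_mul, Real.exp_log (by linarith)]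
  rw [h3, Real.exp_le_exp]
  refine le_trans ?_ hm.le
  have h4 := le_abs_self (Real.log r)
  have h5 := abs_nonneg (Real.log r)
  push_cast
  rw [hc]
  nlinarith

lemma exists_nat_mul_pow_le {θ : ℝ} (hθ0 : 0 < θ) (hθ1 : θ < 1) (D : ℕ) :
    ∃ A : ℕ, 2 ≤ A ∧ D * θ ^ A ≤ θ ^ 2 := by
  have h : Tendsto (fun n : ℕ => (D : ℝ) * θ ^ n) atTop (𝓝 0) := by
    simpa using (_root_.tendsto_pow_atTop_nhds_zero_of_lt_one hθ0.le hθ1).const_mul (D : ℝ)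
  obtain ⟨A, h1, h2⟩ := ((h.eventually_lt_const (pow_pos hθ0 2)).and (eventually_ge_atTop 2)).exists
  exact ⟨A, h2, h1.le⟩

theorem poincare_function_semihyperbolic
    (p : Polynomial ℂ) (hd : 2 ≤ p.natDegree) (hsh : SemiHyperbolic p)
    (hattr : ¬ ∃ z : ℂ, ∃ k : ℕ, 1 ≤ k ∧ (fun w => p.eval w)^[k] z = z ∧
      ‖deriv ((fun w => p.eval w)^[k]) z‖ < 1)
    (z₀ lam : ℂ) (hfix : p.eval z₀ = z₀) (hlam : deriv (fun w => p.eval w) z₀ = lam)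
    (hlam1 : 1 < ‖lam‖)
    (f : ℂ → ℂ) (hf : TranscendentalEntire f) (hf0 : f 0 = z₀)
    (hfe : ∀ z : ℂ, f (lam * z) = p.eval (f z)) :
    logArea (Delta \ (fastEscapingSet f ∩ juliaSet f)) < ⊤ ∧
      0 < volume (fastEscapingSet f ∩ juliaSet f) := by
  suffices hmain : logArea (Delta \ (fastEscapingSet f ∩ juliaSet f)) < ⊤ by
    refine ⟨hmain, pos_iff_ne_zero.2 fun h0 => ?_⟩
    have h1 : logArea Delta ≤ logArea (Delta \ (fastEscapingSet f ∩ juliaSet f)) +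
        logArea (fastEscapingSet f ∩ juliaSet f) :=
      (logArea_mono (by rw [sdiff_union_self]; exact subset_union_left)).trans
        (logArea_union_le _ _)
    rw [logArea_Delta, logArea_eq_zero h0, add_zero] at h1
    exact hmain.not_ge h1
  have hp : 1 ≤ p.natDegree := by omega
  have hl0 : lam ≠ 0 := by rintro rfl; simp at hlam1; linarith
  have hfd : Differentiable ℂ f := hf.1
  have hder0 := poincare_deriv_zero_ne hfix hlam hlam1 hf hf0 hfe
  obtain ⟨r₀, hr₀, hinj₀, c, hc, hder₀⟩ := exists_univalent_disc hfd hder0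
  set r := r₀ / (2 * ‖lam‖) with hr_def
  have hr : 0 < r := by positivity
  have hann : ann ‖lam‖ r 0 ⊆ ball 0 r₀ := by
    intro z hz
    have h1 : ‖z‖ < ‖lam‖ ^ (0 + 1) * r := hz.2
    have h2 : ‖lam‖ ^ (0 + 1) * r = r₀ / 2 := by
      rw [hr_def, zero_add, pow_one]; field_simp
    rw [h2] at h1
    rw [mem_ball_zero_iff]; linarith
  have hinj := hinj₀.mono hann
  have hder : ∀ z ∈ ann ‖lam‖ r 0, c ≤ ‖deriv f z‖ := fun z hz => hder₀ z (hann hz)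
  obtain ⟨R₀, hR₀⟩ := isBounded_iff_forall_norm_le.1
    ((isCompact_closedBall (0 : ℂ) r₀).image hfd.continuous).isBounded
  obtain ⟨R, hRR, hR⟩ := exists_escR_ge hd (R₀ + 1)
  have hfR : ∀ z ∈ ann ‖lam‖ r 0, ‖f z‖ < R := fun z hz => by
    have := hR₀ (f z) (mem_image_of_mem f (ball_subset_closedBall (hann hz)))
    linarith
  obtain ⟨R', hR'⟩ := isBounded_iff_forall_norm_le.1
    ((isCompact_closedBall (0 : ℂ) R).image p.continuous).isBounded
  have hR'' : ∀ v : ℂ, ‖v‖ ≤ R → ‖p.eval v‖ ≤ R' := fun v hv =>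
    hR' _ (mem_image_of_mem _ (mem_closedBall_zero_iff.2 hv))
  obtain ⟨ε, hε, N, hN⟩ := hsh.exists_fibreBound hp
  have hK := hR.filled_subset_frontier hd hε hN hattr
  obtain ⟨q, hq, C, θ, hC, hθ0, hθ1, hvol⟩ := hR.volume_not_good_le hp hε
    (fun z hz => hN z (hR.frontier_subset_julia (hK hz))) hK hR''
  obtain ⟨A, hA, hDA⟩ := exists_nat_mul_pow_le hθ0 hθ1 p.natDegree
  have hev1 : ∀ᶠ m : ℕ in atTop, 2 * θ ^ m < 1 - θ ^ 2 := by
    have h1 : Tendsto (fun n : ℕ => 2 * θ ^ n) atTop (𝓝 0) := by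
      simpa using (_root_.tendsto_pow_atTop_nhds_zero_of_lt_one hθ0.le hθ1).const_mul (2 : ℝ)
    exact h1.eventually_lt_const (by nlinarith)
  have hev2 : ∀ᶠ m : ℕ in atTop, 2 * R' ≤ r * c * (27 / 25) ^ m :=
    ((tendsto_pow_atTop_atTop_of_one_lt (by norm_num : (1 : ℝ) < 27 / 25)).const_mul_atTop
      (mul_pos hr hc)).eventually_ge_atTop _
  obtain ⟨m₁, hm₁⟩ := eventually_atTop.1 (((hev1.and hev2).and
    (eventually_pow_mul_le_exp hlam1 hr A)).and (eventually_ge_atTop 1))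
  set Bd := badSet p f lam r R R' q with hBd
  have hlow : ∀ m z, z ∈ ann ‖lam‖ r m → z ∉ Bd →
      Real.log 2 * (6 / 5) ^ m ≤ Real.log ‖f z‖ := fun m z hz hzb =>
    growth_of_notMem_badSet hlam1 hfe hR hq hz hzb
  have hgrow : ∀ m ≥ m₁, ∀ z ∈ ann ‖lam‖ r m, z ∉ Bd → ‖lam‖ ^ (A * m) * r ≤ ‖f z‖ :=
    fun m hm z hz hzb => (hm₁ m hm).1.2.trans <|
      le_norm_of_le_log (norm_nonneg _) (by have := Real.log_pos one_lt_two; positivity)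
        (hlow m z hz hzb)
  have hexp : ∀ m ≥ m₁, ∀ z ∈ ann ‖lam‖ r m, z ∉ Bd → 2 * ‖f z‖ ≤ ‖z‖ * ‖deriv f z‖ :=
    fun m hm z hz hzb =>
      deriv_of_notMem_badSet hfd hlam1 hfe hR hc hder hq (hm₁ m hm).1.1.2 hz hzb
  have hbad := logArea_orbit_meets_bad hfd hlam1 hr hθ0 hθ1 (C := (r ^ 2)⁻¹ * (c ^ 2)⁻¹ * C)
    (by positivity) (measurableSet_badSet p hfd.continuous lam r R R' q)
    (fun m _ => logArea_badSet_le hfd hlam1 hr hinj hc hder hfR m (hvol m)) hgrow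
    (fun m hm z hz hzb => by
      have := hexp m hm z hz hzb
      have := norm_nonneg (f z)
      linarith)
    (fun m _ => fibre_ann_le hp hlam1 hfe hinj m) (by omega) hDA (hm₁ m₁ le_rfl).1.1.1.le
  obtain ⟨B, hB, D, hD, hup⟩ := poincare_growth hfd.continuous hlam1 hfe r
  obtain ⟨a₀, ha₀, hbd⟩ := hR.exists_bounded_orbit hd hfix hlam hl0 hfd hf0 hder0 hfe
  have hgood : ∀ z, z ∈ ext ‖lam‖ r m₁ → (∀ n, f^[n] z ∉ Bd ∪ (ext ‖lam‖ r m₁)ᶜ) →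
      z ∈ fastEscapingSet f ∩ juliaSet f := by
    intro z hz hn
    have hnB : ∀ n, f^[n] z ∉ Bd := fun n h => hn n (Or.inl h)
    have hnX : ∀ n, f^[n] z ∈ ext ‖lam‖ r m₁ := fun n => by
      by_contra h
      exact hn n (Or.inr h)
    have hesc := tendsto_norm_iterate hlam1 hr hA (hm₁ m₁ le_rfl).2 hgrow hz hnB
    refine ⟨mem_fastEscapingSet hf hlam1 hr hB hD hup (m₁ := m₁) (fun k m _ hkm => ?_) hesc,
      mem_juliaSet_of_expanding hfd hlam1 ha₀ (by have := hR.1; linarith) hbd hesc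
        (fun n => ?_) fun n h0 => ?_⟩
    · rw [Function.iterate_succ_apply']
      exact hlow m _ hkm (hnB k)
    · obtain ⟨i, hi⟩ := exists_mem_ann hlam1 hr (hnX n)
      rw [Function.iterate_succ_apply']
      exact hexp _ (Nat.le_add_right _ _) _ hi (hnB n)
    · have h1 : ‖lam‖ ^ m₁ * r ≤ ‖f^[n] z‖ := hnX n
      rw [h0, norm_zero] at h1
      have : 0 < ‖lam‖ ^ m₁ * r := by positivity
      linarith
  set T := Delta ∩ ball 0 (‖lam‖ ^ m₁ * r) with hT
  have hTm : MeasurableSet T :=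
    (measurableSet_le measurable_const measurable_norm).inter measurableSet_ball
  have hTfin : logArea T < ⊤ := by
    refine (logArea_le_volume one_pos hTm fun z hz => hz.1).trans_lt ?_
    exact ENNReal.mul_lt_top ENNReal.ofReal_lt_top
      ((measure_mono inter_subset_right).trans_lt measure_ball_lt_top)
  refine lt_of_le_of_lt ((logArea_mono ?_).trans (logArea_union_le T _))
    (ENNReal.add_lt_top.2 ⟨hTfin, hbad⟩)
  rintro z ⟨hz, hzn⟩
  by_cases hzX : z ∈ ext ‖lam‖ r m₁
  · right
    refine ⟨hzX, ?_⟩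
    by_contra! hcon
    exact hzn (hgood z hzX hcon)
  · left
    refine ⟨hz, mem_ball_zero_iff.2 ?_⟩
    exact not_le.1 hzX
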